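/- There exists a universal constant C > 0 such that for every dimension n ≥ 1, L_n ≤ C σ̲_n. -/

import Mathlib

open MeasureTheory Real Set Filter Topology RealInnerProductSpace
noncomputable section

abbrev EucSp (n : ℕ) := EuclideanSpace ℝ (Fin n)

/-- A nonnegative function is log-concave. -/
def IsLogConcaveFn {n : ℕ} (f : EucSp n → ℝ) : Prop :=
  (∀ x, 0 ≤ f x) ∧ ∀ x y : EucSp n, ∀ l : ℝ, l ∈ Set.Icc (0:ℝ) 1 →
    f x ^ (1 - l) * f y ^ l ≤ f ((1 - l) • x + l • y)

/-- A measure is log-concave if it has a log-concave density w.r.t. Lebesgue measure. -/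
def IsLogConcave {n : ℕ} (μ : Measure (EucSp n)) : Prop :=
  ∃ f : EucSp n → ℝ, IsLogConcaveFn f ∧
    μ = volume.withDensity (fun x => ENNReal.ofReal (f x))

/-- Barycenter at the origin and covariance matrix equal to the identity. -/
def IsIsotropic {n : ℕ} (μ : Measure (EucSp n)) : Prop :=
  (∫ x, x ∂μ = 0) ∧ ∀ u v : EucSp n, (∫ x, ⟪x, u⟫ * ⟪x, v⟫ ∂μ) = ⟪u, v⟫

/-- σ_n² = sup over isotropic log-concave random vectors of E (|X| - √n)². -/
def sigmaNSq (n : ℕ) : ℝ :=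
  sSup {v | ∃ μ : Measure (EucSp n), IsProbabilityMeasure μ ∧ IsIsotropic μ ∧
    IsLogConcave μ ∧ v = ∫ x, (‖x‖ - Real.sqrt n) ^ 2 ∂μ}

def sigmaN (n : ℕ) : ℝ := Real.sqrt (sigmaNSq n)

/-- σ̲_n = (1/√n) sup over isotropic log-concave random vectors of |E X |X|²|. -/
def sigmaBar (n : ℕ) : ℝ :=
  (Real.sqrt n)⁻¹ * sSup {v | ∃ μ : Measure (EucSp n), IsProbabilityMeasure μ ∧
    IsIsotropic μ ∧ IsLogConcave μ ∧ v = ‖∫ x, (‖x‖ ^ 2) • x ∂μ‖}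

/-- L_n = sup over isotropic log-concave probability densities f on ℝⁿ of f(0)^{1/n}. -/
def LN (n : ℕ) : ℝ :=
  sSup {l | ∃ (μ : Measure (EucSp n)) (f : EucSp n → ℝ),
    IsProbabilityMeasure μ ∧ IsIsotropic μ ∧ IsLogConcaveFn f ∧
    μ = volume.withDensity (fun x => ENNReal.ofReal (f x)) ∧
    l = f 0 ^ ((n : ℝ)⁻¹)}

/-- An integral depending holomorphically on a complex parameter, with locally uniform domination,
is an entire function of the parameter. -/
theorem differentiable_integral_of_locally_dominated {α : Type*} [MeasurableSpace α]
    {μ : Measure α} {F : ℂ → α → ℂ} (hm : ∀ z, AEStronglyMeasurable (F z) μ)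
    (hd : ∀ x, Differentiable ℂ fun z => F z x)
    (hb : ∀ r : ℝ, ∃ g : α → ℝ, Integrable g μ ∧ ∀ z : ℂ, ‖z‖ ≤ r → ∀ x, ‖F z x‖ ≤ g x) :
    Differentiable ℂ fun z => ∫ x, F z x ∂μ := by
  intro z₀
  obtain ⟨g, hg, hgb⟩ := hb (‖z₀‖ + 2)
  have hderiv_meas : AEStronglyMeasurable (fun x => deriv (fun z => F z x) z₀) μ := by
    have hseq : Tendsto (fun k : ℕ => z₀ + ((1 / ((k : ℝ) + 1) : ℝ) : ℂ)) atTop (𝓝[≠] z₀) := by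
      refine tendsto_nhdsWithin_iff.2 ⟨?_, Eventually.of_forall fun k => ?_⟩
      · have h := (Complex.continuous_ofReal.tendsto 0).comp
          (tendsto_one_div_add_atTop_nhds_zero_nat (𝕜 := ℝ))
        simpa using h.const_add z₀
      · have : ((1 / ((k : ℝ) + 1) : ℝ) : ℂ) ≠ 0 := by
          exact_mod_cast (by positivity : (1 / ((k : ℝ) + 1) : ℝ) ≠ 0)
        simpa using this
    refine aestronglyMeasurable_of_tendsto_ae atTop
      (f := fun (k : ℕ) x => slope (fun z => F z x) z₀ (z₀ + ((1 / ((k : ℝ) + 1) : ℝ) : ℂ)))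
      (fun k => ?_) (ae_of_all _ fun x => ?_)
    · simp only [slope, vsub_eq_sub]
      exact ((hm _).sub (hm _)).const_smul (z₀ + ((1 / ((k : ℝ) + 1) : ℝ) : ℂ) - z₀)⁻¹
    · exact ((hd x z₀).hasDerivAt.tendsto_slope).comp hseq
  refine (hasDerivAt_integral_of_dominated_loc_of_deriv_le (bound := g)
    (F' := fun z x => deriv (fun z => F z x) z) (Metric.ball_mem_nhds z₀ one_pos)
    (Eventually.of_forall hm) ?_ hderiv_meas (ae_of_all _ fun x z hz => ?_) hg
    (ae_of_all _ fun x z _ => (hd x z).hasDerivAt)).2.differentiableAt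
  · exact hg.mono' (hm z₀) (ae_of_all _ fun x => hgb z₀ (by linarith) x)
  · have := Complex.norm_deriv_le_of_forall_mem_sphere_norm_le (C := g x) one_pos
      (hd x).diffContOnCl (c := z) fun w hw => hgb w ?_ x
    · simpa using this
    · have h1 : ‖w - z‖ = 1 := by simpa [dist_eq_norm] using hw
      have h2 : ‖z - z₀‖ < 1 := by simpa [dist_eq_norm] using hz
      calc ‖w‖ = ‖(w - z) + (z - z₀) + z₀‖ := by ring_nf
        _ ≤ ‖w - z‖ + ‖z - z₀‖ + ‖z₀‖ := norm_add₃_le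
        _ ≤ _ := by linarith

section SmallPerturbation
variable {ι : Type*} [Fintype ι] [DecidableEq ι]

theorem Matrix.norm_toLin'_toCLM_le {N : Matrix ι ι ℝ} {δ : ℝ} (hδ : 0 ≤ δ)
    (hN : ∀ i j, |N i j| ≤ δ) :
    ‖LinearMap.toContinuousLinearMap (Matrix.toLin' N)‖ ≤ Fintype.card ι * δ := by
  refine ContinuousLinearMap.opNorm_le_bound _ (by positivity) fun x => ?_
  refine (pi_norm_le_iff_of_nonneg (by positivity)).2 fun i => ?_
  simp only [LinearMap.coe_toContinuousLinearMap', Matrix.toLin'_apply, Matrix.mulVec, dotProduct]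
  calc ‖∑ j, N i j * x j‖ ≤ ∑ j, ‖N i j * x j‖ := norm_sum_le _ _
    _ ≤ ∑ _j : ι, δ * ‖x‖ := Finset.sum_le_sum fun j _ => by
        rw [norm_mul]; exact mul_le_mul (hN i j) (norm_le_pi_norm x j) (norm_nonneg _) hδ
    _ = _ := by simp [mul_assoc]

theorem Matrix.det_smul_one_add_pos {N : Matrix ι ι ℝ} {δ ε : ℝ} (hδ : 0 ≤ δ)
    (hN : ∀ i j, |N i j| ≤ δ) (hε : Fintype.card ι * δ < ε) :
    0 < (ε • (1 : Matrix ι ι ℝ) + N).det := by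
  have hεpos : 0 < ε := lt_of_le_of_lt (by positivity) hε
  have hne : ∀ s ∈ Icc (0 : ℝ) 1, (ε • (1 : Matrix ι ι ℝ) + s • N).det ≠ 0 := by
    intro s hs h0
    obtain ⟨x, hx, hx0⟩ := Matrix.exists_mulVec_eq_zero_iff.2 h0
    have hxpos : 0 < ‖x‖ := norm_pos_iff.2 hx
    have h1 : ε • x = -(s • (LinearMap.toContinuousLinearMap (Matrix.toLin' N) x)) := by
      rw [Matrix.add_mulVec, Matrix.smul_mulVec, Matrix.smul_mulVec, Matrix.one_mulVec] at hx0
      simpa using eq_neg_of_add_eq_zero_left hx0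
    have h2 : ε * ‖x‖ ≤ Fintype.card ι * δ * ‖x‖ := by
      calc ε * ‖x‖ = ‖ε • x‖ := by rw [norm_smul, Real.norm_of_nonneg hεpos.le]
        _ = s * ‖LinearMap.toContinuousLinearMap (Matrix.toLin' N) x‖ := by
            rw [h1, norm_neg, norm_smul, Real.norm_of_nonneg hs.1]
        _ ≤ 1 * (Fintype.card ι * δ * ‖x‖) := by
            refine mul_le_mul hs.2 ?_ (norm_nonneg _) zero_le_one
            exact (ContinuousLinearMap.le_opNorm _ _).trans
              (mul_le_mul_of_nonneg_right (Matrix.norm_toLin'_toCLM_le hδ hN) (norm_nonneg _))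
        _ = _ := one_mul _
    nlinarith
  by_contra hcon
  push Not at hcon
  have hcont : ContinuousOn (fun s : ℝ => (ε • (1 : Matrix ι ι ℝ) + s • N).det) (Icc 0 1) := by
    apply Continuous.continuousOn
    fun_prop
  have h0 : (0 : ℝ) ≤ (ε • (1 : Matrix ι ι ℝ) + (0 : ℝ) • N).det := by
    simp; positivity
  obtain ⟨s, hs, hs0⟩ := intermediate_value_Icc' zero_le_one hcont ⟨by simpa using hcon, h0⟩
  exact hne s hs hs0

theorem integral_comp_mul_det_of_small_perturbation {ε δ : ℝ} (hδ : 0 ≤ δ)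
    (hε : Fintype.card ι * δ < ε) {w : (ι → ℝ) → ι → ℝ} {N : (ι → ℝ) → Matrix ι ι ℝ}
    (hw : ∀ X, HasFDerivAt w (LinearMap.toContinuousLinearMap (Matrix.toLin' (N X))) X)
    (hN : ∀ X i j, |N X i j| ≤ δ) (g : (ι → ℝ) → ℝ) :
    ∫ X, (ε • (1 : Matrix ι ι ℝ) + N X).det * g (ε • X + w X) = ∫ X, g X := by
  have hεpos : 0 < ε := lt_of_le_of_lt (by positivity) hε
  set L : NNReal := ⟨Fintype.card ι * δ, by positivity⟩ with hL
  have hlip : LipschitzWith L w := by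
    refine lipschitzWith_of_nnnorm_fderiv_le (fun X => (hw X).differentiableAt) fun X => ?_
    rw [(hw X).fderiv]
    exact_mod_cast Matrix.norm_toLin'_toCLM_le hδ (hN X)
  set Φ : (ι → ℝ) → ι → ℝ := fun X => ε • X + w X with hΦ
  have hcontr : ∀ y : ι → ℝ, ContractingWith (‖ε⁻¹‖₊ * L) fun X => ε⁻¹ • (y - w X) := by
    intro y
    refine ⟨?_, ?_⟩
    · rw [← NNReal.coe_lt_coe]
      push_cast
      rw [Real.norm_of_nonneg (by positivity)]
      change ε⁻¹ * (Fintype.card ι * δ) < 1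
      rw [inv_mul_lt_one₀ hεpos]; exact hε
    · have h2 : LipschitzWith L fun X => y - w X := by
        refine LipschitzWith.of_dist_le_mul fun a b => ?_
        rw [dist_sub_left]; exact hlip.dist_le_mul a b
      exact (lipschitzWith_smul (β := ι → ℝ) (ε⁻¹)).comp h2
  have hfix : ∀ y X, Φ X = y ↔ Function.IsFixedPt (fun X => ε⁻¹ • (y - w X)) X := by
    intro y X
    rw [Function.IsFixedPt, inv_smul_eq_iff₀ hεpos.ne', sub_eq_iff_eq_add, eq_comm]
  have hinj : Function.Injective Φ := fun a b hab =>
    (hcontr (Φ b)).fixedPoint_unique' ((hfix _ _).1 hab) ((hfix _ _).1 rfl)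
  have hsurj : Function.Surjective Φ := fun y =>
    ⟨_, (hfix y _).2 (hcontr y).fixedPoint_isFixedPt⟩
  have hder : ∀ X, HasFDerivAt Φ (LinearMap.toContinuousLinearMap
      (Matrix.toLin' (ε • (1 : Matrix ι ι ℝ) + N X))) X := by
    intro X
    have := ((hasFDerivAt_id (𝕜 := ℝ) X).const_smul ε).add (hw X)
    refine HasFDerivAt.congr_fderiv (f := Φ) this ?_
    ext1 x
    simp
  have := integral_image_eq_integral_abs_det_fderiv_smul volume MeasurableSet.univ
    (fun X _ => (hder X).hasFDerivWithinAt) hinj.injOn g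
  rw [image_univ, hsurj.range_eq, setIntegral_univ, setIntegral_univ] at this
  rw [this]
  refine integral_congr_ae (ae_of_all _ fun X => ?_)
  simp only [smul_eq_mul, ContinuousLinearMap.det, LinearMap.coe_toContinuousLinearMap,
    LinearMap.det_toLin']
  rw [abs_of_pos (Matrix.det_smul_one_add_pos hδ (hN X) hε)]

end SmallPerturbation

section Contour
variable {ι : Type*} [Fintype ι] [DecidableEq ι]

/-- The Gaussian form `exp (-∑ zᵢ²) dz` pulled back along the complex deformation
`z = ε X - τ² u X + τ v X`. -/
def deformedGaussian (ε : ℝ) (u v : (ι → ℝ) → ι → ℝ) (J K : (ι → ℝ) → Matrix ι ι ℝ)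
    (τ : ℂ) (X : ι → ℝ) : ℂ :=
  Complex.exp (-∑ i, ((ε * X i : ℂ) - τ ^ 2 * u X i + τ * v X i) ^ 2) *
    Matrix.det (Matrix.of fun i j =>
      (((ε • (1 : Matrix ι ι ℝ)) i j : ℝ) : ℂ) - τ ^ 2 * J X i j + τ * K X i j)

theorem neg_sq_add_re_le {a D : ℝ} {w : ℂ} (hw : ‖w‖ ≤ D) :
    (-((a : ℂ) + w) ^ 2).re ≤ -(a ^ 2 / 2) + 2 * D ^ 2 := by
  have h1 : |w.re| ≤ D := (Complex.abs_re_le_norm w).trans hw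
  have h2 : |w.im| ≤ D := (Complex.abs_im_le_norm w).trans hw
  have h3 := sq_le_sq' (neg_le_of_abs_le h1) (le_of_abs_le h1)
  have h4 := sq_le_sq' (neg_le_of_abs_le h2) (le_of_abs_le h2)
  simp only [sq, Complex.neg_re, Complex.mul_re, Complex.add_re, Complex.add_im,
    Complex.ofReal_re, Complex.ofReal_im]
  nlinarith [sq_nonneg (a + 2 * w.re)]

variable {ε C : ℝ} {u v : (ι → ℝ) → ι → ℝ} {J K : (ι → ℝ) → Matrix ι ι ℝ}

theorem norm_deformedGaussian_le (hub : ∀ X i, |u X i| ≤ C) (hvb : ∀ X i, |v X i| ≤ C)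
    (hJb : ∀ X i j, |J X i j| ≤ C) (hKb : ∀ X i j, |K X i j| ≤ C) {r : ℝ} {τ : ℂ}
    (hτ : ‖τ‖ ≤ r) (X : ι → ℝ) :
    ‖deformedGaussian ε u v J K τ X‖ ≤
      (∏ i, (rexp (2 * ((r ^ 2 + r) * C) ^ 2) * rexp (-(ε ^ 2 / 2) * X i ^ 2))) *
        ((Fintype.card ι).factorial • (|ε| + (r ^ 2 + r) * C) ^ Fintype.card ι) := by
  have hr : 0 ≤ r := (norm_nonneg _).trans hτ
  have key : ∀ a b : ℝ, |a| ≤ C → |b| ≤ C → ‖-τ ^ 2 * a + τ * b‖ ≤ (r ^ 2 + r) * C := by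
    intro a b ha hb
    calc ‖-τ ^ 2 * a + τ * b‖ ≤ ‖τ‖ ^ 2 * |a| + ‖τ‖ * |b| := by
          refine (norm_add_le _ _).trans (le_of_eq ?_)
          simp
      _ ≤ r ^ 2 * C + r * C := by gcongr
      _ = _ := by ring
  unfold deformedGaussian
  rw [norm_mul]
  refine mul_le_mul ?_ ?_ (norm_nonneg _) (by positivity)
  · rw [Complex.norm_exp, ← Finset.sum_neg_distrib, Complex.re_sum, Real.exp_sum]
    refine Finset.prod_le_prod (fun _ _ => (exp_pos _).le) fun i _ => ?_
    rw [← Real.exp_add]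
    refine Real.exp_le_exp.2 ?_
    have := neg_sq_add_re_le (a := ε * X i) (key _ _ (hub X i) (hvb X i))
    have e : (ε * X i : ℂ) - τ ^ 2 * u X i + τ * v X i
      = ((ε * X i : ℝ) : ℂ) + (-τ ^ 2 * u X i + τ * v X i) := by push_cast; ring
    rw [e]
    nlinarith
  · refine Matrix.det_le (abv := NormedField.toAbsoluteValue ℂ) fun i j => ?_
    change ‖(_ : ℂ)‖ ≤ _
    rw [Matrix.of_apply]
    have e : (((ε • (1 : Matrix ι ι ℝ)) i j : ℝ) : ℂ) - τ ^ 2 * J X i j + τ * K X i j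
      = (((ε • (1 : Matrix ι ι ℝ)) i j : ℝ) : ℂ) + (-τ ^ 2 * J X i j + τ * K X i j) := by ring
    rw [e]
    refine (norm_add_le _ _).trans (add_le_add ?_ (key _ _ (hJb X i j) (hKb X i j)))
    rw [Complex.norm_real, Matrix.smul_apply, norm_smul, Matrix.one_apply]
    split_ifs <;> simp

theorem differentiable_deformedGaussian (X : ι → ℝ) :
    Differentiable ℂ fun τ => deformedGaussian ε u v J K τ X := by
  unfold deformedGaussian
  simp only [Matrix.det_apply, Matrix.of_apply]
  fun_prop

theorem measurable_deformedGaussian (hu : Measurable u) (hv : Measurable v)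
    (hJ : ∀ i j, Measurable fun X => J X i j) (hK : ∀ i j, Measurable fun X => K X i j) (τ : ℂ) : Measurable (deformedGaussian ε u v J K τ) := by
  unfold deformedGaussian
  simp only [Matrix.det_apply, Matrix.of_apply]
  fun_prop

theorem deformedGaussian_ofReal (t : ℝ) (X : ι → ℝ) :
    deformedGaussian ε u v J K t X =
      (((ε • (1 : Matrix ι ι ℝ) + (-t ^ 2 • J X + t • K X)).det *
        rexp (-∑ i, (ε • X + (-t ^ 2 • u X + t • v X)) i ^ 2) : ℝ) : ℂ) := by
  unfold deformedGaussian
  rw [Complex.ofReal_mul, mul_comm]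
  congr 1
  · change _ = Complex.ofRealHom _
    rw [RingHom.map_det]
    congr 1
    ext i j
    simp
    ring
  · push_cast
    congr 2
    refine Finset.sum_congr rfl fun i _ => ?_
    simp
    ring

theorem integral_deformedGaussian (hε : 0 < ε) (hC : 0 ≤ C)
    (hu : ∀ X, HasFDerivAt u (LinearMap.toContinuousLinearMap (Matrix.toLin' (J X))) X)
    (hv : ∀ X, HasFDerivAt v (LinearMap.toContinuousLinearMap (Matrix.toLin' (K X))) X)
    (hJ : ∀ i j, Measurable fun X => J X i j) (hK : ∀ i j, Measurable fun X => K X i j)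
    (hub : ∀ X i, |u X i| ≤ C) (hvb : ∀ X i, |v X i| ≤ C)
    (hJb : ∀ X i j, |J X i j| ≤ C) (hKb : ∀ X i j, |K X i j| ≤ C) (τ : ℂ) :
    ∫ X, deformedGaussian ε u v J K τ X = ((√π ^ Fintype.card ι : ℝ) : ℂ) := by
  have hdiff : Differentiable ℂ fun τ => ∫ X, deformedGaussian ε u v J K τ X := by
    have hum : Measurable u :=
      (continuous_iff_continuousAt.2 fun X => (hu X).continuousAt).measurable
    have hvm : Measurable v :=
      (continuous_iff_continuousAt.2 fun X => (hv X).continuousAt).measurable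
    refine differentiable_integral_of_locally_dominated
      (fun z => (measurable_deformedGaussian hum hvm hJ hK z).aestronglyMeasurable)
      differentiable_deformedGaussian fun r =>
      ⟨_, ?_, fun z hz X => norm_deformedGaussian_le hub hvb hJb hKb hz X⟩
    refine Integrable.mul_const ?_ _
    refine Integrable.fintype_prod (f := fun _ x => rexp (2 * ((r ^ 2 + r) * C) ^ 2) *
      rexp (-(ε ^ 2 / 2) * x ^ 2)) fun i => ?_
    exact (integrable_exp_neg_mul_sq (by positivity)).const_mul _
  have hgauss : ∫ X : ι → ℝ, rexp (-∑ i, X i ^ 2) = √π ^ Fintype.card ι := by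
    simp_rw [← Finset.sum_neg_distrib, Real.exp_sum]
    rw [integral_fintype_prod_volume_eq_prod (fun (_ : ι) (x : ℝ) => rexp (-x ^ 2))]
    have := integral_gaussian 1
    simp at this
    simp [this]
  have hreal : ∀ᶠ t : ℝ in 𝓝 0, ∫ X, deformedGaussian ε u v J K t X =
      ((√π ^ Fintype.card ι : ℝ) : ℂ) := by
    have hlim : Tendsto (fun t : ℝ => (Fintype.card ι : ℝ) * ((t ^ 2 + |t|) * C)) (𝓝 0) (𝓝 0) := by
      have : Continuous fun t : ℝ => (Fintype.card ι : ℝ) * ((t ^ 2 + |t|) * C) := by fun_prop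
      simpa using this.tendsto 0
    filter_upwards [hlim.eventually_lt_const hε] with t ht
    simp_rw [deformedGaussian_ofReal]
    rw [integral_complex_ofReal, ← hgauss]
    congr 1
    refine integral_comp_mul_det_of_small_perturbation (δ := (t ^ 2 + |t|) * C) (by positivity) ht
      (w := fun X => -t ^ 2 • u X + t • v X) (fun X => ?_) (fun X i j => ?_)
      fun z => rexp (-∑ i, z i ^ 2)
    · refine HasFDerivAt.congr_fderiv (((hu X).const_smul (-t ^ 2)).add ((hv X).const_smul t)) ?_
      ext1 x
      simp
    · simp only [Matrix.add_apply, Matrix.smul_apply, smul_eq_mul]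
      calc |-t ^ 2 * J X i j + t * K X i j| ≤ t ^ 2 * |J X i j| + |t| * |K X i j| := by
            refine (abs_add_le _ _).trans (le_of_eq ?_)
            rw [abs_mul, abs_mul, abs_neg, abs_pow, sq_abs]
        _ ≤ t ^ 2 * C + |t| * C := by gcongr <;> apply_assumption
        _ = _ := by ring
  have hfreq : ∃ᶠ z in 𝓝[≠] (0 : ℂ), ∫ X, deformedGaussian ε u v J K z X =
      ((√π ^ Fintype.card ι : ℝ) : ℂ) := by
    have htend : Tendsto (fun t : ℝ => (t : ℂ)) (𝓝[≠] 0) (𝓝[≠] (0 : ℂ)) := by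
      refine tendsto_nhdsWithin_iff.2 ⟨?_, ?_⟩
      · simpa using (Complex.continuous_ofReal.tendsto 0).mono_left nhdsWithin_le_nhds
      · filter_upwards [self_mem_nhdsWithin] with t ht
        simpa using ht
    exact htend.frequently (hreal.filter_mono nhdsWithin_le_nhds).frequently
  exact congrFun (AnalyticOnNhd.eq_of_frequently_eq (fun z _ => hdiff.analyticAt z)
    (fun z _ => analyticAt_const) hfreq) τ
end Contour

section Doubling
variable {κ : Type*} [Fintype κ] [DecidableEq κ]

theorem Matrix.det_doubled_deformation {e : ℂ} (he : e ≠ 0) (P Q : Matrix κ κ ℂ) :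
    (Matrix.fromBlocks (e • (1 : Matrix κ κ ℂ) + (1 / (2 * e)) • P)
      (-Complex.I • (1 / (2 * e)) • Q) (Complex.I • (1 / (2 * e)) • P)
      (e • (1 : Matrix κ κ ℂ) + (1 / (2 * e)) • Q)).det =
      (e ^ 2 • (1 : Matrix κ κ ℂ) + (1 / 2 : ℂ) • (P + Q)).det := by
  have h1 : (Matrix.fromBlocks (1 : Matrix κ κ ℂ) 0 (-Complex.I • (1 : Matrix κ κ ℂ)) 1).det = 1 := by
    simp
  have h2 : (Matrix.fromBlocks (1 : Matrix κ κ ℂ) 0 (Complex.I • (1 : Matrix κ κ ℂ)) 1).det = 1 := by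
    simp
  set M := Matrix.fromBlocks (e • (1 : Matrix κ κ ℂ) + (1 / (2 * e)) • P)
      (-Complex.I • (1 / (2 * e)) • Q) (Complex.I • (1 / (2 * e)) • P)
      (e • (1 : Matrix κ κ ℂ) + (1 / (2 * e)) • Q) with hM
  have h3 : Matrix.fromBlocks (1 : Matrix κ κ ℂ) 0 (-Complex.I • (1 : Matrix κ κ ℂ)) 1 * M *
      Matrix.fromBlocks (1 : Matrix κ κ ℂ) 0 (Complex.I • (1 : Matrix κ κ ℂ)) 1 =
      Matrix.fromBlocks (e • (1 : Matrix κ κ ℂ) + (1 / (2 * e)) • (P + Q))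
        (-Complex.I • (1 / (2 * e)) • Q) 0 (e • (1 : Matrix κ κ ℂ)) := by
    rw [hM, Matrix.fromBlocks_multiply, Matrix.fromBlocks_multiply]
    congr 1 <;> ext i j <;> simp [← mul_assoc] <;> ring_nf <;> simp
  have h4 := congrArg Matrix.det h3
  rw [Matrix.det_mul, Matrix.det_mul, h1, h2, Matrix.det_fromBlocks_zero₂₁, mul_one, one_mul,
    ← Matrix.det_mul] at h4
  rw [h4]
  congr 1
  ext i j
  simp
  field_simp

theorem pi_pow_le_integral_of_hasFDerivAt {ε C : ℝ} (hε : 0 < ε) (hC : 0 ≤ C)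
    {y : (κ → ℝ) → κ → ℝ} {H : (κ → ℝ) → Matrix κ κ ℝ}
    (hy : ∀ x, HasFDerivAt y (LinearMap.toContinuousLinearMap (Matrix.toLin' (H x))) x)
    (hH : ∀ i j, Measurable fun x => H x i j)
    (hyb : ∀ x i, |y x i| ≤ C) (hHb : ∀ x i j, |H x i j| ≤ C) :
    π ^ Fintype.card κ ≤ ∫ p : (κ → ℝ) × (κ → ℝ),
      rexp (-(ε ^ 2 * (p.1 ⬝ᵥ p.1 + p.2 ⬝ᵥ p.2) + (p.1 ⬝ᵥ y p.1 + p.2 ⬝ᵥ y p.2))) *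
        |(ε ^ 2 • (1 : Matrix κ κ ℝ) + (1 / 2 : ℝ) • (H p.1 + H p.2)).det| := by
  set a : ℝ := 1 / (2 * ε) with ha
  have ha0 : 0 < a := by positivity
  set l : (κ ⊕ κ → ℝ) → κ → ℝ := fun X i => X (Sum.inl i) with hl
  set r : (κ ⊕ κ → ℝ) → κ → ℝ := fun X i => X (Sum.inr i) with hr
  have hlc : Continuous l := by fun_prop
  have hrc : Continuous r := by fun_prop
  set u : (κ ⊕ κ → ℝ) → κ ⊕ κ → ℝ := fun X => Sum.elim (a • y (l X)) (a • y (r X)) with hu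
  set v : (κ ⊕ κ → ℝ) → κ ⊕ κ → ℝ := fun X => Sum.elim (-a • y (r X)) (a • y (l X)) with hv
  set J : (κ ⊕ κ → ℝ) → Matrix (κ ⊕ κ) (κ ⊕ κ) ℝ :=
    fun X => Matrix.fromBlocks (a • H (l X)) 0 0 (a • H (r X)) with hJ
  set K : (κ ⊕ κ → ℝ) → Matrix (κ ⊕ κ) (κ ⊕ κ) ℝ :=
    fun X => Matrix.fromBlocks 0 (-a • H (r X)) (a • H (l X)) 0 with hK
  have hyl : ∀ X i, HasFDerivAt (fun X => y (l X) i)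
      ((ContinuousLinearMap.proj i).comp ((LinearMap.toContinuousLinearMap
        (Matrix.toLin' (H (l X)))).comp (LinearMap.toContinuousLinearMap
          (LinearMap.funLeft ℝ ℝ Sum.inl)))) X := by
    intro X i
    have h1 : HasFDerivAt l (LinearMap.toContinuousLinearMap (LinearMap.funLeft ℝ ℝ Sum.inl)) X :=
      (LinearMap.toContinuousLinearMap (LinearMap.funLeft ℝ ℝ
        (Sum.inl : κ → κ ⊕ κ))).hasFDerivAt
    exact (hasFDerivAt_apply (𝕜 := ℝ) i _).comp X ((hy (l X)).comp X h1)
  have hyr : ∀ X i, HasFDerivAt (fun X => y (r X) i)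
      ((ContinuousLinearMap.proj i).comp ((LinearMap.toContinuousLinearMap
        (Matrix.toLin' (H (r X)))).comp (LinearMap.toContinuousLinearMap
          (LinearMap.funLeft ℝ ℝ Sum.inr)))) X := by
    intro X i
    have h1 : HasFDerivAt r (LinearMap.toContinuousLinearMap (LinearMap.funLeft ℝ ℝ Sum.inr)) X :=
      (LinearMap.toContinuousLinearMap (LinearMap.funLeft ℝ ℝ
        (Sum.inr : κ → κ ⊕ κ))).hasFDerivAt
    exact (hasFDerivAt_apply (𝕜 := ℝ) i _).comp X ((hy (r X)).comp X h1)
  have hud : ∀ X, HasFDerivAt u (LinearMap.toContinuousLinearMap (Matrix.toLin' (J X))) X := by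
    intro X
    refine hasFDerivAt_pi'.2 fun s => ?_
    rcases s with i | i
    · refine HasFDerivAt.congr_fderiv ((hyl X i).const_smul a) ?_
      ext1 Z
      simp [hJ, Matrix.fromBlocks_mulVec, LinearMap.funLeft, Matrix.smul_mulVec]
    · refine HasFDerivAt.congr_fderiv ((hyr X i).const_smul a) ?_
      ext1 Z
      simp [hJ, Matrix.fromBlocks_mulVec, LinearMap.funLeft, Matrix.smul_mulVec]
  have hvd : ∀ X, HasFDerivAt v (LinearMap.toContinuousLinearMap (Matrix.toLin' (K X))) X := by
    intro X
    refine hasFDerivAt_pi'.2 fun s => ?_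
    rcases s with i | i
    · refine HasFDerivAt.congr_fderiv ((hyr X i).const_smul (-a)) ?_
      ext1 Z
      simp [hK, Matrix.fromBlocks_mulVec, LinearMap.funLeft, Matrix.neg_mulVec, Matrix.smul_mulVec]
    · refine HasFDerivAt.congr_fderiv ((hyl X i).const_smul a) ?_
      ext1 Z
      simp [hK, Matrix.fromBlocks_mulVec, LinearMap.funLeft, Matrix.smul_mulVec]
  have hHl : ∀ i j, Measurable fun X => H (l X) i j := fun i j => (hH i j).comp hlc.measurable
  have hHr : ∀ i j, Measurable fun X => H (r X) i j := fun i j => (hH i j).comp hrc.measurable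
  have hJm : ∀ s t, Measurable fun X => J X s t := by
    rintro (i | i) (j | j) <;> simp [hJ] <;> first | exact (hHl i j).const_mul a | exact (hHr i j).const_mul a
  have hKm : ∀ s t, Measurable fun X => K X s t := by
    rintro (i | i) (j | j) <;> simp [hK] <;>
      first | exact (hHl i j).const_mul a | exact (hHr i j).const_mul a
  have hub : ∀ X s, |u X s| ≤ a * C := by
    rintro X (i | i) <;> simp [hu, abs_mul, abs_of_pos ha0] <;> gcongr <;> apply hyb
  have hvb : ∀ X s, |v X s| ≤ a * C := by
    rintro X (i | i) <;> simp [hv, abs_mul, abs_of_pos ha0] <;> gcongr <;> apply hyb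
  have haC : 0 ≤ a * C := by positivity
  have hJb : ∀ X s t, |J X s t| ≤ a * C := by
    rintro X (i | i) (j | j) <;> simp [hJ, abs_mul, abs_of_pos ha0, haC] <;> gcongr <;> apply hHb
  have hKb : ∀ X s t, |K X s t| ≤ a * C := by
    rintro X (i | i) (j | j) <;> simp [hK, abs_mul, abs_of_pos ha0, haC] <;> gcongr <;> apply hHb
  have hint := integral_deformedGaussian hε haC hud hvd hJm hKm hub hvb hJb hKb Complex.I
  have hnorm : ∀ X, ‖deformedGaussian ε u v J K Complex.I X‖ =
      rexp (-(ε ^ 2 * (l X ⬝ᵥ l X + r X ⬝ᵥ r X) + (l X ⬝ᵥ y (l X) + r X ⬝ᵥ y (r X)))) *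
        |(ε ^ 2 • (1 : Matrix κ κ ℝ) + (1 / 2 : ℝ) • (H (l X) + H (r X))).det| := by
    intro X
    unfold deformedGaussian
    rw [norm_mul]
    congr 1
    · rw [Complex.norm_exp]
      congr 1
      rw [Complex.neg_re, Complex.re_sum, Fintype.sum_sum_type]
      congr 1
      simp only [dotProduct, Finset.mul_sum, ← Finset.sum_add_distrib]
      refine Finset.sum_congr rfl fun i _ => ?_
      simp [sq, hu, hv, hl, hr]
      rw [ha]
      field_simp
      ring
    · rw [← Real.norm_eq_abs, ← Complex.norm_real]
      congr 1
      have h0 := Matrix.det_doubled_deformation (e := (ε : ℂ)) (by exact_mod_cast hε.ne')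
        ((H (l X)).map Complex.ofRealHom) ((H (r X)).map Complex.ofRealHom)
      change _ = Complex.ofRealHom _
      rw [RingHom.map_det]
      trans
      swap
      · trans
        · exact h0
        · congr 1
          ext i j
          by_cases h : i = j <;> simp [h]
      · congr 1
        ext s t
        rcases s with i | i <;> rcases t with j | j <;> by_cases h : i = j <;>
          simp [hJ, hK, ha, h, Matrix.one_apply]
  have hle := norm_integral_le_integral_norm (μ := volume)
    (fun X => deformedGaussian ε u v J K Complex.I X)
  rw [hint, Complex.norm_real, Real.norm_of_nonneg (by positivity)] at hle
  have hcard : √π ^ Fintype.card (κ ⊕ κ) = π ^ Fintype.card κ := by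
    rw [Fintype.card_sum, ← two_mul, pow_mul, Real.sq_sqrt pi_pos.le]
  rw [hcard] at hle
  refine hle.trans (le_of_eq ?_)
  simp_rw [hnorm]
  exact (volume_measurePreserving_sumPiEquivProdPi (fun _ : κ ⊕ κ => ℝ)).integral_comp'
    (fun p : (κ → ℝ) × (κ → ℝ) =>
      rexp (-(ε ^ 2 * (p.1 ⬝ᵥ p.1 + p.2 ⬝ᵥ p.2) + (p.1 ⬝ᵥ y p.1 + p.2 ⬝ᵥ y p.2))) *
        |(ε ^ 2 • (1 : Matrix κ κ ℝ) + (1 / 2 : ℝ) • (H p.1 + H p.2)).det|)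
end Doubling

theorem integrable_exp_neg_mul_norm {E : Type*} [NormedAddCommGroup E] [NormedSpace ℝ E]
    [FiniteDimensional ℝ E] [MeasurableSpace E] [BorelSpace E] (μ : Measure E)
    [μ.IsAddHaarMeasure] {c : ℝ} (hc : 0 < c) : Integrable (fun x : E => rexp (-(c * ‖x‖))) μ := by
  set m : ℕ := Module.finrank ℝ E + 1 with hm
  have h := (integrable_one_add_norm (E := E) (μ := μ) (r := (m : ℝ))
    (by rw [hm]; push_cast; linarith)).const_mul (rexp c * m.factorial / c ^ m)
  refine h.mono' (by fun_prop) (ae_of_all _ fun x => ?_)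
  rw [Real.norm_of_nonneg (exp_pos _).le, Real.rpow_neg (by positivity), Real.rpow_natCast]
  have h1 := Real.pow_div_factorial_le_exp (c * (1 + ‖x‖)) (by positivity) m
  rw [show -(c * ‖x‖) = c - c * (1 + ‖x‖) by ring, Real.exp_sub, div_mul_eq_mul_div, mul_assoc,
    mul_div_assoc]
  refine mul_le_mul_of_nonneg_left ?_ (exp_pos _).le
  rw [inv_le_comm₀ (exp_pos _) (by positivity)]
  refine le_trans (le_of_eq ?_) h1
  rw [mul_pow]
  field_simp

section Doubling
variable {κ : Type*} [Fintype κ] [DecidableEq κ]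

theorem pi_pow_le_lintegral_of_growth {C c c₀ : ℝ} (hC : 0 ≤ C) (hc : 0 < c)
    {y : (κ → ℝ) → κ → ℝ} {H : (κ → ℝ) → Matrix κ κ ℝ}
    (hy : ∀ x, HasFDerivAt y (LinearMap.toContinuousLinearMap (Matrix.toLin' (H x))) x)
    (hH : ∀ i j, Measurable fun x => H x i j)
    (hyb : ∀ x i, |y x i| ≤ C) (hHb : ∀ x i j, |H x i j| ≤ C)
    (hgrowth : ∀ x, c * ‖x‖ - c₀ ≤ x ⬝ᵥ y x) :
    ENNReal.ofReal (π ^ Fintype.card κ) ≤ ∫⁻ p : (κ → ℝ) × (κ → ℝ),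
      ENNReal.ofReal (rexp (-(p.1 ⬝ᵥ y p.1 + p.2 ⬝ᵥ y p.2)) *
        |((1 / 2 : ℝ) • (H p.1 + H p.2)).det|) := by
  have hyc : Continuous y := continuous_iff_continuousAt.2 fun x => (hy x).continuousAt
  set G : ℝ → (κ → ℝ) × (κ → ℝ) → ℝ := fun ε p =>
    rexp (-(ε ^ 2 * (p.1 ⬝ᵥ p.1 + p.2 ⬝ᵥ p.2) + (p.1 ⬝ᵥ y p.1 + p.2 ⬝ᵥ y p.2))) *
        |(ε ^ 2 • (1 : Matrix κ κ ℝ) + (1 / 2 : ℝ) • (H p.1 + H p.2)).det| with hG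
  have hGm : ∀ ε, Measurable (G ε) := by
    intro ε
    have hd : Continuous fun p : (κ → ℝ) × (κ → ℝ) =>
        ε ^ 2 * (p.1 ⬝ᵥ p.1 + p.2 ⬝ᵥ p.2) + (p.1 ⬝ᵥ y p.1 + p.2 ⬝ᵥ y p.2) := by
      simp only [dotProduct]
      fun_prop
    have h1 : ∀ i j, Measurable fun p : (κ → ℝ) × (κ → ℝ) => H p.1 i j :=
      fun i j => (hH i j).comp measurable_fst
    have h2 : ∀ i j, Measurable fun p : (κ → ℝ) × (κ → ℝ) => H p.2 i j :=
      fun i j => (hH i j).comp measurable_snd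
    refine (measurable_exp.comp hd.measurable.neg).mul ?_
    simp only [Matrix.det_apply, Matrix.add_apply, Matrix.smul_apply]
    exact Measurable.abs (by fun_prop)
  set B : (κ → ℝ) × (κ → ℝ) → ℝ := fun p =>
    (rexp (-(c * ‖p.1‖)) * rexp (-(c * ‖p.2‖))) * (rexp (2 * c₀) *
      ((Fintype.card κ).factorial • (1 + C) ^ Fintype.card κ)) with hB
  have hBi : Integrable B := by
    refine Integrable.mul_const ?_ _
    exact (integrable_exp_neg_mul_norm volume hc).mul_prod (integrable_exp_neg_mul_norm volume hc)
  have hGB : ∀ ε ∈ Icc (0 : ℝ) 1, ∀ p, G ε p ≤ B p := by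
    rintro ε ⟨h0, h1⟩ p
    simp only [hG, hB]
    rw [← mul_assoc, ← Real.exp_add, ← Real.exp_add]
    refine mul_le_mul (Real.exp_le_exp.2 ?_) ?_ (abs_nonneg _) (exp_pos _).le
    · have a1 := hgrowth p.1
      have a2 := hgrowth p.2
      have a3 : 0 ≤ p.1 ⬝ᵥ p.1 := Finset.sum_nonneg fun i _ => mul_self_nonneg _
      have a4 : 0 ≤ p.2 ⬝ᵥ p.2 := Finset.sum_nonneg fun i _ => mul_self_nonneg _
      have a5 : 0 ≤ ε ^ 2 * (p.1 ⬝ᵥ p.1 + p.2 ⬝ᵥ p.2) := by positivity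
      linarith
    · refine Matrix.det_le (abv := AbsoluteValue.abs) fun i j => ?_
      simp only [AbsoluteValue.abs_apply, Matrix.add_apply, Matrix.smul_apply, smul_eq_mul]
      refine (abs_add_le _ _).trans (add_le_add ?_ ?_)
      · rw [Matrix.one_apply]
        split_ifs
        · rw [mul_one, abs_of_nonneg (by positivity)]
          exact pow_le_one₀ h0 h1
        · simp
      · have b1 := hHb p.1 i j
        have b2 := hHb p.2 i j
        rw [abs_le] at *
        constructor <;> linarith [b1.1, b1.2, b2.1, b2.2]
  have hG0 : ∀ ε p, 0 ≤ G ε p := fun ε p => by positivity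
  have hlim : Tendsto (fun k : ℕ => ∫ p, G (1 / ((k : ℝ) + 1)) p) atTop (𝓝 (∫ p, G 0 p)) := by
    refine tendsto_integral_of_dominated_convergence B (fun k => (hGm _).aestronglyMeasurable) hBi
      (fun k => ae_of_all _ fun p => ?_) (ae_of_all _ fun p => ?_)
    · rw [Real.norm_of_nonneg (hG0 _ _)]
      refine hGB _ ⟨by positivity, ?_⟩ p
      rw [div_le_one (by positivity)]
      linarith [(Nat.cast_nonneg k : (0 : ℝ) ≤ k)]
    · have hcont : Continuous fun ε => G ε p := by
        simp only [hG]
        fun_prop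
      exact (hcont.tendsto 0).comp (tendsto_one_div_add_atTop_nhds_zero_nat (𝕜 := ℝ))
  have hle : π ^ Fintype.card κ ≤ ∫ p, G 0 p :=
    ge_of_tendsto' hlim fun k => pi_pow_le_integral_of_hasFDerivAt (by positivity) hC hy hH hyb hHb
  calc ENNReal.ofReal (π ^ Fintype.card κ) ≤ ENNReal.ofReal (∫ p, G 0 p) :=
        ENNReal.ofReal_le_ofReal hle
    _ ≤ ∫⁻ p, ENNReal.ofReal (G 0 p) := by
        rw [integral_eq_lintegral_of_nonneg_ae (ae_of_all _ (hG0 0)) (hGm 0).aestronglyMeasurable]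
        exact ENNReal.ofReal_toReal_le
    _ = _ := by simp [hG]
end Doubling

section Convexity
variable {κ : Type*} [Fintype κ]

/-- A log-concave probability density on `κ → ℝ` whose positivity set is open and bounded. -/
structure IsRegularDensity (f : (κ → ℝ) → ℝ) : Prop where
  nonneg : ∀ x, 0 ≤ f x
  logConcave : ∀ x y, ∀ l ∈ Icc (0 : ℝ) 1, f x ^ (1 - l) * f y ^ l ≤ f ((1 - l) • x + l • y)
  isOpen : IsOpen {x | 0 < f x}
  measurable : Measurable f
  bounded : ∃ R : ℝ, 0 ≤ R ∧ ∀ x, f x ≠ 0 → ‖x‖ ≤ R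
  integral_eq_one : ∫ x, f x = 1

namespace IsRegularDensity
variable {f : (κ → ℝ) → ℝ}

theorem convex (hf : IsRegularDensity f) : Convex ℝ {x | 0 < f x} := by
  intro x hx y hy a b ha hb hab
  have h := hf.logConcave x y b ⟨hb, by linarith⟩
  rw [show 1 - b = a by linarith] at h
  exact lt_of_lt_of_le (mul_pos (rpow_pos_of_pos hx _) (rpow_pos_of_pos hy _)) h

theorem mul_le_sq_midpoint (hf : IsRegularDensity f) (x y : κ → ℝ) :
    f x * f y ≤ f ((1 / 2 : ℝ) • (x + y)) ^ 2 := by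
  have h := hf.logConcave x y (1 / 2) ⟨by norm_num, by norm_num⟩
  rw [show (1 : ℝ) - 1 / 2 = 1 / 2 by norm_num, ← smul_add, ← Real.sqrt_eq_rpow,
    ← Real.sqrt_eq_rpow, ← Real.sqrt_mul (hf.nonneg x)] at h
  calc f x * f y = √(f x * f y) ^ 2 :=
        (Real.sq_sqrt (mul_nonneg (hf.nonneg x) (hf.nonneg y))).symm
    _ ≤ _ := pow_le_pow_left₀ (Real.sqrt_nonneg _) h 2

theorem concaveOn_log (hf : IsRegularDensity f) :
    ConcaveOn ℝ {x | 0 < f x} fun x => Real.log (f x) := by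
  refine ⟨hf.convex, fun x hx y hy a b ha hb hab => ?_⟩
  have h := hf.logConcave x y b ⟨hb, by linarith⟩
  rw [show 1 - b = a by linarith] at h
  have hx' : 0 < f x := hx
  have hy' : 0 < f y := hy
  have h2 := Real.log_le_log (mul_pos (rpow_pos_of_pos hx' _) (rpow_pos_of_pos hy' _)) h
  rwa [Real.log_mul (rpow_pos_of_pos hx' _).ne' (rpow_pos_of_pos hy' _).ne', Real.log_rpow hx',
    Real.log_rpow hy'] at h2

/-- Exponential majorant touching a log-concave density at a point of its support. -/
theorem exists_le_mul_exp (hf : IsRegularDensity f) {b : κ → ℝ} (hb : 0 < f b) :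
    ∃ l : (κ → ℝ) →L[ℝ] ℝ, ∀ x, f x ≤ f b * rexp (l (x - b)) := by
  have hc := hf.concaveOn_log
  have hcont : ContinuousOn (fun x => Real.log (f x)) {x | 0 < f x} := hc.continuousOn hf.isOpen
  set S : Set ((κ → ℝ) × ℝ) := {p | p.1 ∈ {x | 0 < f x} ∧ p.2 < Real.log (f p.1)} with hS
  have hSo : IsOpen S := by
    have h1 : IsOpen (Prod.fst ⁻¹' {x | 0 < f x} : Set ((κ → ℝ) × ℝ)) :=
      hf.isOpen.preimage continuous_fst
    have h2 : ContinuousOn (fun p : (κ → ℝ) × ℝ => Real.log (f p.1) - p.2)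
        (Prod.fst ⁻¹' {x | 0 < f x}) :=
      (hcont.comp continuousOn_fst fun p hp => hp).sub continuousOn_snd
    convert h2.isOpen_inter_preimage h1 (isOpen_Ioi (a := (0 : ℝ))) using 1
    ext p
    simp [hS]
  obtain ⟨φ, hφ⟩ := geometric_hahn_banach_open_point hc.convex_strict_hypograph hSo
    (x := (b, Real.log (f b))) (fun h => lt_irrefl _ h.2)
  have hsplit : ∀ (x : κ → ℝ) (t : ℝ), φ (x, t) = φ (x, 0) + t * φ (0, 1) := by
    intro x t
    have : ((x, t) : (κ → ℝ) × ℝ) = (x, 0) + t • (0, 1) := by ext <;> simp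
    rw [this, map_add, map_smul, smul_eq_mul]
  have hcpos : 0 < φ (0, 1) := by
    have := hφ (b, Real.log (f b) - 1) ⟨hb, by simp⟩
    rw [hsplit b (_ - 1), hsplit b (Real.log _)] at this
    linarith
  refine ⟨-(φ (0, 1))⁻¹ • φ.comp (ContinuousLinearMap.inl ℝ (κ → ℝ) ℝ), fun x => ?_⟩
  rcases (hf.nonneg x).eq_or_lt with h0 | h0
  · rw [← h0]; positivity
  have key : φ (x, 0) + Real.log (f x) * φ (0, 1) ≤ φ (b, 0) + Real.log (f b) * φ (0, 1) := by
    refine le_of_forall_pos_lt_add fun e he => ?_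
    have := hφ (x, Real.log (f x) - e / φ (0, 1)) ⟨h0, by simp; positivity⟩
    rw [hsplit, hsplit b, sub_mul, div_mul_cancel₀ _ hcpos.ne'] at this
    linarith
  rw [← Real.log_le_log_iff h0 (by positivity), Real.log_mul hb.ne' (exp_pos _).ne', Real.log_exp]
  have hsub : φ (x - b, 0) = φ (x, 0) - φ (b, 0) := by
    rw [← map_sub]; simp
  simp only [_root_.smul_apply, ContinuousLinearMap.comp_apply,
    ContinuousLinearMap.inl_apply, hsub, smul_eq_mul]
  have : Real.log (f x) - Real.log (f b) ≤ (φ (b, 0) - φ (x, 0)) / φ (0, 1) := by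
    rw [le_div_iff₀ hcpos]; linarith
  calc _ ≤ Real.log (f b) + (φ (b, 0) - φ (x, 0)) / φ (0, 1) := by linarith
    _ = _ := by ring

theorem integrable (hf : IsRegularDensity f) : Integrable f := by
  by_contra h
  have := hf.integral_eq_one
  rw [integral_undef h] at this
  norm_num at this

theorem integrable_mul (hf : IsRegularDensity f) {g : (κ → ℝ) → ℝ} (hg : Continuous g) :
    Integrable fun x => g x * f x := by
  obtain ⟨R, hR, hb⟩ := hf.bounded
  obtain ⟨C, hC⟩ := (isCompact_closedBall (0 : κ → ℝ) R).exists_bound_of_continuousOn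
    hg.continuousOn
  refine (hf.integrable.const_mul C).mono'
    (hg.aestronglyMeasurable.mul hf.measurable.aestronglyMeasurable) (ae_of_all _ fun x => ?_)
  rw [norm_mul, Real.norm_of_nonneg (hf.nonneg x)]
  by_cases h : f x = 0
  · simp [h]
  · exact mul_le_mul_of_nonneg_right (hC x (by simpa using hb x h)) (hf.nonneg x)

theorem lintegral_eq_one (hf : IsRegularDensity f) : ∫⁻ x, ENNReal.ofReal (f x) = 1 := by
  rw [← ofReal_integral_eq_lintegral_ofReal hf.integrable (ae_of_all _ hf.nonneg),
    hf.integral_eq_one, ENNReal.ofReal_one]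

theorem integral_clm_mul (hf : IsRegularDensity f) {b : κ → ℝ}
    (hb : ∀ i, ∫ x, x i * f x = b i) (φ : (κ → ℝ) →L[ℝ] ℝ) : ∫ x, φ x * f x = φ b := by
  classical
  have hsum : ∀ x, φ x = ∑ i, x i * φ (Pi.single i 1) := by
    intro x
    conv_lhs => rw [← Finset.univ_sum_single x]
    rw [map_sum]
    refine Finset.sum_congr rfl fun i _ => ?_
    rw [← smul_eq_mul, ← map_smul, ← Pi.single_smul, smul_eq_mul, mul_one]
  have hsum' : (fun x => φ x * f x) = fun x => ∑ i, x i * φ (Pi.single i 1) * f x := by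
    ext x; rw [hsum, Finset.sum_mul]
  rw [hsum', hsum b]
  rw [integral_finsetSum _ fun i _ => hf.integrable_mul (by fun_prop)]
  refine Finset.sum_congr rfl fun i _ => ?_
  rw [← hb i, ← integral_mul_const]
  congr 1; ext x; ring

theorem pos_of_barycenter (hf : IsRegularDensity f) {b : κ → ℝ}
    (hb : ∀ i, ∫ x, x i * f x = b i) : 0 < f b := by
  by_contra hcon
  obtain ⟨φ, hφ⟩ := geometric_hahn_banach_open_point hf.convex hf.isOpen hcon
  have hint := hf.integral_clm_mul hb φ
  have hzero : ∫ x, (φ b - φ x) * f x = 0 := by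
    simp_rw [sub_mul]
    rw [integral_sub (hf.integrable.const_mul _) (hf.integrable_mul φ.continuous), hint,
      integral_const_mul, hf.integral_eq_one, mul_one, sub_self]
  have hnn : ∀ x, 0 ≤ (φ b - φ x) * f x := by
    intro x
    rcases (hf.nonneg x).eq_or_lt with h | h
    · rw [← h, mul_zero]
    · exact mul_nonneg (sub_nonneg.2 (hφ x h).le) h.le
  have hae := (integral_eq_zero_iff_of_nonneg hnn
    (hf.integrable_mul (g := fun x => φ b - φ x) (by fun_prop))).1 hzero
  have hf0 : f =ᵐ[volume] 0 := by
    filter_upwards [hae] with x hx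
    rcases (hf.nonneg x).eq_or_lt with h | h
    · exact h.symm
    · exact absurd hx (mul_pos (sub_pos.2 (hφ x h)) h).ne'
  have := hf.integral_eq_one
  rw [integral_congr_ae hf0] at this
  simp at this

theorem le_four_pow_mul_of_barycenter (hf : IsRegularDensity f) {b : κ → ℝ}
    (hb : ∀ i, ∫ x, x i * f x = b i) (x₀ : κ → ℝ) : f x₀ ≤ 4 ^ Fintype.card κ * f b := by
  have hpos := hf.pos_of_barycenter hb
  obtain ⟨l, hl⟩ := hf.exists_le_mul_exp hpos
  have hint := hf.integral_clm_mul hb l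
  have hmid : ∀ x, √(f x₀) * √(f x) ≤ f ((1 / 2 : ℝ) • (x₀ + x)) := by
    intro x
    rw [← Real.sqrt_mul (hf.nonneg _)]
    exact Real.sqrt_le_iff.2 ⟨hf.nonneg _, hf.mul_le_sq_midpoint _ _⟩
  have hlow : ∀ x, (1 - l (x - b) / 2) * f x ≤ √(f b) * √(f x) := by
    intro x
    rcases (hf.nonneg x).eq_or_lt with h | h
    · rw [← h]; simp
    have h1 : 1 - l (x - b) / 2 ≤ rexp (-(l (x - b) / 2)) := by
      linarith [Real.add_one_le_exp (-(l (x - b) / 2))]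
    have h2 : √(f x) ≤ √(f b) * rexp (l (x - b) / 2) := by
      rw [Real.sqrt_le_left (by positivity), mul_pow, Real.sq_sqrt hpos.le, ← Real.exp_nat_mul]
      refine (hl x).trans (le_of_eq ?_)
      congr 2
      push_cast; ring
    calc (1 - l (x - b) / 2) * f x ≤ rexp (-(l (x - b) / 2)) * f x :=
          mul_le_mul_of_nonneg_right h1 h.le
      _ = rexp (-(l (x - b) / 2)) * √(f x) * √(f x) := by
          rw [mul_assoc, Real.mul_self_sqrt h.le]
      _ ≤ rexp (-(l (x - b) / 2)) * (√(f b) * rexp (l (x - b) / 2)) * √(f x) := by gcongr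
      _ = √(f b) * √(f x) := by
          rw [mul_left_comm, ← Real.exp_add]; simp
  have hint2 : Integrable fun x => f ((1 / 2 : ℝ) • (x₀ + x)) :=
    (hf.integrable.comp_smul (by norm_num : (1 / 2 : ℝ) ≠ 0)).comp_add_left x₀
  have hval : ∫ x, f ((1 / 2 : ℝ) • (x₀ + x)) = 2 ^ Fintype.card κ := by
    rw [integral_add_left_eq_self (fun x => f ((1 / 2 : ℝ) • x)) x₀, Measure.integral_comp_smul,
      hf.integral_eq_one]
    simp
  have hint3 : ∫ x, (1 - l (x - b) / 2) * f x = 1 := by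
    have : ∀ x, (1 - l (x - b) / 2) * f x = (1 + l b / 2) * f x - (1 / 2) * (l x * f x) := by
      intro x; rw [map_sub]; ring
    simp_rw [this]
    rw [integral_sub (hf.integrable.const_mul _) ((hf.integrable_mul l.continuous).const_mul _),
      integral_const_mul, integral_const_mul, hint, hf.integral_eq_one]
    ring
  have hfinal : √(f x₀) * 1 ≤ √(f b) * 2 ^ Fintype.card κ := by
    rw [← hint3, ← hval, ← integral_const_mul, ← integral_const_mul]
    refine integral_mono ((hf.integrable_mul (by fun_prop)).const_mul _) (hint2.const_mul _)
      fun x => ?_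
    calc √(f x₀) * ((1 - l (x - b) / 2) * f x) ≤ √(f x₀) * (√(f b) * √(f x)) := by
          exact mul_le_mul_of_nonneg_left (hlow x) (Real.sqrt_nonneg _)
      _ = √(f b) * (√(f x₀) * √(f x)) := by ring
      _ ≤ _ := by gcongr; exact hmid x
  rw [mul_one] at hfinal
  have := pow_le_pow_left₀ (Real.sqrt_nonneg _) hfinal 2
  rw [Real.sq_sqrt (hf.nonneg _), mul_pow, Real.sq_sqrt hpos.le, ← pow_mul, mul_comm _ 2,
    pow_mul] at this
  norm_num at this
  linarith
end IsRegularDensity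
end Convexity

section Tilting
variable {κ : Type*} [Fintype κ]

theorem abs_dotProduct_le (x y : κ → ℝ) : |x ⬝ᵥ y| ≤ Fintype.card κ * (‖x‖ * ‖y‖) := by
  calc |x ⬝ᵥ y| ≤ ∑ i, |x i * y i| := Finset.abs_sum_le_sum_abs _ _
    _ ≤ ∑ _i : κ, ‖x‖ * ‖y‖ := Finset.sum_le_sum fun i _ => by
        rw [abs_mul]
        exact mul_le_mul (norm_le_pi_norm x i) (norm_le_pi_norm y i) (abs_nonneg _) (norm_nonneg _)
    _ = _ := by simp

/-- The linear functional `v ↦ v ⬝ᵥ x`. -/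
def dotCLM (x : κ → ℝ) : (κ → ℝ) →L[ℝ] ℝ := ∑ i, x i • ContinuousLinearMap.proj i

@[simp] theorem dotCLM_apply (x v : κ → ℝ) : dotCLM x v = v ⬝ᵥ x := by
  simp [dotCLM, dotProduct, mul_comm]

theorem continuous_dotCLM : Continuous (dotCLM : (κ → ℝ) → (κ → ℝ) →L[ℝ] ℝ) := by
  unfold dotCLM; fun_prop

theorem norm_dotCLM_le (x : κ → ℝ) : ‖dotCLM x‖ ≤ Fintype.card κ * ‖x‖ := by
  refine ContinuousLinearMap.opNorm_le_bound _ (by positivity) fun v => ?_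
  rw [dotCLM_apply, Real.norm_eq_abs, dotProduct_comm]
  exact (abs_dotProduct_le x v).trans (le_of_eq (by ring))

@[fun_prop]
theorem Continuous.dotProduct_pi {X : Type*} [TopologicalSpace X] {u v : X → κ → ℝ}
    (hu : Continuous u) (hv : Continuous v) : Continuous fun t => u t ⬝ᵥ v t := by
  unfold dotProduct; fun_prop

/-- The exponential moment `∫ g(x) exp(ξ·x) f(x) dx`. -/
def tiltMoment (f g : (κ → ℝ) → ℝ) (ξ : κ → ℝ) : ℝ := ∫ x, g x * (rexp (ξ ⬝ᵥ x) * f x)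

/-- The exponential tilt of the density `f`, normalised. -/
def tilt (f : (κ → ℝ) → ℝ) (ξ x : κ → ℝ) : ℝ := rexp (ξ ⬝ᵥ x) * f x / tiltMoment f 1 ξ

/-- The expectation of `g` under the tilted density. -/
def tiltMean (f g : (κ → ℝ) → ℝ) (ξ : κ → ℝ) : ℝ := ∫ x, g x * tilt f ξ x

theorem tiltMean_eq_div (f g : (κ → ℝ) → ℝ) (ξ : κ → ℝ) :
    tiltMean f g ξ = tiltMoment f g ξ / tiltMoment f 1 ξ := by
  unfold tiltMean tilt
  rw [tiltMoment.eq_def f g, ← integral_div]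
  congr 1; ext x; ring

namespace IsRegularDensity
variable {f : (κ → ℝ) → ℝ}

theorem exists_pos (hf : IsRegularDensity f) : ∃ x, 0 < f x := by
  by_contra! h
  have : f = 0 := funext fun x => le_antisymm (h x) (hf.nonneg x)
  have h1 := hf.integral_eq_one
  simp [this] at h1

theorem integral_mul_pos (hf : IsRegularDensity f) {g : (κ → ℝ) → ℝ} (hg : Continuous g)
    (hg0 : ∀ x, 0 ≤ g x) {x₀ : κ → ℝ} (hx₀ : 0 < f x₀) (hgx : 0 < g x₀) :
    0 < ∫ x, g x * f x := by
  refine (integral_pos_iff_support_of_nonneg (fun x => mul_nonneg (hg0 x) (hf.nonneg x))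
    (hf.integrable_mul hg)).2 ?_
  have ho : IsOpen ({x | 0 < f x} ∩ {x | 0 < g x}) :=
    hf.isOpen.inter (isOpen_lt continuous_const hg)
  refine lt_of_lt_of_le (ho.measure_pos volume ⟨x₀, hx₀, hgx⟩) (measure_mono fun x hx => ?_)
  exact (mul_pos hx.2 hx.1).ne'

theorem integrable_tilt (hf : IsRegularDensity f) {g : (κ → ℝ) → ℝ} (hg : Continuous g)
    (ξ : κ → ℝ) : Integrable fun x => g x * (rexp (ξ ⬝ᵥ x) * f x) := by
  simp_rw [← mul_assoc]
  exact hf.integrable_mul (by fun_prop)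

theorem tiltMoment_one_pos (hf : IsRegularDensity f) (ξ : κ → ℝ) : 0 < tiltMoment f 1 ξ := by
  obtain ⟨x, hx⟩ := hf.exists_pos
  simp only [tiltMoment, Pi.one_apply, one_mul]
  exact hf.integral_mul_pos (g := fun x => rexp (ξ ⬝ᵥ x)) (by fun_prop) (fun x => (exp_pos _).le)
    hx (exp_pos _)

theorem tilt_pos_iff (hf : IsRegularDensity f) (ξ x : κ → ℝ) : 0 < tilt f ξ x ↔ 0 < f x := by
  unfold tilt
  rw [div_pos_iff_of_pos_right (hf.tiltMoment_one_pos ξ), mul_pos_iff_of_pos_left (exp_pos _)]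

protected theorem tilt (hf : IsRegularDensity f) (ξ : κ → ℝ) : IsRegularDensity (tilt f ξ) := by
  have hZ := hf.tiltMoment_one_pos ξ
  refine ⟨fun x => ?_, fun x y l hl => ?_, ?_, ?_, ?_, ?_⟩
  · exact div_nonneg (mul_nonneg (exp_pos _).le (hf.nonneg x)) hZ.le
  · unfold tilt
    have h := hf.logConcave x y l hl
    have e : ∀ z, 0 ≤ rexp (ξ ⬝ᵥ z) * f z := fun z => mul_nonneg (exp_pos _).le (hf.nonneg z)
    rw [Real.div_rpow (e x) hZ.le, Real.div_rpow (e y) hZ.le, div_mul_div_comm,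
      ← Real.rpow_add hZ, sub_add_cancel, Real.rpow_one]
    refine div_le_div_of_nonneg_right ?_ hZ.le
    rw [Real.mul_rpow (exp_pos _).le (hf.nonneg x), Real.mul_rpow (exp_pos _).le (hf.nonneg y),
      mul_mul_mul_comm, ← Real.exp_mul, ← Real.exp_mul, ← Real.exp_add]
    refine mul_le_mul (le_of_eq ?_) h (mul_nonneg (rpow_nonneg (hf.nonneg _) _)
      (rpow_nonneg (hf.nonneg _) _)) (exp_pos _).le
    congr 1
    simp only [dotProduct_add, dotProduct_smul, smul_eq_mul]
    ring
  · simp_rw [hf.tilt_pos_iff]; exact hf.isOpen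
  · unfold tilt
    have : Continuous fun x => rexp (ξ ⬝ᵥ x) := by fun_prop
    exact (this.measurable.mul hf.measurable).div_const _
  · obtain ⟨R, hR, h⟩ := hf.bounded
    refine ⟨R, hR, fun x hx => h x fun h0 => hx ?_⟩
    simp [tilt, h0]
  · have := tiltMean_eq_div f 1 ξ
    simp only [tiltMean, Pi.one_apply, one_mul] at this
    rw [this, div_self hZ.ne']

theorem hasFDerivAt_tiltMoment (hf : IsRegularDensity f) {g : (κ → ℝ) → ℝ} (hg : Continuous g)
    (ξ : κ → ℝ) : HasFDerivAt (tiltMoment f g)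
      (dotCLM fun i => tiltMoment f (fun x => g x * x i) ξ) ξ := by
  obtain ⟨R, hR, hb⟩ := hf.bounded
  obtain ⟨C, hC⟩ := (isCompact_closedBall (0 : κ → ℝ) R).exists_bound_of_continuousOn
    hg.continuousOn
  have hC0 : 0 ≤ C := (norm_nonneg _).trans (hC 0 (by simpa using hR))
  set F' : (κ → ℝ) → (κ → ℝ) → (κ → ℝ) →L[ℝ] ℝ :=
    fun η x => (g x * (rexp (η ⬝ᵥ x) * f x)) • dotCLM x with hF'
  have hm : ∀ η, AEStronglyMeasurable (F' η) volume := fun η =>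
    (hf.integrable_tilt hg η).aestronglyMeasurable.smul continuous_dotCLM.aestronglyMeasurable
  set B : ℝ := C * rexp (Fintype.card κ * ((‖ξ‖ + 1) * R)) * (Fintype.card κ * R) with hB
  have hbound : ∀ x, ∀ η ∈ Metric.ball ξ 1, ‖F' η x‖ ≤ B * f x := by
    intro x η hη
    by_cases h0 : f x = 0
    · simp [hF', h0]
    have hx := hb x h0
    have hη' : ‖η‖ ≤ ‖ξ‖ + 1 := by
      have : ‖η - ξ‖ < 1 := by simpa [dist_eq_norm] using hη
      calc ‖η‖ = ‖ξ + (η - ξ)‖ := by congr 1; abel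
        _ ≤ ‖ξ‖ + ‖η - ξ‖ := norm_add_le _ _
        _ ≤ _ := by linarith
    have h1 : ‖g x‖ ≤ C := hC x (by simpa using hx)
    have h2 : η ⬝ᵥ x ≤ Fintype.card κ * ((‖ξ‖ + 1) * R) := by
      refine (le_abs_self _).trans ((abs_dotProduct_le η x).trans ?_)
      gcongr
    have h3 : ‖dotCLM x‖ ≤ Fintype.card κ * R := (norm_dotCLM_le x).trans (by gcongr)
    simp only [hF', norm_smul, norm_mul, Real.norm_of_nonneg (hf.nonneg x),
      Real.norm_of_nonneg (exp_pos _).le]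
    calc ‖g x‖ * (rexp (η ⬝ᵥ x) * f x) * ‖dotCLM x‖
        ≤ C * (rexp (Fintype.card κ * ((‖ξ‖ + 1) * R)) * f x) * (Fintype.card κ * R) := by
          have := hf.nonneg x
          gcongr
      _ = _ := by rw [hB]; ring
  have hmain := hasFDerivAt_integral_of_dominated_of_fderiv_le (μ := volume) (𝕜 := ℝ)
    (F := fun η x => g x * (rexp (η ⬝ᵥ x) * f x)) (F' := F') (x₀ := ξ)
    (bound := fun x => B * f x) (Metric.ball_mem_nhds ξ one_pos)
    (Eventually.of_forall fun η => (hf.integrable_tilt hg η).aestronglyMeasurable)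
    (hf.integrable_tilt hg ξ) (hm ξ) (ae_of_all _ hbound) (hf.integrable.const_mul _)
    (ae_of_all _ fun x η _ => ?_)
  · refine HasFDerivAt.congr_fderiv hmain ?_
    ext1 v
    have hint : Integrable (F' ξ) :=
      (hf.integrable.const_mul B).mono' (hm ξ)
        (ae_of_all _ fun x => hbound x ξ (Metric.mem_ball_self one_pos))
    rw [ContinuousLinearMap.integral_apply hint, dotCLM_apply, dotProduct]
    simp only [tiltMoment]
    simp_rw [← integral_const_mul]
    rw [← integral_finsetSum]
    · congr 1
      ext x
      simp only [hF', _root_.smul_apply, dotCLM_apply, smul_eq_mul, dotProduct, Finset.mul_sum]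
      refine Finset.sum_congr rfl fun i _ => ?_
      ring
    · intro i _
      exact (hf.integrable_tilt (g := fun x => g x * x i) (by fun_prop) ξ).const_mul _
  · have h1 : HasFDerivAt (fun η : κ → ℝ => η ⬝ᵥ x) (dotCLM x) η := by
      have e : (fun η : κ → ℝ => η ⬝ᵥ x) = dotCLM x := by ext; simp
      rw [e]
      exact (dotCLM x).hasFDerivAt
    refine HasFDerivAt.congr_fderiv ((h1.exp.mul_const (f x)).const_mul (g x)) ?_
    ext1 v
    simp [hF']
    ring

theorem tiltMean_add (hf : IsRegularDensity f) {g h : (κ → ℝ) → ℝ} (hg : Continuous g)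
    (hh : Continuous h) (ξ : κ → ℝ) :
    tiltMean f (fun x => g x + h x) ξ = tiltMean f g ξ + tiltMean f h ξ := by
  unfold tiltMean
  rw [← integral_add ((hf.tilt ξ).integrable_mul hg) ((hf.tilt ξ).integrable_mul hh)]
  congr 1; ext x; ring

theorem tiltMean_const_mul (g : (κ → ℝ) → ℝ) (c : ℝ) (ξ : κ → ℝ) :
    tiltMean f (fun x => c * g x) ξ = c * tiltMean f g ξ := by
  unfold tiltMean
  rw [← integral_const_mul]
  congr 1; ext x; ring

theorem tiltMean_const (hf : IsRegularDensity f) (c : ℝ) (ξ : κ → ℝ) :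
    tiltMean f (fun _ => c) ξ = c := by
  unfold tiltMean
  rw [integral_const_mul, (hf.tilt ξ).integral_eq_one, mul_one]

theorem tiltMean_sum {ι : Type*} (s : Finset ι) (hf : IsRegularDensity f)
    {g : ι → (κ → ℝ) → ℝ} (hg : ∀ i, Continuous (g i)) (ξ : κ → ℝ) :
    tiltMean f (fun x => ∑ i ∈ s, g i x) ξ = ∑ i ∈ s, tiltMean f (g i) ξ := by
  unfold tiltMean
  simp_rw [Finset.sum_mul]
  exact integral_finsetSum _ fun i _ => (hf.tilt ξ).integrable_mul (hg i)

theorem hasFDerivAt_tiltMean (hf : IsRegularDensity f) {g : (κ → ℝ) → ℝ} (hg : Continuous g)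
    (ξ : κ → ℝ) : HasFDerivAt (tiltMean f g)
      (dotCLM fun i => tiltMean f (fun x => g x * x i) ξ -
        tiltMean f g ξ * tiltMean f (fun x => x i) ξ) ξ := by
  have hZ := hf.tiltMoment_one_pos ξ
  have h1 := hf.hasFDerivAt_tiltMoment hg ξ
  have h2 := hf.hasFDerivAt_tiltMoment (g := 1) continuous_one ξ
  have h3 := h1.mul ((hasDerivAt_inv hZ.ne').comp_hasFDerivAt ξ h2)
  have e : tiltMean f g = tiltMoment f g * ((fun y => y⁻¹) ∘ tiltMoment f 1) := by
    ext η
    rw [tiltMean_eq_div]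
    simp [div_eq_mul_inv]
  rw [e]
  refine HasFDerivAt.congr_fderiv h3 ?_
  ext1 v
  simp only [Pi.one_apply, one_mul, _root_.add_apply, _root_.smul_apply, dotCLM_apply, smul_eq_mul,
    Function.comp_apply, tiltMean_eq_div, dotProduct, Finset.mul_sum, ← Finset.sum_add_distrib]
  refine Finset.sum_congr rfl fun i _ => ?_
  simp only [Pi.mul_apply, Function.comp_apply]
  field_simp
  ring
end IsRegularDensity
end Tilting

section TiltBarycenter
variable {κ : Type*} [Fintype κ]

/-- Barycenter of the tilted density. -/
def tiltBary (f : (κ → ℝ) → ℝ) (ξ : κ → ℝ) : κ → ℝ := fun i => tiltMean f (fun x => x i) ξ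

/-- Covariance matrix of the tilted density. -/
def tiltCov (f : (κ → ℝ) → ℝ) (ξ : κ → ℝ) : Matrix κ κ ℝ := Matrix.of fun i j =>
  tiltMean f (fun x => x i * x j) ξ - tiltBary f ξ i * tiltBary f ξ j

namespace IsRegularDensity
variable {f : (κ → ℝ) → ℝ}

theorem tiltMean_expand (hf : IsRegularDensity f) {ι : Type*} (s : Finset ι) (c : ι → ℝ)
    {g : ι → (κ → ℝ) → ℝ} (hg : ∀ i, Continuous (g i)) (ξ : κ → ℝ) :
    tiltMean f (fun x => ∑ i ∈ s, c i * g i x) ξ = ∑ i ∈ s, c i * tiltMean f (g i) ξ := by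
  rw [tiltMean_sum s hf fun i => (hg i).const_mul (c i)]
  exact Finset.sum_congr rfl fun i _ => tiltMean_const_mul _ _ _

theorem tiltCov_apply (hf : IsRegularDensity f) (ξ : κ → ℝ) (i j : κ) :
    tiltCov f ξ i j =
      tiltMean f (fun x => (x i - tiltBary f ξ i) * (x j - tiltBary f ξ j)) ξ := by
  set b := tiltBary f ξ with hb
  have e : (fun x : κ → ℝ => (x i - b i) * (x j - b j)) = fun x =>
      ((x i * x j + (-b j) * x i) + ((-b i) * x j + b i * b j)) := by
    ext x; ring
  rw [e, hf.tiltMean_add (by fun_prop) (by fun_prop), hf.tiltMean_add (by fun_prop) (by fun_prop),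
    hf.tiltMean_add (by fun_prop) (by fun_prop), tiltMean_const_mul, tiltMean_const_mul,
    hf.tiltMean_const]
  change tiltMean f (fun x => x i * x j) ξ - b i * b j = _
  have h1 : tiltMean f (fun x => x i) ξ = b i := rfl
  have h2 : tiltMean f (fun x => x j) ξ = b j := rfl
  rw [h1, h2]
  ring

theorem hasFDerivAt_tiltBary [DecidableEq κ] (hf : IsRegularDensity f) (ξ : κ → ℝ) :
    HasFDerivAt (tiltBary f)
      (LinearMap.toContinuousLinearMap (Matrix.toLin' (tiltCov f ξ))) ξ := by
  refine hasFDerivAt_pi'.2 fun i => ?_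
  refine HasFDerivAt.congr_fderiv (hf.hasFDerivAt_tiltMean (g := fun x => x i) (by fun_prop) ξ) ?_
  ext1 v
  simp [Matrix.mulVec, dotProduct_comm, tiltCov, tiltBary]

theorem continuous_tiltMean (hf : IsRegularDensity f) {g : (κ → ℝ) → ℝ} (hg : Continuous g) :
    Continuous (tiltMean f g) :=
  continuous_iff_continuousAt.2 fun ξ => (hf.hasFDerivAt_tiltMean hg ξ).continuousAt

theorem continuous_tiltBary (hf : IsRegularDensity f) : Continuous (tiltBary f) :=
  continuous_pi fun i => hf.continuous_tiltMean (continuous_apply i)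

theorem continuous_tiltCov (hf : IsRegularDensity f) (i j : κ) :
    Continuous fun ξ => tiltCov f ξ i j :=
  (hf.continuous_tiltMean (g := fun x => x i * x j) (by fun_prop)).sub
    ((continuous_apply i |>.comp hf.continuous_tiltBary).mul
      (continuous_apply j |>.comp hf.continuous_tiltBary))

theorem hasDerivAt_tiltMean_ray (hf : IsRegularDensity f) {g : (κ → ℝ) → ℝ} (hg : Continuous g)
    (η ξ : κ → ℝ) (t : ℝ) : HasDerivAt (fun s : ℝ => tiltMean f g (η + s • ξ))
      (tiltMean f (fun x => g x * ξ ⬝ᵥ x) (η + t • ξ) -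
        tiltMean f g (η + t • ξ) * ξ ⬝ᵥ tiltBary f (η + t • ξ)) t := by
  have h1 : HasDerivAt (fun s : ℝ => η + s • ξ) ξ t := by
    simpa using ((hasDerivAt_id t).smul_const ξ).const_add η
  refine ((hf.hasFDerivAt_tiltMean hg (η + t • ξ)).comp_hasDerivAt t h1).congr_deriv ?_
  rw [dotCLM_apply]
  have e : (fun x => g x * ξ ⬝ᵥ x) = fun x => ∑ i, ξ i * (g x * x i) := by
    ext x; rw [dotProduct, Finset.mul_sum]; exact Finset.sum_congr rfl fun i _ => by ring
  rw [e, hf.tiltMean_expand _ _ fun i => by fun_prop]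
  simp only [dotProduct, mul_sub, Finset.sum_sub_distrib, Finset.mul_sum, tiltBary]
  congr 1
  exact Finset.sum_congr rfl fun i _ => by ring

theorem hasDerivAt_tiltCov_ray (hf : IsRegularDensity f) (η ξ : κ → ℝ) (t : ℝ) (i j : κ) :
    HasDerivAt (fun s : ℝ => tiltCov f (η + s • ξ) i j)
      (tiltMean f (fun x => (x i - tiltBary f (η + t • ξ) i) * (x j - tiltBary f (η + t • ξ) j) *
        ξ ⬝ᵥ (x - tiltBary f (η + t • ξ))) (η + t • ξ)) t := by
  set ζ := η + t • ξ with hζ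
  set b := tiltBary f ζ with hb
  have h1 := hf.hasDerivAt_tiltMean_ray (g := fun x => x i * x j) (by fun_prop) η ξ t
  have h2 := hf.hasDerivAt_tiltMean_ray (g := fun x => x i) (by fun_prop) η ξ t
  have h3 := hf.hasDerivAt_tiltMean_ray (g := fun x => x j) (by fun_prop) η ξ t
  refine (h1.sub (h2.mul h3)).congr_deriv ?_
  rw [← hζ]
  have bi : tiltMean f (fun x => x i) ζ = b i := rfl
  have bj : tiltMean f (fun x => x j) ζ = b j := rfl
  rw [bi, bj]
  have e : (fun x : κ → ℝ => (x i - b i) * (x j - b j) * ξ ⬝ᵥ (x - b)) = fun x =>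
      (((x i * x j * ξ ⬝ᵥ x + (-(ξ ⬝ᵥ b)) * (x i * x j)) +
        ((-b j) * (x i * ξ ⬝ᵥ x) + (-b i) * (x j * ξ ⬝ᵥ x))) +
        ((b j * ξ ⬝ᵥ b * x i + b i * ξ ⬝ᵥ b * x j) + (b i * b j * (ξ ⬝ᵥ x) + -(b i * b j * ξ ⬝ᵥ b)))) := by
    ext x; rw [dotProduct_sub]; ring
  have hs : tiltMean f (fun x => ξ ⬝ᵥ x) ζ = ξ ⬝ᵥ b := by
    have := hf.tiltMean_expand Finset.univ ξ (g := fun i x => x i) (fun i => by fun_prop) ζ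
    exact this
  rw [e, hf.tiltMean_add (by fun_prop) (by fun_prop), hf.tiltMean_add (by fun_prop) (by fun_prop),
    hf.tiltMean_add (by fun_prop) (by fun_prop), hf.tiltMean_add (by fun_prop) (by fun_prop),
    hf.tiltMean_add (by fun_prop) (by fun_prop), hf.tiltMean_add (by fun_prop) (by fun_prop),
    hf.tiltMean_add (by fun_prop) (by fun_prop), tiltMean_const_mul, tiltMean_const_mul,
    tiltMean_const_mul, tiltMean_const_mul, tiltMean_const_mul, tiltMean_const_mul,
    hf.tiltMean_const, bi, bj, hs]
  ring

theorem dotProduct_tiltCov_mulVec (hf : IsRegularDensity f) (ξ v : κ → ℝ) :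
    v ⬝ᵥ (tiltCov f ξ).mulVec v = tiltMean f (fun x => (v ⬝ᵥ (x - tiltBary f ξ)) ^ 2) ξ := by
  have e : (fun x : κ → ℝ => (v ⬝ᵥ (x - tiltBary f ξ)) ^ 2) = fun x => ∑ i, v i * ∑ j, v j *
      ((x i - tiltBary f ξ i) * (x j - tiltBary f ξ j)) := by
    ext x
    rw [sq, dotProduct, Finset.sum_mul_sum]
    refine Finset.sum_congr rfl fun i _ => ?_
    rw [Finset.mul_sum]
    refine Finset.sum_congr rfl fun j _ => ?_
    simp; ring
  rw [e, hf.tiltMean_expand _ _ fun i => by fun_prop]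
  simp only [dotProduct, Matrix.mulVec]
  refine Finset.sum_congr rfl fun i _ => ?_
  rw [hf.tiltMean_expand _ _ fun i => by fun_prop]
  congr 1
  refine Finset.sum_congr rfl fun j _ => ?_
  rw [hf.tiltCov_apply, mul_comm]

theorem tiltCov_posDef (hf : IsRegularDensity f) (ξ : κ → ℝ) : (tiltCov f ξ).PosDef := by
  refine Matrix.PosDef.of_dotProduct_mulVec_pos ?_ fun v hv => ?_
  · ext i j
    simp [tiltCov, mul_comm]
  rw [star_trivial, hf.dotProduct_tiltCov_mulVec]
  obtain ⟨x₀, hx₀, hne⟩ : ∃ x, 0 < f x ∧ v ⬝ᵥ (x - tiltBary f ξ) ≠ 0 := by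
    by_contra! hcon
    obtain ⟨x, hx⟩ := hf.exists_pos
    have hlim : Tendsto (fun s : ℝ => x + s • v) (𝓝[≠] 0) (𝓝 x) := by
      have : Continuous fun s : ℝ => x + s • v := by fun_prop
      simpa using (this.tendsto 0).mono_left nhdsWithin_le_nhds
    obtain ⟨s, hs, hs0⟩ := ((hlim.eventually (hf.isOpen.mem_nhds hx)).and
      self_mem_nhdsWithin).exists
    have h1 := hcon _ hx
    have h2 := hcon _ hs
    rw [add_sub_right_comm, dotProduct_add, h1, zero_add, dotProduct_smul, smul_eq_mul] at h2
    rcases mul_eq_zero.1 h2 with h | h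
    · exact hs0 h
    · exact hv (dotProduct_self_eq_zero.1 h)
  exact (hf.tilt ξ).integral_mul_pos (g := fun x => (v ⬝ᵥ (x - tiltBary f ξ)) ^ 2) (by fun_prop)
    (fun x => sq_nonneg _) ((hf.tilt_pos_iff ξ x₀).2 hx₀) (by positivity)

theorem abs_tiltMean_le (hf : IsRegularDensity f) {g : (κ → ℝ) → ℝ} (hg : Continuous g)
    {R C : ℝ} (hR : ∀ x, f x ≠ 0 → ‖x‖ ≤ R) (hC : ∀ x, ‖x‖ ≤ R → |g x| ≤ C) (ξ : κ → ℝ) :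
    |tiltMean f g ξ| ≤ C := by
  have ht := hf.tilt ξ
  calc |tiltMean f g ξ| ≤ ∫ x, |g x * tilt f ξ x| := abs_integral_le_integral_abs
    _ ≤ ∫ x, C * tilt f ξ x := by
        refine integral_mono (ht.integrable_mul hg).abs (ht.integrable.const_mul _) fun x => ?_
        simp only [abs_mul, abs_of_nonneg (ht.nonneg x)]
        by_cases h : f x = 0
        · simp [tilt, h]
        · exact mul_le_mul_of_nonneg_right (hC x (hR x h)) (ht.nonneg x)
    _ = C := by rw [integral_const_mul, ht.integral_eq_one, mul_one]

theorem exists_bound (hf : IsRegularDensity f) : ∃ C : ℝ, 0 ≤ C ∧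
    (∀ ξ i, |tiltBary f ξ i| ≤ C) ∧ ∀ ξ i j, |tiltCov f ξ i j| ≤ C := by
  obtain ⟨R, hR, hb⟩ := hf.bounded
  have h1 : ∀ ξ i, |tiltBary f ξ i| ≤ R := fun ξ i =>
    hf.abs_tiltMean_le (by fun_prop) hb (fun x hx => (norm_le_pi_norm x i).trans hx) ξ
  refine ⟨R + R * R + R * R, by positivity, fun ξ i => (h1 ξ i).trans ?_, fun ξ i j => ?_⟩
  · nlinarith [mul_nonneg hR hR]
  · have h2 : |tiltMean f (fun x => x i * x j) ξ| ≤ R * R :=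
      hf.abs_tiltMean_le (by fun_prop) hb (fun x hx => by
        rw [abs_mul]
        exact mul_le_mul ((norm_le_pi_norm x i).trans hx) ((norm_le_pi_norm x j).trans hx)
          (abs_nonneg _) hR) ξ
    have h3 : |tiltBary f ξ i * tiltBary f ξ j| ≤ R * R := by
      rw [abs_mul]; exact mul_le_mul (h1 ξ i) (h1 ξ j) (abs_nonneg _) hR
    simp only [tiltCov, Matrix.of_apply]
    refine (abs_sub _ _).trans ?_
    linarith

/-- The gradient inequality for the convex function `log (tiltMoment f 1)`. -/
theorem tiltMoment_mul_exp_le (hf : IsRegularDensity f) (ξ η : κ → ℝ) :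
    tiltMoment f 1 ξ * rexp (η ⬝ᵥ tiltBary f ξ) ≤ tiltMoment f 1 (ξ + η) := by
  have hZ := hf.tiltMoment_one_pos ξ
  have ht := hf.tilt ξ
  set b := tiltBary f ξ with hb
  have h1 : tiltMean f (fun x => rexp (η ⬝ᵥ x)) ξ = tiltMoment f 1 (ξ + η) / tiltMoment f 1 ξ := by
    rw [tiltMean_eq_div]
    congr 1
    simp only [tiltMoment, Pi.one_apply, one_mul, add_dotProduct, Real.exp_add]
    congr 1; ext x; ring
  have hs : tiltMean f (fun x => η ⬝ᵥ x) ξ = η ⬝ᵥ b :=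
    hf.tiltMean_expand Finset.univ η (g := fun i x => x i) (fun i => by fun_prop) ξ
  have h2 : tiltMean f (fun x => rexp (η ⬝ᵥ b) * (η ⬝ᵥ x + (1 - η ⬝ᵥ b))) ξ ≤
      tiltMean f (fun x => rexp (η ⬝ᵥ x)) ξ := by
    refine integral_mono (ht.integrable_mul (by fun_prop)) (ht.integrable_mul (by fun_prop))
      fun x => mul_le_mul_of_nonneg_right ?_ (ht.nonneg x)
    have := Real.add_one_le_exp (η ⬝ᵥ x - η ⬝ᵥ b)
    calc rexp (η ⬝ᵥ b) * (η ⬝ᵥ x + (1 - η ⬝ᵥ b))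
        ≤ rexp (η ⬝ᵥ b) * rexp (η ⬝ᵥ x - η ⬝ᵥ b) := by gcongr; linarith
      _ = _ := by rw [← Real.exp_add]; congr 1; ring
  rw [tiltMean_const_mul, hf.tiltMean_add (by fun_prop) (by fun_prop), hs, hf.tiltMean_const, h1,
    le_div_iff₀ hZ] at h2
  linarith

theorem tilt_zero (hf : IsRegularDensity f) : tilt f 0 = f := by
  ext x
  simp [tilt, tiltMoment, hf.integral_eq_one]

theorem tiltMoment_one_zero (hf : IsRegularDensity f) : tiltMoment f 1 0 = 1 := by
  simp [tiltMoment, hf.integral_eq_one]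

theorem dotProduct_tiltBary_lt (hf : IsRegularDensity f) {ξ η : κ → ℝ} (h : ξ ≠ η) :
    (η - ξ) ⬝ᵥ tiltBary f ξ < (η - ξ) ⬝ᵥ tiltBary f η := by
  classical
  set φ : ℝ → ℝ := fun s => (η - ξ) ⬝ᵥ tiltBary f (ξ + s • (η - ξ)) with hφ
  have hd : ∀ s, HasDerivAt φ ((η - ξ) ⬝ᵥ (tiltCov f (ξ + s • (η - ξ))).mulVec (η - ξ)) s := by
    intro s
    have h1 : HasDerivAt (fun s : ℝ => ξ + s • (η - ξ)) (η - ξ) s := by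
      simpa using ((hasDerivAt_id s).smul_const (η - ξ)).const_add ξ
    have h2 := (hf.hasFDerivAt_tiltBary (ξ + s • (η - ξ))).comp_hasDerivAt s h1
    have h3 := (dotCLM (η - ξ)).hasFDerivAt.comp_hasDerivAt s h2
    refine (h3.congr_deriv ?_).congr_of_eventuallyEq (Eventually.of_forall fun s => ?_)
    · simp [dotProduct_comm]
    · simp [hφ, dotProduct_comm]
  have hmono : StrictMono φ := by
    refine strictMono_of_deriv_pos fun s => ?_
    rw [(hd s).deriv]
    simpa using (hf.tiltCov_posDef (ξ + s • (η - ξ))).dotProduct_mulVec_pos (x := η - ξ)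
      (sub_ne_zero.2 h.symm)
  simpa [hφ] using hmono zero_lt_one

theorem tiltBary_injective (hf : IsRegularDensity f) : Function.Injective (tiltBary f) := by
  intro ξ η h
  by_contra hne
  have := hf.dotProduct_tiltBary_lt hne
  rw [h] at this
  exact lt_irrefl _ this

theorem apply_mul_exp_neg_le (hf : IsRegularDensity f) (ξ x₀ : κ → ℝ) :
    f x₀ * rexp (ξ ⬝ᵥ x₀ - ξ ⬝ᵥ tiltBary f ξ) ≤ 4 ^ Fintype.card κ * f (tiltBary f ξ) := by
  have h := (hf.tilt ξ).le_four_pow_mul_of_barycenter (b := tiltBary f ξ) (fun i => rfl) x₀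
  have hZ := hf.tiltMoment_one_pos ξ
  unfold tilt at h
  rw [← mul_div_assoc, div_le_div_iff_of_pos_right hZ] at h
  rw [Real.exp_sub, mul_div_assoc', div_le_iff₀ (exp_pos _)]
  linarith
end IsRegularDensity
end TiltBarycenter

section CenteredDensity
variable {κ : Type*} [Fintype κ]

theorem lintegral_comp_smul_pi {r : ℝ} (hr : 0 < r) (F : (κ → ℝ) → ENNReal) :
    ∫⁻ x, F (r • x) = ENNReal.ofReal ((r ^ Fintype.card κ)⁻¹) * ∫⁻ x, F x := by
  have h := Measure.map_addHaar_smul (volume : Measure (κ → ℝ)) hr.ne'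
  have he : MeasurableEmbedding fun x : κ → ℝ => r • x :=
    (Homeomorph.smulOfNeZero r hr.ne').measurableEmbedding
  rw [← he.lintegral_map, h, lintegral_smul_measure, Module.finrank_pi,
    abs_of_nonneg (by positivity), smul_eq_mul]

namespace IsRegularDensity
variable {f : (κ → ℝ) → ℝ}

theorem one_le_tiltMoment (hf : IsRegularDensity f) (hc : tiltBary f 0 = 0) (ξ : κ → ℝ) :
    1 ≤ tiltMoment f 1 ξ := by
  have := hf.tiltMoment_mul_exp_le 0 ξ
  simpa [hc, hf.tiltMoment_one_zero] using this

theorem tiltMoment_le_exp (hf : IsRegularDensity f) (ξ : κ → ℝ) :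
    tiltMoment f 1 ξ ≤ rexp (ξ ⬝ᵥ tiltBary f ξ) := by
  have := hf.tiltMoment_mul_exp_le ξ (-ξ)
  rwa [neg_dotProduct, add_neg_cancel, hf.tiltMoment_one_zero, Real.exp_neg, ← div_eq_mul_inv,
    div_le_one (exp_pos _)] at this

theorem sq_tiltMoment_le (hf : IsRegularDensity f) (ξ η : κ → ℝ) :
    tiltMoment f 1 ξ ^ 2 ≤ tiltMoment f 1 (ξ + η) * tiltMoment f 1 (ξ - η) := by
  have h1 := hf.tiltMoment_mul_exp_le ξ η
  have h2 := hf.tiltMoment_mul_exp_le ξ (-η)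
  have h0 := (hf.tiltMoment_one_pos ξ).le
  rw [← sub_eq_add_neg] at h2
  calc tiltMoment f 1 ξ ^ 2 = (tiltMoment f 1 ξ * rexp (η ⬝ᵥ tiltBary f ξ)) *
        (tiltMoment f 1 ξ * rexp ((-η) ⬝ᵥ tiltBary f ξ)) := by
        rw [neg_dotProduct, mul_mul_mul_comm, ← Real.exp_add, add_neg_cancel, Real.exp_zero]; ring
    _ ≤ _ := mul_le_mul h1 h2 (by positivity) (hf.tiltMoment_one_pos _).le

theorem apply_zero_mul_exp_neg_le (hf : IsRegularDensity f) (ξ : κ → ℝ) :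
    f 0 * rexp (-(ξ ⬝ᵥ tiltBary f ξ)) ≤ 4 ^ Fintype.card κ * f (tiltBary f ξ) := by
  simpa using hf.apply_mul_exp_neg_le ξ 0

theorem apply_zero_pos (hf : IsRegularDensity f) (hc : tiltBary f 0 = 0) : 0 < f 0 := by
  refine hf.pos_of_barycenter fun i => ?_
  have := congrFun hc i
  simpa [tiltBary, tiltMean, hf.tilt_zero] using this

theorem dotProduct_tiltBary_nonneg (hf : IsRegularDensity f) (hc : tiltBary f 0 = 0) (ξ : κ → ℝ) :
    0 ≤ ξ ⬝ᵥ tiltBary f ξ :=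
  Real.one_le_exp_iff.1 ((hf.one_le_tiltMoment hc ξ).trans (hf.tiltMoment_le_exp ξ))

theorem exists_linear_growth (hf : IsRegularDensity f) (hc : tiltBary f 0 = 0) :
    ∃ c : ℝ, 0 < c ∧ ∀ ξ, c * ‖ξ‖ - c ≤ ξ ⬝ᵥ tiltBary f ξ := by
  have hcont : Continuous fun ξ => ξ ⬝ᵥ tiltBary f ξ :=
    continuous_id.dotProduct_pi hf.continuous_tiltBary
  obtain ⟨c, hc0, hcs⟩ := (isCompact_sphere (0 : κ → ℝ) 1).exists_forall_le' hcont.continuousOn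
    (a := 0) fun ξ hξ => by
      have : (0 : κ → ℝ) ≠ ξ := by
        rintro rfl; simp at hξ
      simpa [hc] using hf.dotProduct_tiltBary_lt this
  refine ⟨c, hc0, fun ξ => ?_⟩
  rcases le_or_gt ‖ξ‖ 1 with h | h
  · exact le_trans (by nlinarith) (hf.dotProduct_tiltBary_nonneg hc ξ)
  have hr : 0 < ‖ξ‖ := by linarith
  set u := ‖ξ‖⁻¹ • ξ with hu
  have hu1 : ‖u‖ = 1 := by rw [hu, norm_smul, norm_inv, norm_norm, inv_mul_cancel₀ hr.ne']
  have hξ : ξ = ‖ξ‖ • u := by rw [hu, smul_smul, mul_inv_cancel₀ hr.ne', one_smul]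
  have hne : u ≠ ξ := by
    intro h'; rw [h'] at hu1; linarith
  have h1 := hf.dotProduct_tiltBary_lt hne
  have h2 : ξ - u = (1 - ‖ξ‖⁻¹) • ξ := by rw [sub_smul, one_smul]
  have h3 : 0 < 1 - ‖ξ‖⁻¹ := by
    rw [sub_pos]; exact inv_lt_one_of_one_lt₀ h
  rw [h2, smul_dotProduct, smul_dotProduct, smul_eq_mul, smul_eq_mul] at h1
  have h4 := lt_of_mul_lt_mul_left h1 h3.le
  have h5 : ξ ⬝ᵥ tiltBary f u = ‖ξ‖ * (u ⬝ᵥ tiltBary f u) := by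
    nth_rewrite 1 [hξ]; rw [smul_dotProduct, smul_eq_mul]
  have h6 := hcs u (by simpa using hu1)
  nlinarith

/-- Integral of the product of `f` and its translate by `w / 2`. -/
def halfCorrelation (f : (κ → ℝ) → ℝ) (w : κ → ℝ) : ENNReal :=
  ∫⁻ u, ENNReal.ofReal (f ((1 / 2 : ℝ) • w + u) * f u)

theorem lintegral_halfCorrelation (hf : IsRegularDensity f) :
    ∫⁻ w, halfCorrelation f w = ENNReal.ofReal (2 ^ Fintype.card κ) := by
  have hm := hf.measurable
  unfold halfCorrelation
  rw [lintegral_lintegral_swap (by fun_prop)]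
  have : ∀ u : κ → ℝ, ∫⁻ w : κ → ℝ, ENNReal.ofReal (f ((1 / 2 : ℝ) • w + u) * f u) =
      ENNReal.ofReal (2 ^ Fintype.card κ) * ENNReal.ofReal (f u) := by
    intro u
    simp_rw [ENNReal.ofReal_mul (hf.nonneg _)]
    rw [lintegral_mul_const _ (by fun_prop),
      lintegral_comp_smul_pi (by norm_num : (0:ℝ) < 1 / 2) fun w => ENNReal.ofReal (f (w + u)),
      lintegral_add_right_eq_self (fun w => ENNReal.ofReal (f w)) u, hf.lintegral_eq_one, mul_one]
    congr 2
    rw [one_div, inv_pow, inv_inv]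
  simp_rw [this]
  rw [lintegral_const_mul _ (by fun_prop), hf.lintegral_eq_one, mul_one]

theorem sqrt_mul_le_halfCorrelation (hf : IsRegularDensity f) (m₁ m₂ : κ → ℝ) :
    ENNReal.ofReal √(f m₁ * f m₂) ≤
      ENNReal.ofReal (2 ^ Fintype.card κ) * halfCorrelation f (m₁ - m₂) := by
  have hm := hf.measurable
  calc ENNReal.ofReal √(f m₁ * f m₂)
      = ∫⁻ z, ENNReal.ofReal (√(f m₁ * f m₂) * f z) := by
        simp_rw [ENNReal.ofReal_mul (Real.sqrt_nonneg _)]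
        rw [lintegral_const_mul _ (by fun_prop), hf.lintegral_eq_one, mul_one]
    _ ≤ ∫⁻ z, ENNReal.ofReal (f ((1 / 2 : ℝ) • (m₁ + z)) * f ((1 / 2 : ℝ) • (m₂ + z))) := by
        refine lintegral_mono fun z => ENNReal.ofReal_le_ofReal ?_
        refine abs_le_of_sq_le_sq' ?_ (mul_nonneg (hf.nonneg _) (hf.nonneg _)) |>.2
        rw [mul_pow, Real.sq_sqrt (mul_nonneg (hf.nonneg _) (hf.nonneg _)), mul_pow]
        calc f m₁ * f m₂ * f z ^ 2 = (f m₁ * f z) * (f m₂ * f z) := by ring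
          _ ≤ _ := mul_le_mul (hf.mul_le_sq_midpoint _ _) (hf.mul_le_sq_midpoint _ _)
            (mul_nonneg (hf.nonneg _) (hf.nonneg _)) (sq_nonneg _)
    _ = ∫⁻ z, ENNReal.ofReal (f ((1 / 2 : ℝ) • (m₁ - m₂) + (1 / 2 : ℝ) • z) *
          f ((1 / 2 : ℝ) • z)) := by
        rw [← lintegral_add_left_eq_self (fun z => ENNReal.ofReal
          (f ((1 / 2 : ℝ) • (m₁ - m₂) + (1 / 2 : ℝ) • z) * f ((1 / 2 : ℝ) • z))) m₂]
        refine lintegral_congr fun z => ?_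
        rw [← smul_add, show m₁ - m₂ + (m₂ + z) = m₁ + z by abel]
    _ = _ := by
        rw [lintegral_comp_smul_pi (by norm_num : (0:ℝ) < 1 / 2)
          fun z => ENNReal.ofReal (f ((1 / 2 : ℝ) • (m₁ - m₂) + z) * f z)]
        congr 2
        rw [one_div, inv_pow, inv_inv]
end IsRegularDensity
end CenteredDensity

section SymmetrizedTilt
variable {κ : Type*} [Fintype κ]

/-- The gradient of `ξ ↦ log (tiltMoment f 1 ξ) + log (tiltMoment f 1 (-ξ))`. -/
def symmBary (f : (κ → ℝ) → ℝ) (ξ : κ → ℝ) : κ → ℝ := tiltBary f ξ - tiltBary f (-ξ)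

/-- The Hessian of `ξ ↦ log (tiltMoment f 1 ξ) + log (tiltMoment f 1 (-ξ))`. -/
def symmCov (f : (κ → ℝ) → ℝ) (ξ : κ → ℝ) : Matrix κ κ ℝ := tiltCov f ξ + tiltCov f (-ξ)

namespace IsRegularDensity
variable {f : (κ → ℝ) → ℝ}

theorem dotProduct_symmBary (ξ : κ → ℝ) :
    ξ ⬝ᵥ symmBary f ξ = ξ ⬝ᵥ tiltBary f ξ + (-ξ) ⬝ᵥ tiltBary f (-ξ) := by
  rw [symmBary, dotProduct_sub, neg_dotProduct, sub_eq_add_neg]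

theorem hasFDerivAt_symmBary [DecidableEq κ] (hf : IsRegularDensity f) (ξ : κ → ℝ) :
    HasFDerivAt (symmBary f)
      (LinearMap.toContinuousLinearMap (Matrix.toLin' (symmCov f ξ))) ξ := by
  have h1 := (hf.hasFDerivAt_tiltBary (-ξ)).comp ξ (hasFDerivAt_id ξ).neg
  refine HasFDerivAt.congr_fderiv ((hf.hasFDerivAt_tiltBary ξ).sub h1) ?_
  ext1 v
  simp [symmCov]

theorem continuous_symmBary (hf : IsRegularDensity f) : Continuous (symmBary f) :=
  hf.continuous_tiltBary.sub (hf.continuous_tiltBary.comp continuous_neg)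

theorem continuous_symmCov (hf : IsRegularDensity f) : Continuous (symmCov f) :=
  continuous_matrix fun i j => (hf.continuous_tiltCov i j).add
    ((hf.continuous_tiltCov i j).comp continuous_neg)

theorem exp_neg_symm_le (hf : IsRegularDensity f) (hc : tiltBary f 0 = 0) (x z : κ → ℝ) :
    rexp (-(x ⬝ᵥ symmBary f x + z ⬝ᵥ symmBary f z)) ≤
      (tiltMoment f 1 ((1 / 2 : ℝ) • (x + z)))⁻¹ * (4 ^ Fintype.card κ / f 0) *
        √(f ((1 / 2 : ℝ) • (tiltBary f x + tiltBary f (-z))) *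
          f ((1 / 2 : ℝ) • (tiltBary f (-x) + tiltBary f z))) := by
  set S := x ⬝ᵥ symmBary f x + z ⬝ᵥ symmBary f z with hS
  set m := (1 / 2 : ℝ) • (x + z) with hm
  set d := (1 / 2 : ℝ) • (x - z) with hd
  set F := √(f ((1 / 2 : ℝ) • (tiltBary f x + tiltBary f (-z))) *
          f ((1 / 2 : ℝ) • (tiltBary f (-x) + tiltBary f z))) with hF
  have hSe : S = (x ⬝ᵥ tiltBary f x + (-x) ⬝ᵥ tiltBary f (-x)) +
      (z ⬝ᵥ tiltBary f z + (-z) ⬝ᵥ tiltBary f (-z)) := by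
    rw [hS, dotProduct_symmBary, dotProduct_symmBary]
  have hS0 : 0 ≤ S := by
    have := hf.dotProduct_tiltBary_nonneg hc
    rw [hSe]; linarith [this x, this (-x), this z, this (-z)]
  have f0 := hf.apply_zero_pos hc
  have hZ := hf.tiltMoment_one_pos
  have e1 : m + d = x := by rw [hm, hd, ← smul_add, show x + z + (x - z) = (2:ℝ) • x by
    rw [two_smul]; abel, smul_smul]; norm_num
  have e2 : m - d = z := by rw [hm, hd, ← smul_sub, show x + z - (x - z) = (2:ℝ) • z by
    rw [two_smul]; abel, smul_smul]; norm_num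
  have key1 : tiltMoment f 1 m ≤ rexp (S / 2) := by
    have h1 := hf.sq_tiltMoment_le m d
    have h2 := hf.sq_tiltMoment_le (-m) (-d)
    rw [e1, e2] at h1
    rw [← neg_add, e1, show -m - -d = -(m - d) by abel, e2] at h2
    have h3 := hf.one_le_tiltMoment hc (-m)
    refine abs_le_of_sq_le_sq' ?_ (exp_pos _).le |>.2
    calc tiltMoment f 1 m ^ 2 ≤ tiltMoment f 1 m ^ 2 * tiltMoment f 1 (-m) ^ 2 :=
          le_mul_of_one_le_right (sq_nonneg _) (one_le_pow₀ h3)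
      _ ≤ (tiltMoment f 1 x * tiltMoment f 1 z) * (tiltMoment f 1 (-x) * tiltMoment f 1 (-z)) :=
          mul_le_mul h1 h2 (sq_nonneg _) (mul_pos (hZ _) (hZ _)).le
      _ ≤ (rexp (x ⬝ᵥ tiltBary f x) * rexp (z ⬝ᵥ tiltBary f z)) *
          (rexp ((-x) ⬝ᵥ tiltBary f (-x)) * rexp ((-z) ⬝ᵥ tiltBary f (-z))) := by
          gcongr
          · exact (mul_pos (hZ _) (hZ _)).le
          · exact (hZ _).le
          · exact hf.tiltMoment_le_exp _
          · exact hf.tiltMoment_le_exp _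
          · exact (hZ _).le
          · exact hf.tiltMoment_le_exp _
          · exact hf.tiltMoment_le_exp _
      _ = rexp (S / 2) ^ 2 := by
          rw [← Real.exp_add, ← Real.exp_add, ← Real.exp_add, sq, ← Real.exp_add, hSe]
          congr 1; ring
  have key2 : f 0 * rexp (-(S / 4)) ≤ 4 ^ Fintype.card κ * F := by
    refine le_of_pow_le_pow_left₀ (n := 4) (by norm_num) (by positivity) ?_
    have hn := hf.nonneg
    calc (f 0 * rexp (-(S / 4))) ^ 4
        = ((f 0 * rexp (-(x ⬝ᵥ tiltBary f x))) * (f 0 * rexp (-((-z) ⬝ᵥ tiltBary f (-z))))) *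
          ((f 0 * rexp (-((-x) ⬝ᵥ tiltBary f (-x)))) * (f 0 * rexp (-(z ⬝ᵥ tiltBary f z)))) := by
          have : rexp (-(S / 4)) ^ 4 = rexp (-(x ⬝ᵥ tiltBary f x)) *
              rexp (-((-z) ⬝ᵥ tiltBary f (-z))) * (rexp (-((-x) ⬝ᵥ tiltBary f (-x))) *
                rexp (-(z ⬝ᵥ tiltBary f z))) := by
            rw [← Real.exp_nat_mul, ← Real.exp_add, ← Real.exp_add, ← Real.exp_add, hSe]
            congr 1; push_cast; ring
          rw [mul_pow, this]; ring
      _ ≤ ((4 ^ Fintype.card κ * f (tiltBary f x)) * (4 ^ Fintype.card κ * f (tiltBary f (-z)))) *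
          ((4 ^ Fintype.card κ * f (tiltBary f (-x))) * (4 ^ Fintype.card κ * f (tiltBary f z))) := by
          have g := hf.apply_zero_mul_exp_neg_le
          have p4 : (0:ℝ) ≤ 4 ^ Fintype.card κ := by positivity
          have q : ∀ w, 0 ≤ f 0 * rexp (-(w ⬝ᵥ tiltBary f w)) := fun w => by positivity
          have q' : ∀ w, 0 ≤ 4 ^ Fintype.card κ * f w := fun w => mul_nonneg p4 (hn w)
          exact mul_le_mul (mul_le_mul (g _) (g _) (q _) (q' _))
            (mul_le_mul (g _) (g _) (q _) (q' _)) (mul_nonneg (q _) (q _))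
            (mul_nonneg (q' _) (q' _))
      _ = (4 ^ Fintype.card κ) ^ 4 * ((f (tiltBary f x) * f (tiltBary f (-z))) *
          (f (tiltBary f (-x)) * f (tiltBary f z))) := by ring
      _ ≤ (4 ^ Fintype.card κ) ^ 4 * (f ((1 / 2 : ℝ) • (tiltBary f x + tiltBary f (-z))) ^ 2 *
          f ((1 / 2 : ℝ) • (tiltBary f (-x) + tiltBary f z)) ^ 2) := by
          refine mul_le_mul_of_nonneg_left ?_ (by positivity)
          exact mul_le_mul (hf.mul_le_sq_midpoint _ _) (hf.mul_le_sq_midpoint _ _)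
            (mul_nonneg (hn _) (hn _)) (sq_nonneg _)
      _ = (4 ^ Fintype.card κ * F) ^ 4 := by
          rw [mul_pow, show F ^ 4 = (F ^ 2) ^ 2 by ring, hF,
            Real.sq_sqrt (mul_nonneg (hn _) (hn _))]
          ring
  have hF0 : 0 ≤ F := Real.sqrt_nonneg _
  calc rexp (-S) ≤ rexp (-(S / 2)) * rexp (-(S / 4)) := by
        rw [← Real.exp_add]; exact Real.exp_le_exp.2 (by linarith)
    _ ≤ (tiltMoment f 1 m)⁻¹ * (4 ^ Fintype.card κ / f 0 * F) := by
        refine mul_le_mul ?_ ?_ (exp_pos _).le (inv_nonneg.2 (hZ _).le)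
        · rw [Real.exp_neg]; exact inv_anti₀ (hZ _) key1
        · rw [div_mul_eq_mul_div, le_div_iff₀ f0, mul_comm]; exact key2
    _ = _ := by ring

theorem lintegral_det_mul_halfCorrelation_le [DecidableEq κ] (hf : IsRegularDensity f)
    (p : κ → ℝ) :
    ∫⁻ x, ENNReal.ofReal |((1 / 2 : ℝ) • (symmCov f x + symmCov f (p - x))).det| *
      halfCorrelation f ((1 / 2 : ℝ) • (symmBary f x - symmBary f (p - x))) ≤
      ENNReal.ofReal (2 ^ Fintype.card κ) := by
  set q : (κ → ℝ) → κ → ℝ := fun x => (1 / 2 : ℝ) • (symmBary f x - symmBary f (p - x)) with hq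
  have hd : ∀ x ∈ (univ : Set (κ → ℝ)), HasFDerivWithinAt q (LinearMap.toContinuousLinearMap
      (Matrix.toLin' ((1 / 2 : ℝ) • (symmCov f x + symmCov f (p - x))))) univ x := by
    intro x _
    refine HasFDerivAt.hasFDerivWithinAt ?_
    have h1 := (hf.hasFDerivAt_symmBary (p - x)).comp x ((hasFDerivAt_id x).const_sub p)
    refine HasFDerivAt.congr_fderiv
      (((hf.hasFDerivAt_symmBary x).sub h1).const_smul (1 / 2 : ℝ)) ?_
    ext1 v
    simp
  have hinj : Function.Injective q := by
    intro x z hxz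
    by_contra hne
    have h1 := hf.dotProduct_tiltBary_lt hne
    have h2 := hf.dotProduct_tiltBary_lt (ξ := -x) (η := -z) (by simpa using hne)
    have h3 := hf.dotProduct_tiltBary_lt (ξ := p - x) (η := p - z) (by simpa using hne)
    have h4 := hf.dotProduct_tiltBary_lt (ξ := -(p - x)) (η := -(p - z)) (by simpa using hne)
    rw [show -z - -x = -(z - x) by abel] at h2
    rw [show p - z - (p - x) = -(z - x) by abel] at h3
    rw [show -(p - z) - -(p - x) = z - x by abel] at h4
    have h5 : symmBary f x - symmBary f (p - x) = symmBary f z - symmBary f (p - z) :=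
      smul_right_injective _ (by norm_num : (1 / 2 : ℝ) ≠ 0) hxz
    have h6 := congrArg (fun w => (z - x) ⬝ᵥ w) h5
    simp only [symmBary, dotProduct_sub] at h6
    rw [neg_dotProduct, neg_dotProduct] at h2 h3
    linarith
  have h := lintegral_image_eq_lintegral_abs_det_fderiv_mul volume MeasurableSet.univ hd
    hinj.injOn (halfCorrelation f)
  simp only [LinearMap.det_toContinuousLinearMap, LinearMap.det_toLin', Measure.restrict_univ] at h
  rw [← h, ← hf.lintegral_halfCorrelation]
  exact setLIntegral_le_lintegral _ _

theorem lintegral_prod_eq_lintegral_sub {G : (κ → ℝ) → (κ → ℝ) → ENNReal}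
    (hG : Measurable (Function.uncurry G)) :
    ∫⁻ p : (κ → ℝ) × (κ → ℝ), G p.1 p.2 = ∫⁻ p, ∫⁻ x, G x (p - x) := by
  have h1 : ∫⁻ p : (κ → ℝ) × (κ → ℝ), G p.1 p.2 = ∫⁻ x, ∫⁻ z, G x z :=
    lintegral_prod _ hG.aemeasurable
  have h2 : ∀ x, ∫⁻ p, G x (p - x) = ∫⁻ z, G x z := fun x => lintegral_sub_right_eq_self (G x) x
  have hm : Measurable (Function.uncurry fun x p => G x (p - x)) :=
    hG.comp (measurable_fst.prodMk (measurable_snd.sub measurable_fst))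
  rw [h1, ← lintegral_lintegral_swap hm.aemeasurable]
  exact lintegral_congr fun x => (h2 x).symm

theorem exp_neg_symm_mul_det_le [DecidableEq κ] (hf : IsRegularDensity f)
    (hc : tiltBary f 0 = 0) (p x : κ → ℝ) :
    ENNReal.ofReal (rexp (-(x ⬝ᵥ symmBary f x + (p - x) ⬝ᵥ symmBary f (p - x))) *
      |((1 / 2 : ℝ) • (symmCov f x + symmCov f (p - x))).det|) ≤
      ENNReal.ofReal ((tiltMoment f 1 ((1 / 2 : ℝ) • p))⁻¹ * (8 ^ Fintype.card κ / f 0)) *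
      (ENNReal.ofReal |((1 / 2 : ℝ) • (symmCov f x + symmCov f (p - x))).det| *
      halfCorrelation f ((1 / 2 : ℝ) • (symmBary f x - symmBary f (p - x)))) := by
  have h1 := hf.exp_neg_symm_le hc x (p - x)
  rw [add_sub_cancel] at h1
  have h2 := hf.sqrt_mul_le_halfCorrelation
    ((1 / 2 : ℝ) • (tiltBary f x + tiltBary f (-(p - x))))
    ((1 / 2 : ℝ) • (tiltBary f (-x) + tiltBary f (p - x)))
  rw [show (1 / 2 : ℝ) • (tiltBary f x + tiltBary f (-(p - x))) -
      (1 / 2 : ℝ) • (tiltBary f (-x) + tiltBary f (p - x)) =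
      (1 / 2 : ℝ) • (symmBary f x - symmBary f (p - x)) by
    rw [← smul_sub]; congr 1; simp only [symmBary]; abel] at h2
  have hi := inv_nonneg.2 (hf.tiltMoment_one_pos ((1 / 2 : ℝ) • p)).le
  have f0 := (hf.apply_zero_pos hc).le
  set Q := √(f ((1 / 2 : ℝ) • (tiltBary f x + tiltBary f (-(p - x)))) *
        f ((1 / 2 : ℝ) • (tiltBary f (-x) + tiltBary f (p - x))))
  set D := |((1 / 2 : ℝ) • (symmCov f x + symmCov f (p - x))).det| with hD
  have hD0 : 0 ≤ D := abs_nonneg _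
  set K := halfCorrelation f ((1 / 2 : ℝ) • (symmBary f x - symmBary f (p - x)))
  set W := (tiltMoment f 1 ((1 / 2 : ℝ) • p))⁻¹
  set E := rexp (-(x ⬝ᵥ symmBary f x + (p - x) ⬝ᵥ symmBary f (p - x)))
  set N := Fintype.card κ
  clear_value Q D K W E N
  have h48 : W * (8 ^ N / f 0) = W * (4 ^ N / f 0) * 2 ^ N := by
    rw [show (8:ℝ) = 4 * 2 by norm_num, mul_pow]; ring
  calc ENNReal.ofReal (E * D) ≤ ENNReal.ofReal (W * (4 ^ N / f 0) * Q * D) :=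
        ENNReal.ofReal_le_ofReal (mul_le_mul_of_nonneg_right h1 hD0)
    _ = ENNReal.ofReal (W * (4 ^ N / f 0)) * ENNReal.ofReal Q * ENNReal.ofReal D := by
        rw [ENNReal.ofReal_mul' hD0, ENNReal.ofReal_mul (by positivity)]
    _ ≤ ENNReal.ofReal (W * (4 ^ N / f 0)) * (ENNReal.ofReal (2 ^ N) * K) *
        ENNReal.ofReal D := by gcongr
    _ = ENNReal.ofReal (W * (8 ^ N / f 0)) * (ENNReal.ofReal D * K) := by
        rw [h48, ENNReal.ofReal_mul (p := _ * (4 ^ N / f 0)) (by positivity)]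
        ring

/-- A functional Santaló-type lower bound for the integral of the inverse Laplace transform. -/
theorem le_lintegral_inv_tiltMoment [DecidableEq κ] (hf : IsRegularDensity f)
    (hc : tiltBary f 0 = 0) :
    ENNReal.ofReal ((π / 32) ^ Fintype.card κ * f 0) ≤
      ∫⁻ ξ, ENNReal.ofReal (tiltMoment f 1 ξ)⁻¹ := by
  obtain ⟨C, hC, hCb, hCc⟩ := hf.exists_bound
  obtain ⟨c, hc0, hg⟩ := hf.exists_linear_growth hc
  have f0 := hf.apply_zero_pos hc
  have hyc := hf.continuous_symmBary
  have hHc := hf.continuous_symmCov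
  have main := pi_pow_le_lintegral_of_growth (C := C + C) (c := c) (c₀ := c) (y := symmBary f)
    (H := symmCov f) (by positivity) hc0 hf.hasFDerivAt_symmBary
    (fun i j => (hHc.matrix_elem i j).measurable)
    (fun x i => (abs_sub _ _).trans (add_le_add (hCb _ _) (hCb _ _)))
    (fun x i j => (abs_add_le _ _).trans (add_le_add (hCc _ _ _) (hCc _ _ _)))
    (fun x => by
      rw [dotProduct_symmBary]
      linarith [hg x, hf.dotProduct_tiltBary_nonneg hc (-x)])
  have hGm : Measurable (Function.uncurry fun x z : κ → ℝ =>
      ENNReal.ofReal (rexp (-(x ⬝ᵥ symmBary f x + z ⬝ᵥ symmBary f z)) *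
      |((1 / 2 : ℝ) • (symmCov f x + symmCov f z)).det|)) := by
    refine ENNReal.measurable_ofReal.comp (Continuous.measurable ?_)
    have h3 : Continuous fun p : (κ → ℝ) × (κ → ℝ) =>
        (1 / 2 : ℝ) • (symmCov f p.1 + symmCov f p.2) :=
      ((hHc.comp continuous_fst).add (hHc.comp continuous_snd)).const_smul (1 / 2 : ℝ)
    exact (Real.continuous_exp.comp
      ((continuous_fst.dotProduct_pi (hyc.comp continuous_fst)).add
        (continuous_snd.dotProduct_pi (hyc.comp continuous_snd))).neg).mul
      (continuous_abs.comp h3.matrix_det)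
  rw [lintegral_prod_eq_lintegral_sub hGm] at main
  have h1 : ∀ p : κ → ℝ, ∫⁻ x, ENNReal.ofReal
      (rexp (-(x ⬝ᵥ symmBary f x + (p - x) ⬝ᵥ symmBary f (p - x))) *
      |((1 / 2 : ℝ) • (symmCov f x + symmCov f (p - x))).det|) ≤
      ENNReal.ofReal (16 ^ Fintype.card κ / f 0) *
        ENNReal.ofReal (tiltMoment f 1 ((1 / 2 : ℝ) • p))⁻¹ := by
    intro p
    refine (lintegral_mono (hf.exp_neg_symm_mul_det_le hc p)).trans ?_
    rw [lintegral_const_mul' _ _ ENNReal.ofReal_ne_top]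
    refine (mul_le_mul_right (hf.lintegral_det_mul_halfCorrelation_le p) _).trans_eq ?_
    have hi := inv_nonneg.2 (hf.tiltMoment_one_pos ((1 / 2 : ℝ) • p)).le
    rw [← ENNReal.ofReal_mul (by positivity), ← ENNReal.ofReal_mul (by positivity)]
    congr 1
    rw [show (16:ℝ) = 8 * 2 by norm_num, mul_pow]; ring
  have h2 : ∫⁻ p : κ → ℝ, ENNReal.ofReal (16 ^ Fintype.card κ / f 0) *
      ENNReal.ofReal (tiltMoment f 1 ((1 / 2 : ℝ) • p))⁻¹ =
      ENNReal.ofReal (32 ^ Fintype.card κ / f 0) * ∫⁻ ξ, ENNReal.ofReal (tiltMoment f 1 ξ)⁻¹ := by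
    rw [lintegral_const_mul' _ _ ENNReal.ofReal_ne_top, lintegral_comp_smul_pi (by norm_num)
      fun p => ENNReal.ofReal (tiltMoment f 1 p)⁻¹, ← mul_assoc,
      ← ENNReal.ofReal_mul (by positivity)]
    congr 2
    rw [one_div, inv_pow, inv_inv, show (32:ℝ) = 16 * 2 by norm_num, mul_pow]; ring
  have h3 := main.trans ((lintegral_mono h1).trans_eq h2)
  set N := Fintype.card κ
  set I := ∫⁻ ξ, ENNReal.ofReal (tiltMoment f 1 ξ)⁻¹
  calc ENNReal.ofReal ((π / 32) ^ N * f 0)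
      = ENNReal.ofReal (f 0 / 32 ^ N) * ENNReal.ofReal (π ^ N) := by
        rw [← ENNReal.ofReal_mul (by positivity)]; congr 1; rw [div_pow]; ring
    _ ≤ ENNReal.ofReal (f 0 / 32 ^ N) * (ENNReal.ofReal (32 ^ N / f 0) * I) := by gcongr
    _ = _ := by
        rw [← mul_assoc, ← ENNReal.ofReal_mul (by positivity),
          show f 0 / 32 ^ N * (32 ^ N / f 0) = 1 by field_simp, ENNReal.ofReal_one, one_mul]
end IsRegularDensity
end SymmetrizedTilt

section DetDerivative
variable {κ : Type*} [Fintype κ] [DecidableEq κ]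

theorem Matrix.det_updateRow_eq_sum_adjugate (M : Matrix κ κ ℝ) (i : κ) (v : κ → ℝ) :
    (M.updateRow i v).det = ∑ j, v j * M.adjugate j i := by
  rw [Matrix.det_eq_sum_mul_adjugate_row _ i]
  refine Finset.sum_congr rfl fun j _ => ?_
  rw [Matrix.updateRow_self, Matrix.adjugate_apply, Matrix.adjugate_apply, Matrix.updateRow_idem]

theorem HasDerivAt.matrix_det {M : ℝ → Matrix κ κ ℝ} {M' : κ → κ → ℝ} {t : ℝ}
    (h : ∀ i j, HasDerivAt (fun s => M s i j) (M' i j) t) :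
    HasDerivAt (fun s => (M s).det) (∑ i, ∑ j, M' i j * (M t).adjugate j i) t := by
  let D : ContinuousMultilinearMap ℝ (fun _ : κ => κ → ℝ) ℝ :=
    { toMultilinearMap := (Matrix.detRowAlternating (n := κ) (R := ℝ)).toMultilinearMap
      cont := (continuous_id (X := Matrix κ κ ℝ)).matrix_det }
  have hM : HasDerivAt (fun s => (fun i j => M s i j : κ → κ → ℝ)) (fun i j => M' i j) t :=
    hasDerivAt_pi.2 fun i => hasDerivAt_pi.2 fun j => h i j
  refine ((D.hasFDerivAt _).comp_hasDerivAt t hM).congr_deriv ?_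
  rw [ContinuousMultilinearMap.linearDeriv_apply]
  exact Finset.sum_congr rfl fun i _ => Matrix.det_updateRow_eq_sum_adjugate (M t) i (M' i)

theorem HasDerivAt.log_matrix_det {M : ℝ → Matrix κ κ ℝ} {M' : κ → κ → ℝ} {t : ℝ}
    (h : ∀ i j, HasDerivAt (fun s => M s i j) (M' i j) t) (h0 : (M t).det ≠ 0) :
    HasDerivAt (fun s => Real.log (M s).det) (∑ i, ∑ j, M' i j * (M t)⁻¹ j i) t := by
  refine ((HasDerivAt.matrix_det h).log h0).congr_deriv ?_
  simp only [Matrix.inv_def, Matrix.smul_apply, smul_eq_mul, Ring.inverse_eq_inv', Finset.sum_div]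
  refine Finset.sum_congr rfl fun i _ => Finset.sum_congr rfl fun j _ => ?_
  field_simp
end DetDerivative

section DeterminantBound
variable {κ : Type*} [Fintype κ] [DecidableEq κ]

/-- A lower bound, uniform over tilts and directions, for the third moments of the tilted
densities, contracted with the inverse covariance. -/
def HasThirdMomentBound (f : (κ → ℝ) → ℝ) (σ : ℝ) : Prop := ∀ ζ ξ : κ → ℝ,
  -(√(Fintype.card κ) * σ * √(ξ ⬝ᵥ (tiltCov f ζ).mulVec ξ)) ≤
    ∑ i, ∑ j, tiltMean f (fun x => (x i - tiltBary f ζ i) * (x j - tiltBary f ζ j) *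
      ξ ⬝ᵥ (x - tiltBary f ζ)) ζ * (tiltCov f ζ)⁻¹ j i

namespace IsRegularDensity
variable {f : (κ → ℝ) → ℝ}

theorem det_tiltCov_zero_mul_exp_le (hf : IsRegularDensity f) (hc : tiltBary f 0 = 0) {σ : ℝ}
    (hσ : HasThirdMomentBound f σ) (ξ : κ → ℝ) :
    (tiltCov f 0).det * rexp (-(Fintype.card κ + σ ^ 2 / 4 * (ξ ⬝ᵥ tiltBary f ξ))) ≤
      (tiltCov f ξ).det := by
  set N : ℝ := (Fintype.card κ : ℝ) with hN
  have hN0 : 0 ≤ N := Nat.cast_nonneg _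
  have hdet : ∀ ζ, 0 < (tiltCov f ζ).det := fun ζ => (hf.tiltCov_posDef ζ).det_pos
  set v : ℝ → ℝ := fun t => Real.log (tiltCov f (0 + t • ξ)).det + (N * t +
    σ ^ 2 / 4 * (ξ ⬝ᵥ tiltBary f (0 + t • ξ))) with hv
  have hd2 : ∀ t, HasDerivAt (fun t : ℝ => ξ ⬝ᵥ tiltBary f (0 + t • ξ))
      (ξ ⬝ᵥ (tiltCov f (0 + t • ξ)).mulVec ξ) t := by
    intro t
    have h1 : HasDerivAt (fun s : ℝ => 0 + s • ξ) ξ t := by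
      simpa using ((hasDerivAt_id t).smul_const ξ).const_add 0
    have h3 := (dotCLM ξ).hasFDerivAt.comp_hasDerivAt t
      ((hf.hasFDerivAt_tiltBary (0 + t • ξ)).comp_hasDerivAt t h1)
    refine (h3.congr_deriv ?_).congr_of_eventuallyEq (Eventually.of_forall fun s => ?_)
    · simp [dotProduct_comm]
    · simp [dotProduct_comm]
  have hd : ∀ t, HasDerivAt v (_ + (N * 1 + σ ^ 2 / 4 * _)) t := fun t =>
    (HasDerivAt.log_matrix_det (fun i j => hf.hasDerivAt_tiltCov_ray 0 ξ t i j) (hdet _).ne').add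
      (((hasDerivAt_id t).const_mul N).add ((hd2 t).const_mul _))
  have hmono : Monotone v := by
    refine monotone_of_deriv_nonneg (fun t => (hd t).differentiableAt) fun t => ?_
    rw [(hd t).deriv]
    have h := hσ (0 + t • ξ) ξ
    have hw : 0 ≤ ξ ⬝ᵥ (tiltCov f (0 + t • ξ)).mulVec ξ := by
      simpa using (hf.tiltCov_posDef (0 + t • ξ)).posSemidef.dotProduct_mulVec_nonneg ξ
    have h1 := Real.sq_sqrt hw
    have h2 := Real.sq_sqrt hN0
    have h3 := sq_nonneg (√N - σ / 2 * √(ξ ⬝ᵥ (tiltCov f (0 + t • ξ)).mulVec ξ))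
    have h4 : √N * σ * √(ξ ⬝ᵥ (tiltCov f (0 + t • ξ)).mulVec ξ) ≤
        N * 1 + σ ^ 2 / 4 * (ξ ⬝ᵥ (tiltCov f (0 + t • ξ)).mulVec ξ) := by
      nlinarith
    linarith
  have h01 := hmono zero_le_one
  simp only [hv, zero_smul, one_smul, zero_add, mul_zero, mul_one, hc, dotProduct_zero,
    add_zero] at h01
  rw [← Real.log_le_log_iff (mul_pos (hdet _) (exp_pos _)) (hdet _),
    Real.log_mul (hdet _).ne' (exp_pos _).ne', Real.log_exp]
  linarith

/-- The integral of the Jacobian of `tiltBary f` against `exp (-ξ ⬝ᵥ tiltBary f ξ)` is at most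
`4 ^ n / f 0`. -/
theorem lintegral_det_mul_exp_le (hf : IsRegularDensity f) (hc : tiltBary f 0 = 0) :
    ∫⁻ ξ, ENNReal.ofReal ((tiltCov f ξ).det * rexp (-(ξ ⬝ᵥ tiltBary f ξ))) ≤
      ENNReal.ofReal (4 ^ Fintype.card κ / f 0) := by
  have f0 := hf.apply_zero_pos hc
  have h := lintegral_image_eq_lintegral_abs_det_fderiv_mul volume MeasurableSet.univ
    (fun ξ _ => (hf.hasFDerivAt_tiltBary ξ).hasFDerivWithinAt) hf.tiltBary_injective.injOn
    fun x => ENNReal.ofReal (f x)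
  simp only [LinearMap.det_toContinuousLinearMap, LinearMap.det_toLin', Measure.restrict_univ] at h
  calc _ ≤ ∫⁻ ξ, ENNReal.ofReal (4 ^ Fintype.card κ / f 0) *
        (ENNReal.ofReal |(tiltCov f ξ).det| * ENNReal.ofReal (f (tiltBary f ξ))) := by
        refine lintegral_mono fun ξ => ?_
        rw [← ENNReal.ofReal_mul (abs_nonneg _), ← ENNReal.ofReal_mul (by positivity)]
        refine ENNReal.ofReal_le_ofReal ?_
        have h1 := hf.apply_zero_mul_exp_neg_le ξ
        have hd := (hf.tiltCov_posDef ξ).det_pos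
        rw [abs_of_pos hd, mul_left_comm]
        refine mul_le_mul_of_nonneg_left ?_ hd.le
        rw [div_mul_eq_mul_div, le_div_iff₀ f0]
        linarith
    _ = ENNReal.ofReal (4 ^ Fintype.card κ / f 0) *
        ∫⁻ x in tiltBary f '' univ, ENNReal.ofReal (f x) := by
        rw [lintegral_const_mul' _ _ ENNReal.ofReal_ne_top, h]
    _ ≤ ENNReal.ofReal (4 ^ Fintype.card κ / f 0) * 1 := by
        gcongr
        exact (setLIntegral_le_lintegral _ _).trans_eq hf.lintegral_eq_one
    _ = _ := mul_one _

theorem sq_apply_zero_mul_det_le (hf : IsRegularDensity f) (hc : tiltBary f 0 = 0) {σ : ℝ}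
    (hσ : HasThirdMomentBound f σ) :
    f 0 ^ 2 * (tiltCov f 0).det ≤ (128 * (2 + σ ^ 2 / 4)) ^ Fintype.card κ := by
  have f0 := hf.apply_zero_pos hc
  have hA := (hf.tiltCov_posDef 0).det_pos
  set A := (tiltCov f 0).det with hAd
  set N := Fintype.card κ with hN
  set τ : ℝ := 1 + σ ^ 2 / 4 with hτ
  have hτ0 : 0 < 1 + τ := by positivity
  have key : ENNReal.ofReal (A * rexp (-N) * (((1 + τ) ^ N)⁻¹ * ((π / 32) ^ N * f 0))) ≤
      ENNReal.ofReal (4 ^ N / f 0) := by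
    calc _ = ENNReal.ofReal (A * rexp (-N)) * (ENNReal.ofReal ((1 + τ) ^ N)⁻¹ *
          ENNReal.ofReal ((π / 32) ^ N * f 0)) := by
          rw [ENNReal.ofReal_mul (by positivity),
            ENNReal.ofReal_mul (p := ((1 + τ) ^ N)⁻¹) (by positivity)]
      _ ≤ ENNReal.ofReal (A * rexp (-N)) * (ENNReal.ofReal ((1 + τ) ^ N)⁻¹ *
          ∫⁻ ξ, ENNReal.ofReal (tiltMoment f 1 ξ)⁻¹) := by
          gcongr; exact hf.le_lintegral_inv_tiltMoment hc
      _ = ∫⁻ ξ, ENNReal.ofReal (A * rexp (-N)) *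
          ENNReal.ofReal (tiltMoment f 1 ((1 + τ) • ξ))⁻¹ := by
          rw [lintegral_const_mul' _ _ ENNReal.ofReal_ne_top, lintegral_comp_smul_pi hτ0
            fun ξ => ENNReal.ofReal (tiltMoment f 1 ξ)⁻¹]
      _ ≤ ∫⁻ ξ, ENNReal.ofReal ((tiltCov f ξ).det * rexp (-(ξ ⬝ᵥ tiltBary f ξ))) := by
          refine lintegral_mono fun ξ => ?_
          rw [← ENNReal.ofReal_mul (by positivity)]
          refine ENNReal.ofReal_le_ofReal ?_
          have h1 := hf.det_tiltCov_zero_mul_exp_le hc hσ ξ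
          have h2 := hf.tiltMoment_mul_exp_le ξ (τ • ξ)
          have h3 := hf.one_le_tiltMoment hc ξ
          rw [smul_dotProduct, smul_eq_mul, show ξ + τ • ξ = (1 + τ) • ξ by
            rw [add_smul 1 τ ξ, one_smul]] at h2
          have h4 : rexp (τ * (ξ ⬝ᵥ tiltBary f ξ)) ≤ tiltMoment f 1 ((1 + τ) • ξ) :=
            (le_mul_of_one_le_left (exp_pos _).le h3).trans h2
          calc A * rexp (-N) * (tiltMoment f 1 ((1 + τ) • ξ))⁻¹
              ≤ A * rexp (-N) * rexp (-(τ * (ξ ⬝ᵥ tiltBary f ξ))) := by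
                refine mul_le_mul_of_nonneg_left ?_ (by positivity)
                rw [Real.exp_neg (τ * _)]
                exact inv_anti₀ (exp_pos _) h4
            _ = A * rexp (-(N + σ ^ 2 / 4 * (ξ ⬝ᵥ tiltBary f ξ))) *
                rexp (-(ξ ⬝ᵥ tiltBary f ξ)) := by
                rw [mul_assoc, mul_assoc, ← Real.exp_add, ← Real.exp_add]
                congr 2; rw [hτ]; ring
            _ ≤ _ := mul_le_mul_of_nonneg_right h1 (exp_pos _).le
      _ ≤ _ := hf.lintegral_det_mul_exp_le hc
  have key2 := (ENNReal.ofReal_le_ofReal_iff (by positivity)).1 key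
  rw [le_div_iff₀ f0] at key2
  have hexp : rexp (-N) = (rexp 1 ^ N)⁻¹ := by
    rw [Real.exp_neg, ← Real.exp_nat_mul, mul_one]
  have hpe : rexp 1 ≤ π := by linarith [Real.exp_one_lt_d9, Real.pi_gt_d2]
  calc f 0 ^ 2 * A = (A * rexp (-N) * (((1 + τ) ^ N)⁻¹ * ((π / 32) ^ N * f 0)) * f 0) *
        (rexp 1 ^ N * (1 + τ) ^ N * (32 / π) ^ N) := by
        rw [hexp, div_pow, div_pow]; field_simp
    _ ≤ 4 ^ N * (rexp 1 ^ N * (1 + τ) ^ N * (32 / π) ^ N) := by gcongr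
    _ ≤ 4 ^ N * (π ^ N * (1 + τ) ^ N * (32 / π) ^ N) := by gcongr
    _ = _ := by
        rw [← mul_pow, ← mul_pow, ← mul_pow, hτ]
        congr 1; field_simp; ring
end IsRegularDensity
end DeterminantBound

section LogConcaveFunctions
variable {n : ℕ}

namespace IsLogConcaveFn
variable {f : EucSp n → ℝ}

theorem convex (hf : IsLogConcaveFn f) : Convex ℝ {x | 0 < f x} := by
  intro x hx y hy a b ha hb hab
  have h := hf.2 x y b ⟨hb, by linarith⟩
  rw [show 1 - b = a by linarith] at h
  exact lt_of_lt_of_le (mul_pos (rpow_pos_of_pos hx _) (rpow_pos_of_pos hy _)) h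

theorem concaveOn_log (hf : IsLogConcaveFn f) :
    ConcaveOn ℝ {x | 0 < f x} fun x => Real.log (f x) := by
  refine ⟨hf.convex, fun x hx y hy a b ha hb hab => ?_⟩
  have h := hf.2 x y b ⟨hb, by linarith⟩
  rw [show 1 - b = a by linarith] at h
  have hx' : 0 < f x := hx
  have hy' : 0 < f y := hy
  have h2 := Real.log_le_log (mul_pos (rpow_pos_of_pos hx' _) (rpow_pos_of_pos hy' _)) h
  rwa [Real.log_mul (rpow_pos_of_pos hx' _).ne' (rpow_pos_of_pos hy' _).ne', Real.log_rpow hx',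
    Real.log_rpow hy'] at h2

theorem sqrt_mul_sqrt_le (hf : IsLogConcaveFn f) (x y : EucSp n) :
    √(f x) * √(f y) ≤ f ((1 / 2 : ℝ) • (x + y)) := by
  have h := hf.2 x y (1 / 2) ⟨by norm_num, by norm_num⟩
  rwa [show (1 : ℝ) - 1 / 2 = 1 / 2 by norm_num, ← smul_add, ← Real.sqrt_eq_rpow,
    ← Real.sqrt_eq_rpow] at h

theorem indicator (hf : IsLogConcaveFn f) {C : Set (EucSp n)} (hC : Convex ℝ C) :
    IsLogConcaveFn (C.indicator f) := by
  refine ⟨fun x => indicator_nonneg (fun x _ => hf.1 x) x, fun x y l hl => ?_⟩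
  rcases hl.1.eq_or_lt with rfl | h0
  · simp
  rcases hl.2.eq_or_lt with rfl | h1
  · simp
  have hn : 0 ≤ C.indicator f ((1 - l) • x + l • y) := indicator_nonneg (fun x _ => hf.1 x) _
  by_cases hx : x ∈ C
  · by_cases hy : y ∈ C
    · rw [indicator_of_mem hx, indicator_of_mem hy,
        indicator_of_mem (hC hx hy (sub_nonneg.2 hl.2) hl.1 (by ring))]
      exact hf.2 x y l hl
    · rwa [indicator_of_notMem hy, Real.zero_rpow h0.ne', mul_zero]
  · rwa [indicator_of_notMem hx, Real.zero_rpow (by linarith), zero_mul]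

/-- Modifying a log-concave function on a null set makes it measurable, with open positivity
set, without changing its upper bounds. -/
theorem exists_open_version (hf : IsLogConcaveFn f) : ∃ g : EucSp n → ℝ, IsLogConcaveFn g ∧
    Measurable g ∧ IsOpen {x | 0 < g x} ∧ g =ᵐ[volume] f ∧
    ∀ M, (∃ z, 0 < g z) → (∀ x, g x ≤ M) → ∀ x, f x ≤ M := by
  set D : Set (EucSp n) := {x | 0 < f x} with hD
  have hDc : Convex ℝ D := hf.convex
  refine ⟨(interior D).indicator f, hf.indicator hDc.interior, ?_, ?_, ?_, ?_⟩
  · have hlog := hf.concaveOn_log.continuousOn_interior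
    have hc : ContinuousOn f (interior D) :=
      (Real.continuous_exp.comp_continuousOn hlog).congr fun x hx =>
        (Real.exp_log (interior_subset hx : x ∈ D)).symm
    classical
    rw [← Set.piecewise_eq_indicator]
    exact hc.measurable_piecewise (g := 0) continuousOn_const isOpen_interior.measurableSet
  · convert isOpen_interior (s := D) using 1
    ext x
    by_cases hx : x ∈ interior D
    · simp only [mem_ofPred_eq, indicator_of_mem hx, hx, iff_true]
      exact (interior_subset hx : x ∈ D)
    · simp [hx]
  · have h0 : volume (frontier D) = 0 := hDc.addHaar_frontier volume
    refine measure_mono_null (fun x hx => ?_) h0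
    simp only [mem_compl_iff, mem_ofPred_eq] at hx
    by_cases h : x ∈ interior D
    · simp [h] at hx
    · refine ⟨subset_closure ?_, h⟩
      rw [indicator_of_notMem h] at hx
      exact (hf.1 x).lt_of_ne hx
  · rintro M ⟨z, hz⟩ hM x
    have hzi : z ∈ interior D := by
      by_contra h; simp [h] at hz
    have hzp : 0 < f z := (interior_subset hzi : z ∈ D)
    rcases (hf.1 x).eq_or_lt with h0 | h0
    · rw [← h0]; exact hz.le.trans (hM z)
    have hcont : Continuous fun t : ℝ => f x ^ (1 - t) * f z ^ t :=
      ((Real.continuous_const_rpow h0.ne').comp (continuous_const.sub continuous_id)).mul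
        (Real.continuous_const_rpow hzp.ne')
    have hlim : Tendsto (fun t : ℝ => f x ^ (1 - t) * f z ^ t) (𝓝[>] 0) (𝓝 (f x)) := by
      simpa using (hcont.tendsto 0).mono_left nhdsWithin_le_nhds
    refine le_of_tendsto hlim ?_
    filter_upwards [Ioo_mem_nhdsGT (zero_lt_one (α := ℝ))] with t ht
    have hmem : (1 - t) • x + t • z ∈ interior D := by
      rw [add_comm]
      exact hDc.combo_interior_self_mem_interior hzi (show x ∈ D from h0) ht.1
        (sub_nonneg.2 ht.2.le) (by ring)
    refine (hf.2 x z t ⟨ht.1.le, ht.2.le⟩).trans ?_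
    have := hM ((1 - t) • x + t • z)
    rwa [indicator_of_mem hmem] at this
end IsLogConcaveFn

theorem IsLogConcave.exists_measurable_density {μ : Measure (EucSp n)} (h : IsLogConcave μ) :
    ∃ g : EucSp n → ℝ, IsLogConcaveFn g ∧ Measurable g ∧
      μ = volume.withDensity fun x => ENNReal.ofReal (g x) := by
  obtain ⟨f, hf, rfl⟩ := h
  obtain ⟨g, hg, hgm, -, hgf, -⟩ := hf.exists_open_version
  refine ⟨g, hg, hgm, withDensity_congr_ae ?_⟩
  filter_upwards [hgf] with x hx
  rw [hx]
end LogConcaveFunctions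

section Moments
variable {n : ℕ} {μ : Measure (EucSp n)}

theorem IsIsotropic.integral_mul (h : IsIsotropic μ) (i j : Fin n) :
    ∫ x, x i * x j ∂μ = if i = j then 1 else 0 := by
  have := h.2 (EuclideanSpace.single i 1) (EuclideanSpace.single j 1)
  simpa [EuclideanSpace.inner_single_right, eq_comm, Pi.single_apply] using this

theorem IsIsotropic.integrable_sq (h : IsIsotropic μ) (i : Fin n) :
    Integrable (fun x => x i ^ 2) μ := by
  by_contra hn
  have := h.integral_mul i i
  simp_rw [← sq] at this
  rw [integral_undef hn] at this
  simp at this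

theorem IsIsotropic.integrable_norm_sq (h : IsIsotropic μ) :
    Integrable (fun x : EucSp n => ‖x‖ ^ 2) μ := by
  simp_rw [EuclideanSpace.real_norm_sq_eq]
  exact integrable_finsetSum _ fun i _ => h.integrable_sq i

theorem IsIsotropic.integral_norm_sq (h : IsIsotropic μ) :
    ∫ x : EucSp n, ‖x‖ ^ 2 ∂μ = n := by
  simp_rw [EuclideanSpace.real_norm_sq_eq]
  rw [integral_finsetSum _ fun i _ => h.integrable_sq i]
  simp_rw [sq, h.integral_mul]
  simp

theorem IsIsotropic.half_le_measure_closedBall [IsProbabilityMeasure μ] (h : IsIsotropic μ)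
    (hn : 0 < n) : ENNReal.ofReal (1 / 2) ≤ μ (Metric.closedBall 0 (2 * √n)) := by
  have hn' : (0 : ℝ) < n := by exact_mod_cast hn
  have h1 := mul_meas_ge_le_integral_of_nonneg (μ := μ) (f := fun x : EucSp n => ‖x‖ ^ 2)
    (Eventually.of_forall fun x => sq_nonneg _) h.integrable_norm_sq (4 * n)
  rw [h.integral_norm_sq] at h1
  have h2 : μ.real {x : EucSp n | (4 * n : ℝ) ≤ ‖x‖ ^ 2} ≤ 1 / 4 := by
    by_contra! hcon; nlinarith
  have h3 : (Metric.closedBall (0 : EucSp n) (2 * √n))ᶜ ⊆ {x | (4 * n : ℝ) ≤ ‖x‖ ^ 2} := by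
    intro x hx
    simp only [mem_compl_iff, mem_closedBall_zero_iff, not_le] at hx
    have h4 : (2 * √n) ^ 2 = 4 * n := by rw [mul_pow, Real.sq_sqrt hn'.le]; norm_num
    rw [mem_ofPred_eq, ← h4]
    exact pow_le_pow_left₀ (by positivity) hx.le 2
  have h5 := (measureReal_mono (μ := μ) h3).trans h2
  rw [probReal_compl_eq_one_sub Metric.isClosed_closedBall.measurableSet] at h5
  rw [← ofReal_measureReal]
  exact ENNReal.ofReal_le_ofReal (by linarith)
end Moments

section ThirdMoment
variable {n : ℕ}

theorem lintegral_comp_half_smul_add (F : EucSp n → ENNReal) (y : EucSp n) :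
    ∫⁻ x, F ((1 / 2 : ℝ) • (x + y)) = 2 ^ n * ∫⁻ x, F x := by
  have h1 := lintegral_add_right_eq_self (μ := (volume : Measure (EucSp n)))
    (fun x => F ((1 / 2 : ℝ) • x)) y
  rw [h1]
  have h2 := Measure.map_addHaar_smul (volume : Measure (EucSp n)) (r := (1 / 2 : ℝ)) (by norm_num)
  have h3 : MeasurableEmbedding fun x : EucSp n => (1 / 2 : ℝ) • x :=
    (Homeomorph.smulOfNeZero (1 / 2 : ℝ) (by norm_num)).measurableEmbedding
  rw [← h3.lintegral_map, h2, lintegral_smul_measure, finrank_euclideanSpace, Fintype.card_fin,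
    smul_eq_mul]
  congr 1
  rw [abs_of_nonneg (by positivity), one_div, inv_pow, inv_inv,
    ENNReal.ofReal_pow (by norm_num)]
  norm_num

variable {P G : EucSp n → ENNReal}

theorem lintegral_enorm_mul_mul_le (hPm : Measurable P) (hGm : Measurable G)
    (hmid : ∀ x y, G x * G y ≤ P ((1 / 2 : ℝ) • (x + y))) (hP1 : ∫⁻ x, P x = 1)
    {T : ENNReal} {y : EucSp n} (hy : ‖y‖ₑ ≤ T) :
    (∫⁻ x, ‖x‖ₑ * G x) * G y ≤ 2 ^ n * (2 * (∫⁻ x, ‖x‖ₑ * P x) + T) := by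
  calc (∫⁻ x, ‖x‖ₑ * G x) * G y = ∫⁻ x, ‖x‖ₑ * G x * G y :=
        (lintegral_mul_const _ (by fun_prop)).symm
    _ ≤ ∫⁻ x, (fun m => 2 * (‖m‖ₑ * P m) + T * P m) ((1 / 2 : ℝ) • (x + y)) := by
        refine lintegral_mono fun x => ?_
        have hx : ‖x‖ₑ ≤ 2 * ‖(1 / 2 : ℝ) • (x + y)‖ₑ + T := by
          have h : x = (2 : ℝ) • ((1 / 2 : ℝ) • (x + y)) - y := by
            rw [smul_smul]; norm_num
          calc ‖x‖ₑ = ‖(2 : ℝ) • ((1 / 2 : ℝ) • (x + y)) - y‖ₑ := by rw [← h]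
            _ ≤ ‖(2 : ℝ) • ((1 / 2 : ℝ) • (x + y))‖ₑ + ‖y‖ₑ := enorm_sub_le
            _ ≤ _ := by
              rw [enorm_smul]
              gcongr
              simp [enorm_eq_nnnorm]
        calc ‖x‖ₑ * G x * G y ≤ (2 * ‖(1 / 2 : ℝ) • (x + y)‖ₑ + T) * P ((1 / 2 : ℝ) • (x + y)) := by
              rw [mul_assoc]
              exact mul_le_mul' hx (hmid x y)
          _ = _ := by simp only [add_mul, mul_assoc]
    _ = _ := by
        rw [lintegral_comp_half_smul_add (fun m => 2 * (‖m‖ₑ * P m) + T * P m),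
          lintegral_add_left (by fun_prop),
          lintegral_const_mul _ (by fun_prop), lintegral_const_mul _ (by fun_prop), hP1, mul_one]

theorem setLIntegral_mul_mul_enorm_sq_le (hPm : Measurable P) (hGm : Measurable G)
    (hmid : ∀ x y, G x * G y ≤ P ((1 / 2 : ℝ) • (x + y))) {T : ℝ} {x : EucSp n}
    (hx : 3 * T ≤ ‖x‖) :
    (∫⁻ y in Metric.closedBall 0 T, G y) * (G x * ‖x‖ₑ ^ 2) ≤
      2 ^ n * (9 * ∫⁻ x, ‖x‖ₑ ^ 2 * P x) := by
  calc (∫⁻ y in Metric.closedBall 0 T, G y) * (G x * ‖x‖ₑ ^ 2)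
      = ∫⁻ y in Metric.closedBall 0 T, G y * (G x * ‖x‖ₑ ^ 2) :=
        (lintegral_mul_const _ (by fun_prop)).symm
    _ ≤ ∫⁻ y in Metric.closedBall 0 T,
          (fun m => 9 * (‖m‖ₑ ^ 2 * P m)) ((1 / 2 : ℝ) • (y + x)) := by
        refine setLIntegral_mono' measurableSet_closedBall fun y hy => ?_
        have hy' : ‖y‖ ≤ T := by simpa using hy
        have h1 : ‖x‖ₑ ≤ 3 * ‖(1 / 2 : ℝ) • (y + x)‖ₑ := by
          rw [← ofReal_norm, ← ofReal_norm, show (3 : ENNReal) = ENNReal.ofReal 3 by norm_num,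
            ← ENNReal.ofReal_mul (by norm_num)]
          apply ENNReal.ofReal_le_ofReal
          rw [norm_smul]
          have := norm_sub_le (y + x) y
          rw [add_sub_cancel_left] at this
          norm_num
          linarith
        calc G y * (G x * ‖x‖ₑ ^ 2) = ‖x‖ₑ ^ 2 * (G y * G x) := by ring
          _ ≤ (3 * ‖(1 / 2 : ℝ) • (y + x)‖ₑ) ^ 2 * P ((1 / 2 : ℝ) • (y + x)) :=
            mul_le_mul' (pow_le_pow_left' h1 2) (hmid y x)
          _ = _ := by simp only []; ring
    _ ≤ ∫⁻ y, (fun m => 9 * (‖m‖ₑ ^ 2 * P m)) ((1 / 2 : ℝ) • (y + x)) :=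
        setLIntegral_le_lintegral _ _
    _ = _ := by rw [lintegral_comp_half_smul_add (fun m => 9 * (‖m‖ₑ ^ 2 * P m)),
          lintegral_const_mul _ (by fun_prop)]

theorem setLIntegral_enorm_cube_mul_le (hPm : Measurable P) (hGm : Measurable G)
    (hGP : ∀ x, G x * G x = P x)
    (hmid : ∀ x y, G x * G y ≤ P ((1 / 2 : ℝ) • (x + y))) (hP1 : ∫⁻ x, P x = 1) (T : ℝ) :
    (∫⁻ x in {x | 3 * T ≤ ‖x‖}, ‖x‖ₑ ^ 3 * P x) * ∫⁻ x in Metric.closedBall 0 T, P x ≤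
      2 ^ n * (9 * ∫⁻ x, ‖x‖ₑ ^ 2 * P x) *
        (2 ^ n * (2 * (∫⁻ x, ‖x‖ₑ * P x) + ENNReal.ofReal T)) := by
  set b := ∫⁻ y in Metric.closedBall 0 T, G y with hb
  set a := ∫⁻ x, ‖x‖ₑ * G x with ha
  set K' := 2 ^ n * (9 * ∫⁻ x, ‖x‖ₑ ^ 2 * P x) with hK'
  set K := 2 ^ n * (2 * (∫⁻ x, ‖x‖ₑ * P x) + ENNReal.ofReal T) with hK
  have h1 : a * ∫⁻ x in Metric.closedBall 0 T, P x ≤ K * b := by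
    rw [← lintegral_const_mul _ hPm, hb, ← lintegral_const_mul _ hGm]
    refine setLIntegral_mono' measurableSet_closedBall fun y hy => ?_
    rw [← hGP, ← mul_assoc]
    refine mul_le_mul_left (lintegral_enorm_mul_mul_le hPm hGm hmid hP1 ?_) _
    rw [← ofReal_norm]
    exact ENNReal.ofReal_le_ofReal (by simpa using hy)
  have h2 : b * ∫⁻ x in {x | 3 * T ≤ ‖x‖}, ‖x‖ₑ ^ 3 * P x ≤ K' * a := by
    rw [← lintegral_const_mul _ (by fun_prop), ha, ← lintegral_const_mul _ (by fun_prop)]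
    refine le_trans ?_ (setLIntegral_le_lintegral {x | 3 * T ≤ ‖x‖} _)
    refine setLIntegral_mono' (measurableSet_le measurable_const measurable_norm) fun x hx => ?_
    rw [← hGP, show b * (‖x‖ₑ ^ 3 * (G x * G x)) = b * (G x * ‖x‖ₑ ^ 2) * (‖x‖ₑ * G x) by ring]
    exact mul_le_mul_left (setLIntegral_mul_mul_enorm_sq_le hPm hGm hmid hx) _
  by_cases hb0 : b = 0
  · have : ∫⁻ x in Metric.closedBall 0 T, P x = 0 := by
      rw [lintegral_eq_zero_iff hPm]
      filter_upwards [(lintegral_eq_zero_iff hGm).1 hb0] with x hx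
      rw [← hGP, hx]; simp
    rw [this, mul_zero]; exact zero_le
  have hbt : b ≠ ⊤ := by
    obtain ⟨y, hy⟩ : ∃ y, G y ≠ 0 := by
      by_contra! hcon
      simp [← hGP, hcon] at hP1
    intro hbt
    have : b * G y ≤ 2 ^ n := by
      rw [← lintegral_mul_const _ hGm]
      calc _ ≤ ∫⁻ x, G x * G y := setLIntegral_le_lintegral _ _
        _ ≤ ∫⁻ x, P ((1 / 2 : ℝ) • (x + y)) := lintegral_mono fun x => hmid x y
        _ = 2 ^ n := by rw [lintegral_comp_half_smul_add, hP1, mul_one]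
    rw [hbt, ENNReal.top_mul hy] at this
    exact absurd this (by simp)
  clear_value b a K K'
  rw [← ENNReal.mul_le_mul_iff_right hb0 hbt]
  calc _ = b * (∫⁻ x in {x | 3 * T ≤ ‖x‖}, ‖x‖ₑ ^ 3 * P x) *
        ∫⁻ x in Metric.closedBall 0 T, P x := by rw [mul_assoc]
    _ ≤ K' * a * ∫⁻ x in Metric.closedBall 0 T, P x := mul_le_mul_left h2 _
    _ ≤ K' * (K * b) := by rw [mul_assoc]; exact mul_le_mul_right h1 _
    _ = _ := by ring

theorem lintegral_enorm_cube_le {μ : Measure (EucSp n)} [IsProbabilityMeasure μ]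
    (hn : 0 < n) (hμ : IsIsotropic μ) (hl : IsLogConcave μ) :
    ∫⁻ x, ‖x‖ₑ ^ 3 ∂μ ≤ ENNReal.ofReal (6 * √n) ^ 3 +
      2 * (2 ^ n * (9 * n) * (2 ^ n * (2 * (1 + n) + ENNReal.ofReal (2 * √n)))) := by
  obtain ⟨g, hg, hgm, hd⟩ := hl.exists_measurable_density
  have hPm : Measurable fun x => ENNReal.ofReal (g x) := by fun_prop
  have hint : ∀ F : EucSp n → ENNReal, Measurable F →
      ∫⁻ x, F x * ENNReal.ofReal (g x) = ∫⁻ x, F x ∂μ := by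
    intro F hF
    rw [hd, lintegral_withDensity_eq_lintegral_mul _ hPm hF]
    simp [mul_comm]
  have hM2 : ∫⁻ x, ‖x‖ₑ ^ 2 ∂μ = n := by
    have h := ofReal_integral_eq_lintegral_ofReal hμ.integrable_norm_sq
      (Eventually.of_forall fun x => sq_nonneg _)
    rw [hμ.integral_norm_sq, ENNReal.ofReal_natCast] at h
    rw [h]
    simp_rw [ENNReal.ofReal_pow (norm_nonneg _), ofReal_norm]
  have hM1 : ∫⁻ x, ‖x‖ₑ ∂μ ≤ 1 + n := by
    calc ∫⁻ x, ‖x‖ₑ ∂μ ≤ ∫⁻ x, (1 + ‖x‖ₑ ^ 2) ∂μ := by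
          refine lintegral_mono fun x => ?_
          rcases le_total (‖x‖ₑ) 1 with h | h
          · exact h.trans le_self_add
          · exact (le_self_pow h two_ne_zero).trans le_add_self
      _ = _ := by rw [lintegral_add_left measurable_const, hM2]; simp
  have key := setLIntegral_enorm_cube_mul_le (P := fun x => ENNReal.ofReal (g x))
    (G := fun x => ENNReal.ofReal (√(g x))) hPm (by fun_prop)
    (fun x => by rw [← ENNReal.ofReal_mul (sqrt_nonneg _), mul_self_sqrt (hg.1 x)])
    (fun x y => by
      rw [← ENNReal.ofReal_mul (sqrt_nonneg _)]
      exact ENNReal.ofReal_le_ofReal (hg.sqrt_mul_sqrt_le x y))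
    (by simpa using hint 1 measurable_one) (2 * √n)
  rw [hint _ (by fun_prop), hint _ (by fun_prop), hM2] at key
  have hball : ∫⁻ x in Metric.closedBall 0 (2 * √n), ENNReal.ofReal (g x) =
      μ (Metric.closedBall 0 (2 * √n)) := by
    rw [hd, withDensity_apply _ measurableSet_closedBall]
  have hset : MeasurableSet {x : EucSp n | 3 * (2 * √n) ≤ ‖x‖} :=
    measurableSet_le measurable_const measurable_norm
  have htail : ∫⁻ x in {x : EucSp n | 3 * (2 * √n) ≤ ‖x‖}, ‖x‖ₑ ^ 3 * ENNReal.ofReal (g x) =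
      ∫⁻ x in {x : EucSp n | 3 * (2 * √n) ≤ ‖x‖}, ‖x‖ₑ ^ 3 ∂μ := by
    rw [hd, setLIntegral_withDensity_eq_setLIntegral_mul _ hPm (by fun_prop) hset]
    simp [mul_comm]
  rw [hball, htail] at key
  have hhalf := hμ.half_le_measure_closedBall hn
  rw [← lintegral_add_compl _ hset, add_comm]
  refine add_le_add ?_ ?_
  · calc _ ≤ ∫⁻ x in {x : EucSp n | 3 * (2 * √n) ≤ ‖x‖}ᶜ, ENNReal.ofReal (6 * √n) ^ 3 ∂μ := by
          refine setLIntegral_mono' hset.compl fun x hx => ?_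
          refine pow_le_pow_left' ?_ 3
          rw [← ofReal_norm]
          refine ENNReal.ofReal_le_ofReal ?_
          have : ¬ 3 * (2 * √n) ≤ ‖x‖ := hx
          linarith
      _ ≤ _ := by
        rw [setLIntegral_const]
        exact mul_le_of_le_one_right' prob_le_one
  · set t := ∫⁻ x in {x : EucSp n | 3 * (2 * √n) ≤ ‖x‖}, ‖x‖ₑ ^ 3 ∂μ
    have h2 : (2 : ENNReal) * ENNReal.ofReal (1 / 2) = 1 := by
      rw [show (2 : ENNReal) = ENNReal.ofReal 2 by norm_num, ← ENNReal.ofReal_mul (by norm_num)]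
      norm_num
    calc t = 2 * (t * ENNReal.ofReal (1 / 2)) := by rw [mul_left_comm, h2, mul_one]
      _ ≤ 2 * (t * μ (Metric.closedBall 0 (2 * √n))) := by gcongr
      _ ≤ _ := by
        refine mul_le_mul_right (key.trans ?_) _
        gcongr

theorem exists_forall_lintegral_enorm_cube_le (hn : 0 < n) : ∃ K : ENNReal, K ≠ ⊤ ∧
    ∀ μ : Measure (EucSp n), IsProbabilityMeasure μ → IsIsotropic μ → IsLogConcave μ →
      ∫⁻ x, ‖x‖ₑ ^ 3 ∂μ ≤ K := by
  refine ⟨_, ?_, fun μ h1 h2 h3 => lintegral_enorm_cube_le hn h2 h3⟩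
  finiteness

theorem bddAbove_norm_integral_norm_sq_smul (hn : 0 < n) :
    BddAbove {v | ∃ μ : Measure (EucSp n), IsProbabilityMeasure μ ∧
      IsIsotropic μ ∧ IsLogConcave μ ∧ v = ‖∫ x, (‖x‖ ^ 2) • x ∂μ‖} := by
  obtain ⟨K, hK, h⟩ := exists_forall_lintegral_enorm_cube_le hn
  refine ⟨K.toReal, ?_⟩
  rintro _ ⟨μ, h1, h2, h3, rfl⟩
  refine (norm_integral_le_lintegral_norm _).trans (ENNReal.toReal_mono hK ?_)
  refine le_of_eq_of_le (lintegral_congr fun x => ?_) (h μ h1 h2 h3)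
  rw [norm_smul, norm_pow, norm_norm, ← pow_succ, ENNReal.ofReal_pow (norm_nonneg _), ofReal_norm]

theorem sqrt_mul_sigmaBar (hn : 0 < n) : √n * sigmaBar n =
    sSup {v | ∃ μ : Measure (EucSp n), IsProbabilityMeasure μ ∧
      IsIsotropic μ ∧ IsLogConcave μ ∧ v = ‖∫ x, (‖x‖ ^ 2) • x ∂μ‖} := by
  have : (0 : ℝ) < √n := Real.sqrt_pos.2 (by exact_mod_cast hn)
  rw [sigmaBar, mul_inv_cancel_left₀ this.ne']

theorem norm_integral_norm_sq_smul_le (hn : 0 < n) {μ : Measure (EucSp n)}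
    [h1 : IsProbabilityMeasure μ] (h2 : IsIsotropic μ) (h3 : IsLogConcave μ) :
    ‖∫ x, (‖x‖ ^ 2) • x ∂μ‖ ≤ √n * sigmaBar n := by
  rw [sqrt_mul_sigmaBar hn]
  exact le_csSup (bddAbove_norm_integral_norm_sq_smul hn) ⟨μ, h1, h2, h3, rfl⟩

theorem integrable_norm_sq_smul (hn : 0 < n) {μ : Measure (EucSp n)}
    [h1 : IsProbabilityMeasure μ] (h2 : IsIsotropic μ) (h3 : IsLogConcave μ) :
    Integrable (fun x : EucSp n => (‖x‖ ^ 2) • x) μ := by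
  refine ⟨by fun_prop, ?_⟩
  obtain ⟨K, hK, h⟩ := exists_forall_lintegral_enorm_cube_le hn
  refine lt_of_le_of_lt (le_of_eq_of_le (lintegral_congr fun x => ?_) (h μ h1 h2 h3)) hK.lt_top
  rw [enorm_smul, enorm_pow, enorm_norm, ← pow_succ]
end ThirdMoment

section Whitening
open Matrix

open scoped MatrixOrder in
theorem Matrix.PosDef.exists_transpose_mul_self {ι : Type*} [Fintype ι] [DecidableEq ι]
    {H : Matrix ι ι ℝ} (hH : H.PosDef) : ∃ B : Matrix ι ι ℝ, IsUnit B.det ∧ H = Bᵀ * B := by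
  obtain ⟨B, hB⟩ := CStarAlgebra.nonneg_iff_eq_star_mul_self.mp hH.posSemidef.nonneg
  rw [star_eq_conjTranspose, conjTranspose_eq_transpose_of_trivial] at hB
  refine ⟨B, ?_, hB⟩
  have h := hH.det_pos
  rw [hB, det_mul, det_transpose] at h
  exact isUnit_iff_ne_zero.2 fun h0 => by simp [h0] at h

variable {n : ℕ}

/-- The affine map `x ↦ (Bᵀ)⁻¹ (x - b)` into Euclidean space. -/
def whiten (B : Matrix (Fin n) (Fin n) ℝ) (b x : Fin n → ℝ) : EucSp n :=
  WithLp.toLp 2 ((B⁻¹)ᵀ *ᵥ (x - b))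

/-- The law of the whitening of a random vector with density `g`. -/
def whitenedMeasure (g : (Fin n → ℝ) → ℝ) (B : Matrix (Fin n) (Fin n) ℝ) (b : Fin n → ℝ) :
    Measure (EucSp n) :=
  (volume.withDensity fun x => ENNReal.ofReal (g x)).map (whiten B b)

variable {B : Matrix (Fin n) (Fin n) ℝ} {b : Fin n → ℝ} {g : (Fin n → ℝ) → ℝ}

@[fun_prop]
theorem continuous_whiten : Continuous (whiten B b) := by
  unfold whiten
  exact (PiLp.continuous_toLp 2 _).comp (by fun_prop)

theorem inner_whiten (u : EucSp n) (x : Fin n → ℝ) :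
    ⟪whiten B b x, u⟫ = (B⁻¹ *ᵥ WithLp.ofLp u) ⬝ᵥ (x - b) := by
  rw [whiten, EuclideanSpace.inner_eq_star_dotProduct]
  simp only [star_trivial]
  rw [dotProduct_mulVec, vecMul_transpose]

theorem inner_whiten_toLp_mulVec (hB : IsUnit B.det) (ξ x : Fin n → ℝ) :
    ⟪whiten B b x, WithLp.toLp 2 (B *ᵥ ξ)⟫ = ξ ⬝ᵥ (x - b) := by
  rw [inner_whiten, mulVec_mulVec, nonsing_inv_mul _ hB, one_mulVec]

theorem norm_toLp_mulVec (ξ : Fin n → ℝ) :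
    ‖(WithLp.toLp 2 (B *ᵥ ξ) : EucSp n)‖ = √(ξ ⬝ᵥ ((Bᵀ * B) *ᵥ ξ)) := by
  rw [← mulVec_mulVec, dotProduct_mulVec, vecMul_transpose, ← Real.sqrt_sq (norm_nonneg _),
    EuclideanSpace.real_norm_sq_eq]
  congr 1
  exact Finset.sum_congr rfl fun i _ => sq _

theorem norm_sq_whiten (x : Fin n → ℝ) :
    ‖whiten B b x‖ ^ 2 = ∑ i, ∑ j, (x i - b i) * (x j - b j) * (Bᵀ * B)⁻¹ j i := by
  rw [whiten, EuclideanSpace.real_norm_sq_eq]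
  have h : ∑ i, ((B⁻¹)ᵀ *ᵥ (x - b)) i ^ 2 = ((B⁻¹)ᵀ *ᵥ (x - b)) ⬝ᵥ ((B⁻¹)ᵀ *ᵥ (x - b)) :=
    Finset.sum_congr rfl fun i _ => sq _
  refine h.trans ?_
  rw [dotProduct_mulVec, vecMul_transpose, mulVec_mulVec, dotProduct_comm, transpose_nonsing_inv,
    ← Matrix.mul_inv_rev, Finset.sum_comm]
  simp only [dotProduct, mulVec, Finset.mul_sum, Pi.sub_apply]
  exact Finset.sum_congr rfl fun i _ => Finset.sum_congr rfl fun j _ => by ring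

theorem integral_whitenedMeasure {E : Type*} [NormedAddCommGroup E] [NormedSpace ℝ E]
    (hg : IsRegularDensity g) {F : EucSp n → E} (hF : Continuous F)
    [SecondCountableTopologyEither (EucSp n) E] :
    ∫ z, F z ∂(whitenedMeasure g B b) = ∫ x, g x • F (whiten B b x) := by
  rw [whitenedMeasure, integral_map (by fun_prop) hF.aestronglyMeasurable,
    integral_withDensity_eq_integral_toReal_smul (by have := hg.measurable; fun_prop)
      (by simp)]
  simp_rw [ENNReal.toReal_ofReal (hg.nonneg _)]

theorem integrable_whitenedMeasure {E : Type*} [NormedAddCommGroup E] [NormedSpace ℝ E]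
    (hg : IsRegularDensity g) {F : EucSp n → E} (hF : Continuous F)
    [SecondCountableTopologyEither (EucSp n) E] :
    Integrable F (whitenedMeasure g B b) := by
  have := hg.measurable
  rw [whitenedMeasure, integrable_map_measure hF.aestronglyMeasurable (by fun_prop),
    integrable_withDensity_iff_integrable_smul' (by fun_prop) (by simp)]
  simp_rw [ENNReal.toReal_ofReal (hg.nonneg _)]
  have h := hg.integrable_mul (g := fun x => ‖F (whiten B b x)‖) (by fun_prop)
  refine (integrable_norm_iff ?_).1 (h.congr ?_)
  · exact hg.measurable.aestronglyMeasurable.smul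
      (hF.comp continuous_whiten).aestronglyMeasurable
  · exact Eventually.of_forall fun x => by
      simp [norm_smul, abs_of_nonneg (hg.nonneg x), mul_comm]

theorem isProbabilityMeasure_whitenedMeasure (hg : IsRegularDensity g) :
    IsProbabilityMeasure (whitenedMeasure g B b) := by
  have : IsProbabilityMeasure (volume.withDensity fun x => ENNReal.ofReal (g x)) :=
    ⟨by rw [withDensity_apply _ MeasurableSet.univ, setLIntegral_univ, hg.lintegral_eq_one]⟩
  exact Measure.isProbabilityMeasure_map (by fun_prop)

theorem isLogConcave_whitenedMeasure (hg : IsRegularDensity g) (hB : IsUnit B.det) :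
    IsLogConcave (whitenedMeasure g B b) := by
  set c : ℝ := |((B⁻¹)ᵀ.det)⁻¹| with hc
  have hdet : ((B⁻¹)ᵀ).det ≠ 0 := by
    rw [det_transpose, det_nonsing_inv]
    exact (Ring.inverse_unit hB.unit ▸ by simp [hB.ne_zero] : Ring.inverse B.det ≠ 0)
  have hmap : (volume : Measure (Fin n → ℝ)).map (whiten B b) = ENNReal.ofReal c • volume := by
    have e : whiten B b = (WithLp.toLp 2 : (Fin n → ℝ) → EucSp n) ∘ toLin' ((B⁻¹)ᵀ) ∘
      fun x => x - b := rfl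
    rw [e, ← Measure.map_map (by fun_prop) (by fun_prop), ← Measure.map_map (by fun_prop)
      (by fun_prop), map_sub_right_eq_self, Real.map_matrix_volume_pi_eq_smul_volume_pi hdet,
      Measure.map_smul, (PiLp.volume_preserving_toLp (Fin n)).map_eq]
  let Ψ : EucSp n → Fin n → ℝ := fun z => Bᵀ *ᵥ WithLp.ofLp z + b
  have hΨ : ∀ x, Ψ (whiten B b x) = x := fun x => by
    simp only [Ψ, whiten]
    rw [mulVec_mulVec, ← transpose_mul, nonsing_inv_mul _ hB, transpose_one, one_mulVec,
      sub_add_cancel]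
  have hΨm : Measurable Ψ := by
    have : Continuous Ψ := by fun_prop
    exact this.measurable
  have hgm := hg.measurable
  refine ⟨fun z => c * g (Ψ z), ⟨fun z => mul_nonneg (abs_nonneg _) (hg.nonneg _), ?_⟩, ?_⟩
  · intro x y l hl
    have h := hg.logConcave (Ψ x) (Ψ y) l hl
    have hc0 : 0 < c := abs_pos.2 (inv_ne_zero hdet)
    have e : Ψ ((1 - l) • x + l • y) = (1 - l) • Ψ x + l • Ψ y := by
      simp only [Ψ, WithLp.ofLp_add, WithLp.ofLp_smul, mulVec_add, mulVec_smul]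
      module
    beta_reduce
    rw [e, mul_rpow hc0.le (hg.nonneg _), mul_rpow hc0.le (hg.nonneg _)]
    calc _ = c ^ (1 - l) * c ^ l * (g (Ψ x) ^ (1 - l) * g (Ψ y) ^ l) := by ring
      _ = c * (g (Ψ x) ^ (1 - l) * g (Ψ y) ^ l) := by
        rw [← rpow_add hc0, sub_add_cancel, rpow_one]
      _ ≤ _ := mul_le_mul_of_nonneg_left h hc0.le
  · ext s hs
    rw [whitenedMeasure, Measure.map_apply (by fun_prop) hs,
      withDensity_apply _ ((by fun_prop : Measurable (whiten B b)) hs), withDensity_apply _ hs]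
    have hmul : ∀ z, ENNReal.ofReal (c * g (Ψ z)) = ENNReal.ofReal c * ENNReal.ofReal (g (Ψ z)) :=
      fun z => ENNReal.ofReal_mul (abs_nonneg _)
    simp_rw [hmul]
    rw [lintegral_const_mul _ (by fun_prop), ← smul_eq_mul, ← lintegral_smul_measure, ← Measure.restrict_smul,
      ← hmap, setLIntegral_map hs (by fun_prop) (by fun_prop)]
    simp_rw [hΨ]

theorem isIsotropic_whitenedMeasure (hg : IsRegularDensity g) (hB : IsUnit B.det)
    (hb : ∀ i, ∫ x, x i * g x = b i)
    (hcov : ∀ i j, ∫ x, (x i - b i) * (x j - b j) * g x = (Bᵀ * B) i j) :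
    IsIsotropic (whitenedMeasure g B b) := by
  have hcoord : ∀ i, ∫ x, (x i - b i) * g x = 0 := fun i => by
    simp_rw [sub_mul]
    rw [integral_sub (hg.integrable_mul (by fun_prop)) (hg.integrable.const_mul _), hb,
      integral_const_mul, hg.integral_eq_one, mul_one, sub_self]
  refine ⟨?_, fun u v => ?_⟩
  · refine ext_inner_right ℝ fun u => ?_
    have h1 := integral_inner (𝕜 := ℝ) (integrable_whitenedMeasure (B := B) (b := b) hg
      (F := fun z : EucSp n => z) continuous_id) u
    rw [real_inner_comm, ← h1, inner_zero_left, integral_whitenedMeasure hg (by fun_prop)]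
    simp_rw [real_inner_comm _ u, inner_whiten, dotProduct, smul_eq_mul]
    have e : ∀ x, g x * ∑ i, (B⁻¹ *ᵥ WithLp.ofLp u) i * (x - b) i =
        ∑ i, (B⁻¹ *ᵥ WithLp.ofLp u) i * ((x i - b i) * g x) := fun x => by
      rw [Finset.mul_sum]
      exact Finset.sum_congr rfl fun i _ => by rw [Pi.sub_apply]; ring
    simp_rw [e]
    rw [integral_finsetSum _ fun i _ => (hg.integrable_mul (by fun_prop)).const_mul _]
    simp_rw [integral_const_mul, hcoord, mul_zero, Finset.sum_const_zero]
  · rw [integral_whitenedMeasure hg (by fun_prop)]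
    simp_rw [inner_whiten, smul_eq_mul]
    set p := B⁻¹ *ᵥ WithLp.ofLp u with hp
    set q := B⁻¹ *ᵥ WithLp.ofLp v with hq
    have e : ∀ x, g x * (p ⬝ᵥ (x - b) * q ⬝ᵥ (x - b)) =
        ∑ i, ∑ j, p i * q j * ((x i - b i) * (x j - b j) * g x) := fun x => by
      rw [dotProduct, dotProduct, Finset.sum_mul_sum, Finset.mul_sum]
      refine Finset.sum_congr rfl fun i _ => ?_
      rw [Finset.mul_sum]
      exact Finset.sum_congr rfl fun j _ => by simp only [Pi.sub_apply]; ring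
    simp_rw [e]
    rw [integral_finsetSum _ fun i _ => integrable_finsetSum _ fun j _ =>
      (hg.integrable_mul (by fun_prop)).const_mul _]
    have e2 : ∑ i, ∑ j, p i * q j * (Bᵀ * B) i j = ⟪u, v⟫ := by
      have : ∑ i, ∑ j, p i * q j * (Bᵀ * B) i j = p ⬝ᵥ ((Bᵀ * B) *ᵥ q) := by
        simp only [dotProduct, mulVec, Finset.mul_sum]
        exact Finset.sum_congr rfl fun i _ => Finset.sum_congr rfl fun j _ => by ring
      rw [this, ← mulVec_mulVec, dotProduct_mulVec, vecMul_transpose, hp, hq, mulVec_mulVec,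
        mulVec_mulVec, mul_nonsing_inv _ hB, one_mulVec, one_mulVec,
        EuclideanSpace.inner_eq_star_dotProduct, star_trivial, dotProduct_comm]
    rw [← e2]
    refine Finset.sum_congr rfl fun i _ => ?_
    rw [integral_finsetSum _ fun j _ => (hg.integrable_mul (by fun_prop)).const_mul _]
    exact Finset.sum_congr rfl fun j _ => by rw [integral_const_mul, hcov]

/-- The third moments of a regular density, contracted with the inverse covariance, are controlled
by `sigmaBar`. -/
theorem IsRegularDensity.abs_integral_contract_le (hn : 0 < n) (hg : IsRegularDensity g)
    {H : Matrix (Fin n) (Fin n) ℝ} (hH : H.PosDef) (hb : ∀ i, ∫ x, x i * g x = b i)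
    (hcov : ∀ i j, ∫ x, (x i - b i) * (x j - b j) * g x = H i j) (ξ : Fin n → ℝ) :
    |∑ i, ∑ j, (∫ x, (x i - b i) * (x j - b j) * ξ ⬝ᵥ (x - b) * g x) * H⁻¹ j i| ≤
      √n * sigmaBar n * √(ξ ⬝ᵥ (H *ᵥ ξ)) := by
  obtain ⟨B, hB, rfl⟩ := hH.exists_transpose_mul_self
  have hprob := isProbabilityMeasure_whitenedMeasure (B := B) (b := b) hg
  have hiso := isIsotropic_whitenedMeasure hg hB hb hcov
  have hlog := isLogConcave_whitenedMeasure (b := b) hg hB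
  have hmain := norm_integral_norm_sq_smul_le hn hiso hlog
  have hint := integrable_whitenedMeasure (B := B) (b := b) hg
    (F := fun z : EucSp n => ‖z‖ ^ 2 • z) (by fun_prop)
  have hcs := abs_real_inner_le_norm (∫ z, ‖z‖ ^ 2 • z ∂(whitenedMeasure g B b))
    (WithLp.toLp 2 (B *ᵥ ξ))
  rw [norm_toLp_mulVec] at hcs
  refine le_trans (le_of_eq ?_) (hcs.trans (by gcongr))
  congr 1
  rw [real_inner_comm, ← integral_inner (𝕜 := ℝ) hint, integral_whitenedMeasure hg (by fun_prop)]
  have e : ∀ x, g x • ⟪WithLp.toLp 2 (B *ᵥ ξ), ‖whiten B b x‖ ^ 2 • whiten B b x⟫ =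
      ∑ i, ∑ j, (x i - b i) * (x j - b j) * ξ ⬝ᵥ (x - b) * g x * (Bᵀ * B)⁻¹ j i := fun x => by
    rw [inner_smul_right, real_inner_comm, inner_whiten_toLp_mulVec hB, norm_sq_whiten,
      Finset.sum_mul, Finset.smul_sum]
    refine Finset.sum_congr rfl fun i _ => ?_
    rw [Finset.sum_mul, Finset.smul_sum]
    exact Finset.sum_congr rfl fun j _ => by rw [smul_eq_mul]; ring
  have hint3 : ∀ i j, Integrable fun x =>
      (x i - b i) * (x j - b j) * ξ ⬝ᵥ (x - b) * g x * (Bᵀ * B)⁻¹ j i := fun i j =>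
    (hg.integrable_mul (by fun_prop)).mul_const _
  simp_rw [e]
  rw [integral_finsetSum _ fun i _ => integrable_finsetSum _ fun j _ => hint3 i j]
  refine Finset.sum_congr rfl fun i _ => ?_
  rw [integral_finsetSum _ fun j _ => hint3 i j]
  exact Finset.sum_congr rfl fun j _ => (integral_mul_const _ _).symm

theorem IsRegularDensity.hasThirdMomentBound (hn : 0 < n) (hg : IsRegularDensity g) :
    HasThirdMomentBound g (sigmaBar n) := by
  intro ζ ξ
  have h := (hg.tilt ζ).abs_integral_contract_le hn (hg.tiltCov_posDef ζ) (b := tiltBary g ζ)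
    (fun i => rfl) (fun i j => (hg.tiltCov_apply ζ i j).symm) ξ
  rw [Fintype.card_fin]
  exact neg_le_of_abs_le h

end Whitening

section ShiftedExponential

/-- Density of a standard exponential variable shifted to have mean zero. -/
def shiftedExp : ℝ → ℝ := (Ioi (-1)).indicator fun t => rexp (-(t + 1))

theorem shiftedExp_nonneg (t : ℝ) : 0 ≤ shiftedExp t :=
  indicator_nonneg (fun _ _ => (exp_pos _).le) t

theorem measurable_shiftedExp : Measurable shiftedExp :=
  (by fun_prop : Measurable fun t : ℝ => rexp (-(t + 1))).indicator measurableSet_Ioi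

theorem pow_mul_shiftedExp_sub_one (j : ℕ) (s : ℝ) : s ^ j * shiftedExp (s - 1) =
    (Ioi (0 : ℝ)).indicator (fun s => rexp (-s) * s ^ ((j + 1 : ℝ) - 1)) s := by
  by_cases hs : 0 < s
  · have h1 : s - 1 ∈ Ioi (-1 : ℝ) := by simp [hs]
    rw [shiftedExp, indicator_of_mem h1, indicator_of_mem (mem_Ioi.2 hs)]
    simp [mul_comm]
  · have h1 : s - 1 ∉ Ioi (-1 : ℝ) := by simpa using hs
    rw [shiftedExp, indicator_of_notMem h1, indicator_of_notMem (by simpa using hs), mul_zero]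

theorem integrable_pow_mul_shiftedExp_sub_one (j : ℕ) :
    Integrable fun s => s ^ j * shiftedExp (s - 1) := by
  simp_rw [pow_mul_shiftedExp_sub_one]
  rw [integrable_indicator_iff measurableSet_Ioi]
  exact Real.GammaIntegral_convergent (by positivity)

theorem integral_pow_mul_shiftedExp_sub_one (j : ℕ) :
    ∫ s, s ^ j * shiftedExp (s - 1) = j.factorial := by
  simp_rw [pow_mul_shiftedExp_sub_one]
  rw [integral_indicator measurableSet_Ioi, ← Real.Gamma_eq_integral (by positivity),
    Real.Gamma_nat_eq_factorial]

theorem integrable_pow_mul_shiftedExp (k : ℕ) : Integrable fun t => t ^ k * shiftedExp t := by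
  have e : (fun s : ℝ => (s - 1) ^ k * shiftedExp (s - 1)) = fun s =>
      ∑ m ∈ Finset.range (k + 1), (-1) ^ (k - m) * (k.choose m : ℝ) *
        (s ^ m * shiftedExp (s - 1)) := by
    ext s
    rw [sub_eq_add_neg, add_pow, Finset.sum_mul]
    exact Finset.sum_congr rfl fun m _ => by rw [← sub_eq_add_neg]; ring
  have h : Integrable fun s : ℝ => (s - 1) ^ k * shiftedExp (s - 1) :=
    e ▸ integrable_finsetSum _ fun m _ => (integrable_pow_mul_shiftedExp_sub_one m).const_mul _
  simpa using h.comp_add_right 1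

theorem integral_pow_mul_shiftedExp (k : ℕ) : ∫ t, t ^ k * shiftedExp t =
    ∑ m ∈ Finset.range (k + 1), (-1) ^ (k - m) * (k.choose m : ℝ) * m.factorial := by
  rw [← integral_sub_right_eq_self _ (1 : ℝ)]
  have e : (fun s : ℝ => (s - 1) ^ k * shiftedExp (s - 1)) = fun s =>
      ∑ m ∈ Finset.range (k + 1), (-1) ^ (k - m) * (k.choose m : ℝ) *
        (s ^ m * shiftedExp (s - 1)) := by
    ext s
    rw [sub_eq_add_neg, add_pow, Finset.sum_mul]
    exact Finset.sum_congr rfl fun m _ => by rw [← sub_eq_add_neg]; ring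
  rw [e, integral_finsetSum _ fun m _ => (integrable_pow_mul_shiftedExp_sub_one m).const_mul _]
  simp_rw [integral_const_mul, integral_pow_mul_shiftedExp_sub_one]

theorem integral_pow_zero_mul_shiftedExp : ∫ t, t ^ 0 * shiftedExp t = 1 := by
  rw [integral_pow_mul_shiftedExp]; simp

theorem integral_pow_one_mul_shiftedExp : ∫ t, t ^ 1 * shiftedExp t = 0 := by
  rw [integral_pow_mul_shiftedExp]; simp [Finset.sum_range_succ]

theorem integral_pow_two_mul_shiftedExp : ∫ t, t ^ 2 * shiftedExp t = 1 := by
  rw [integral_pow_mul_shiftedExp]; norm_num [Finset.sum_range_succ, Nat.choose, Nat.factorial]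

theorem integral_pow_three_mul_shiftedExp : ∫ t, t ^ 3 * shiftedExp t = 2 := by
  rw [integral_pow_mul_shiftedExp]; norm_num [Finset.sum_range_succ, Nat.choose, Nat.factorial]

variable {n : ℕ}

/-- The product of `n` centered exponential densities. -/
def prodShiftedExp (n : ℕ) (z : EucSp n) : ℝ := ∏ i, shiftedExp (z i)

/-- The law of `n` independent centered exponential variables. -/
def prodShiftedExpMeasure (n : ℕ) : Measure (EucSp n) :=
  volume.withDensity fun z => ENNReal.ofReal (prodShiftedExp n z)

theorem prodShiftedExp_nonneg (z : EucSp n) : 0 ≤ prodShiftedExp n z :=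
  Finset.prod_nonneg fun _ _ => shiftedExp_nonneg _

theorem measurable_prodShiftedExp : Measurable (prodShiftedExp n) :=
  Finset.measurable_prod _ fun i _ => measurable_shiftedExp.comp (by fun_prop)

theorem isLogConcaveFn_prodShiftedExp : IsLogConcaveFn (prodShiftedExp n) := by
  have hC : Convex ℝ {z : EucSp n | ∀ i, -1 < z i} := by
    have : {z : EucSp n | ∀ i, -1 < z i} = ⋂ i, {z | -1 < EuclideanSpace.proj (𝕜 := ℝ) i z} := by
      ext z; simp
    rw [this]
    exact convex_iInter fun i => (convex_Ioi (-1 : ℝ)).linear_preimage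
      (EuclideanSpace.proj (𝕜 := ℝ) i : EucSp n →L[ℝ] ℝ).toLinearMap
  have hexp : IsLogConcaveFn fun z : EucSp n => rexp (∑ i, -(z i + 1)) := by
    refine ⟨fun z => (exp_pos _).le, fun x y l hl => le_of_eq ?_⟩
    rw [← exp_mul, ← exp_mul, ← exp_add, Finset.sum_mul, Finset.sum_mul, ← Finset.sum_add_distrib]
    congr 1
    refine Finset.sum_congr rfl fun i _ => ?_
    simp only [PiLp.add_apply, PiLp.smul_apply, smul_eq_mul]
    ring
  convert hexp.indicator hC using 1
  ext z
  by_cases hz : ∀ i, -1 < z i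
  · rw [indicator_of_mem (by exact hz), prodShiftedExp, exp_sum]
    exact Finset.prod_congr rfl fun i _ => indicator_of_mem (mem_Ioi.2 (hz i)) _
  · rw [indicator_of_notMem (by exact hz)]
    push Not at hz
    obtain ⟨i, hi⟩ := hz
    exact Finset.prod_eq_zero (Finset.mem_univ i) (indicator_of_notMem (by simpa using hi) _)

theorem integrable_prod_pow_mul_prodShiftedExp (α : Fin n → ℕ) :
    Integrable fun z : EucSp n => (∏ k, z k ^ α k) * prodShiftedExp n z := by
  rw [← (PiLp.volume_preserving_toLp (Fin n)).integrable_comp_emb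
    (MeasurableEquiv.toLp 2 (Fin n → ℝ)).measurableEmbedding]
  have h := Integrable.fintype_prod (μ := fun _ : Fin n => (volume : Measure ℝ))
    (f := fun k t => t ^ α k * shiftedExp t) fun k => integrable_pow_mul_shiftedExp (α k)
  refine h.congr (Eventually.of_forall fun x => ?_)
  simp [prodShiftedExp, Finset.prod_mul_distrib]

theorem integral_prod_pow_mul_prodShiftedExp (α : Fin n → ℕ) :
    ∫ z : EucSp n, (∏ k, z k ^ α k) * prodShiftedExp n z =
      ∏ k, ∫ t, t ^ α k * shiftedExp t := by
  rw [← (PiLp.volume_preserving_toLp (Fin n)).integral_comp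
    (MeasurableEquiv.toLp 2 (Fin n → ℝ)).measurableEmbedding,
    ← integral_fintype_prod_volume_eq_prod (𝕜 := ℝ) (fun (k : Fin n) t => t ^ α k * shiftedExp t)]
  simp [prodShiftedExp, Finset.prod_mul_distrib]

theorem integral_prodShiftedExpMeasure (F : EucSp n → ℝ) :
    ∫ z, F z ∂(prodShiftedExpMeasure n) = ∫ z, F z * prodShiftedExp n z := by
  rw [prodShiftedExpMeasure, integral_withDensity_eq_integral_toReal_smul
    (by have := @measurable_prodShiftedExp n; fun_prop) (by simp)]
  simp_rw [ENNReal.toReal_ofReal (prodShiftedExp_nonneg _), smul_eq_mul,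
    mul_comm (prodShiftedExp n _)]

theorem integral_prod_pow_prodShiftedExpMeasure (α : Fin n → ℕ) :
    ∫ z : EucSp n, ∏ k, z k ^ α k ∂(prodShiftedExpMeasure n) =
      ∏ k, ∫ t, t ^ α k * shiftedExp t := by
  rw [integral_prodShiftedExpMeasure, integral_prod_pow_mul_prodShiftedExp]

theorem integrable_prod_pow_prodShiftedExpMeasure (α : Fin n → ℕ) :
    Integrable (fun z : EucSp n => ∏ k, z k ^ α k) (prodShiftedExpMeasure n) := by
  rw [prodShiftedExpMeasure, integrable_withDensity_iff_integrable_smul'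
    (by have := @measurable_prodShiftedExp n; fun_prop) (by simp)]
  simp_rw [ENNReal.toReal_ofReal (prodShiftedExp_nonneg _), smul_eq_mul,
    mul_comm (prodShiftedExp n _)]
  exact integrable_prod_pow_mul_prodShiftedExp α

instance isProbabilityMeasure_prodShiftedExpMeasure :
    IsProbabilityMeasure (prodShiftedExpMeasure n) := by
  refine ⟨?_⟩
  have h := integral_prod_pow_mul_prodShiftedExp (n := n) 0
  have hi := integrable_prod_pow_mul_prodShiftedExp (n := n) 0
  simp only [Pi.zero_apply, pow_zero, Finset.prod_const_one, one_mul] at h hi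
  rw [prodShiftedExpMeasure, withDensity_apply _ MeasurableSet.univ, setLIntegral_univ,
    ← ofReal_integral_eq_lintegral_ofReal hi (Eventually.of_forall prodShiftedExp_nonneg), h]
  have := integral_pow_zero_mul_shiftedExp
  simp only [pow_zero, one_mul] at this
  simp [this]

theorem prod_pow_single (z : EucSp n) (i : Fin n) (a : ℕ) :
    ∏ k, z k ^ (Pi.single i a : Fin n → ℕ) k = z i ^ a := by
  rw [Finset.prod_eq_single i] <;> simp +contextual

theorem prod_pow_single_add_single (z : EucSp n) (i j : Fin n) (a c : ℕ) :
    ∏ k, z k ^ (Pi.single i a + Pi.single j c : Fin n → ℕ) k = z i ^ a * z j ^ c := by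
  simp_rw [Pi.add_apply, pow_add, Finset.prod_mul_distrib, prod_pow_single]

theorem integral_pow_prodShiftedExpMeasure (i : Fin n) (a : ℕ) :
    ∫ z : EucSp n, z i ^ a ∂(prodShiftedExpMeasure n) = ∫ t, t ^ a * shiftedExp t := by
  simp_rw [← prod_pow_single _ i a]
  rw [integral_prod_pow_prodShiftedExpMeasure, Finset.prod_eq_single i]
  · simp
  · intro k _ hk
    rw [Pi.single_eq_of_ne hk, integral_pow_zero_mul_shiftedExp]
  · simp

theorem integral_mul_pow_prodShiftedExpMeasure {i j : Fin n} (h : i ≠ j) (c : ℕ) :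
    ∫ z : EucSp n, z i ^ 1 * z j ^ c ∂(prodShiftedExpMeasure n) = 0 := by
  simp_rw [← prod_pow_single_add_single]
  rw [integral_prod_pow_prodShiftedExpMeasure]
  refine Finset.prod_eq_zero (Finset.mem_univ i) ?_
  rw [Pi.add_apply, Pi.single_eq_same, Pi.single_eq_of_ne h, add_zero,
    integral_pow_one_mul_shiftedExp]

theorem integrable_pow_prodShiftedExpMeasure (i : Fin n) (a : ℕ) :
    Integrable (fun z : EucSp n => z i ^ a) (prodShiftedExpMeasure n) := by
  simp_rw [← prod_pow_single _ i a]
  exact integrable_prod_pow_prodShiftedExpMeasure _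

theorem integrable_pow_mul_pow_prodShiftedExpMeasure (i j : Fin n) (a c : ℕ) :
    Integrable (fun z : EucSp n => z i ^ a * z j ^ c) (prodShiftedExpMeasure n) := by
  simp_rw [← prod_pow_single_add_single]
  exact integrable_prod_pow_prodShiftedExpMeasure _

theorem isIsotropic_prodShiftedExpMeasure : IsIsotropic (prodShiftedExpMeasure n) := by
  refine ⟨?_, fun u v => ?_⟩
  · by_cases hi : Integrable (fun z : EucSp n => z) (prodShiftedExpMeasure n)
    swap
    · exact integral_undef hi
    refine ext_inner_left ℝ fun u => ?_
    rw [← integral_inner (𝕜 := ℝ) hi, inner_zero_right]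
    simp_rw [EuclideanSpace.inner_eq_star_dotProduct, star_trivial, dotProduct]
    have h1 : ∀ i, Integrable (fun z : EucSp n => z i) (prodShiftedExpMeasure n) := fun i => by
      simpa using integrable_pow_prodShiftedExpMeasure i 1
    rw [integral_finsetSum _ fun i _ => (h1 i).mul_const _]
    refine Finset.sum_eq_zero fun i _ => ?_
    have := integral_pow_prodShiftedExpMeasure i 1
    rw [integral_pow_one_mul_shiftedExp] at this
    simp only [pow_one] at this
    rw [integral_mul_const, this, zero_mul]
  · have e : ∀ z : EucSp n, ⟪z, u⟫ * ⟪z, v⟫ = ∑ i, ∑ j, u i * v j * (z i ^ 1 * z j ^ 1) := fun z => by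
      simp_rw [EuclideanSpace.inner_eq_star_dotProduct, star_trivial, dotProduct,
        Finset.sum_mul_sum, pow_one]
      exact Finset.sum_congr rfl fun i _ => Finset.sum_congr rfl fun j _ => by ring
    have hint : ∀ i j, Integrable (fun z : EucSp n => u i * v j * (z i ^ 1 * z j ^ 1))
      (prodShiftedExpMeasure n) := fun i j =>
        (integrable_pow_mul_pow_prodShiftedExpMeasure i j 1 1).const_mul _
    simp_rw [e]
    rw [integral_finsetSum _ fun i _ => integrable_finsetSum _ fun j _ => hint i j,
      EuclideanSpace.inner_eq_star_dotProduct, star_trivial, dotProduct]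
    refine Finset.sum_congr rfl fun i _ => ?_
    rw [integral_finsetSum _ fun j _ => hint i j, Finset.sum_eq_single i]
    · have := integral_pow_prodShiftedExpMeasure i 2
      rw [integral_pow_two_mul_shiftedExp] at this
      simp_rw [integral_const_mul, ← pow_add]
      rw [this]; ring
    · intro j _ hj
      rw [integral_const_mul, integral_mul_pow_prodShiftedExpMeasure hj.symm, mul_zero]
    · simp

theorem inner_integral_norm_sq_smul_prodShiftedExpMeasure (hn : 0 < n) :
    ⟪(WithLp.toLp 2 fun _ => 1 : EucSp n),
      ∫ z, ‖z‖ ^ 2 • z ∂(prodShiftedExpMeasure n)⟫ = 2 * n := by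
  rw [← integral_inner (𝕜 := ℝ) (integrable_norm_sq_smul hn isIsotropic_prodShiftedExpMeasure
    ⟨_, isLogConcaveFn_prodShiftedExp, rfl⟩)]
  have e : ∀ z : EucSp n, ⟪(WithLp.toLp 2 fun _ => 1 : EucSp n), ‖z‖ ^ 2 • z⟫ =
      ∑ i, ∑ j, z i ^ 1 * z j ^ 2 := fun z => by
    rw [inner_smul_right, EuclideanSpace.real_norm_sq_eq, EuclideanSpace.inner_eq_star_dotProduct,
      star_trivial, dotProduct, mul_comm, Finset.sum_mul_sum]
    simp
  simp_rw [e]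
  rw [integral_finsetSum _ fun i _ => integrable_finsetSum _ fun j _ =>
    integrable_pow_mul_pow_prodShiftedExpMeasure i j 1 2]
  have h2 : ∀ i : Fin n, ∫ z : EucSp n, ∑ j, z i ^ 1 * z j ^ 2 ∂(prodShiftedExpMeasure n) = 2 := by
    intro i
    rw [integral_finsetSum _ fun j _ => integrable_pow_mul_pow_prodShiftedExpMeasure i j 1 2,
      Finset.sum_eq_single i]
    · simp_rw [← pow_add]
      rw [integral_pow_prodShiftedExpMeasure, integral_pow_three_mul_shiftedExp]
    · intro j _ hj
      exact integral_mul_pow_prodShiftedExpMeasure hj.symm 2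
    · simp
  simp_rw [h2]
  simp [mul_comm]

theorem two_le_sigmaBar (hn : 0 < n) : 2 ≤ sigmaBar n := by
  have hn' : (0 : ℝ) < n := by exact_mod_cast hn
  have h1 := norm_integral_norm_sq_smul_le hn (isIsotropic_prodShiftedExpMeasure (n := n))
    ⟨_, isLogConcaveFn_prodShiftedExp, rfl⟩
  have h2 := real_inner_le_norm (WithLp.toLp 2 fun _ => 1 : EucSp n)
    (∫ z, ‖z‖ ^ 2 • z ∂(prodShiftedExpMeasure n))
  rw [inner_integral_norm_sq_smul_prodShiftedExpMeasure hn] at h2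
  have h3 : ‖(WithLp.toLp 2 fun _ => 1 : EucSp n)‖ = √n := by
    rw [EuclideanSpace.norm_eq]; simp
  rw [h3] at h2
  have h4 : 2 * (n : ℝ) ≤ n * sigmaBar n := by
    calc 2 * (n : ℝ) ≤ √n * (√n * sigmaBar n) :=
          h2.trans (mul_le_mul_of_nonneg_left h1 (sqrt_nonneg _))
      _ = _ := by rw [← mul_assoc, mul_self_sqrt hn'.le]
  nlinarith

end ShiftedExponential

section Translation
variable {κ : Type*} [Fintype κ] {f : (κ → ℝ) → ℝ}

namespace IsRegularDensity

theorem comp_add_right (hf : IsRegularDensity f) (b : κ → ℝ) :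
    IsRegularDensity fun x => f (x + b) := by
  refine ⟨fun x => hf.nonneg _, fun x y l hl => ?_, ?_, ?_, ?_, ?_⟩
  · have h := hf.logConcave (x + b) (y + b) l hl
    rwa [show (1 - l) • (x + b) + l • (y + b) = (1 - l) • x + l • y + b by module] at h
  · exact hf.isOpen.preimage (continuous_id.add continuous_const)
  · exact hf.measurable.comp (measurable_id.add_const b)
  · obtain ⟨R, hR, h⟩ := hf.bounded
    refine ⟨R + ‖b‖, by positivity, fun x hx => ?_⟩
    have h1 := norm_sub_le (x + b) b
    rw [add_sub_cancel_right] at h1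
    linarith [h _ hx]
  · rw [integral_add_right_eq_self f b, hf.integral_eq_one]

theorem tiltMean_zero (hf : IsRegularDensity f) (g : (κ → ℝ) → ℝ) :
    tiltMean f g 0 = ∫ x, g x * f x := by
  rw [tiltMean, hf.tilt_zero]

theorem tiltMean_comp_add_right (hf : IsRegularDensity f) (b : κ → ℝ) (g : (κ → ℝ) → ℝ) :
    tiltMean (fun x => f (x + b)) g 0 = tiltMean f (fun y => g (y - b)) 0 := by
  rw [hf.tiltMean_zero, (hf.comp_add_right b).tiltMean_zero,
    ← integral_add_right_eq_self (fun y => g (y - b) * f y) b]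
  simp

theorem tiltBary_comp_add_right (hf : IsRegularDensity f) :
    tiltBary (fun x => f (x + tiltBary f 0)) 0 = 0 := by
  ext i
  rw [tiltBary, hf.tiltMean_comp_add_right, hf.tiltMean_zero]
  simp only [Pi.sub_apply, Pi.zero_apply, sub_mul]
  rw [integral_sub (hf.integrable_mul (by fun_prop)) (hf.integrable.const_mul _),
    integral_const_mul, hf.integral_eq_one, ← hf.tiltMean_zero, tiltBary, mul_one, sub_self]

theorem tiltCov_comp_add_right (hf : IsRegularDensity f) :
    tiltCov (fun x => f (x + tiltBary f 0)) 0 = tiltCov f 0 := by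
  ext i j
  rw [(hf.comp_add_right _).tiltCov_apply, hf.tiltCov_apply, hf.tiltBary_comp_add_right,
    hf.tiltMean_comp_add_right]
  simp

/-- Bound for the maximum of a regular density in terms of its covariance. -/
theorem sq_apply_mul_det_le [DecidableEq κ] (hf : IsRegularDensity f) {σ : ℝ}
    (hσ : HasThirdMomentBound (fun x => f (x + tiltBary f 0)) σ) (x : κ → ℝ) :
    f x ^ 2 * (tiltCov f 0).det ≤ (2048 * (2 + σ ^ 2 / 4)) ^ Fintype.card κ := by
  have hk := hf.comp_add_right (tiltBary f 0)
  have h1 := hk.sq_apply_zero_mul_det_le hf.tiltBary_comp_add_right hσ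
  rw [hf.tiltCov_comp_add_right, zero_add] at h1
  have h2 := hk.le_four_pow_mul_of_barycenter (b := 0) (fun i => by
    rw [← hk.tiltMean_zero fun x => x i]
    exact congrFun hf.tiltBary_comp_add_right i) (x - tiltBary f 0)
  simp only [sub_add_cancel, zero_add] at h2
  have h3 : f x ^ 2 ≤ (4 ^ Fintype.card κ * f (tiltBary f 0)) ^ 2 :=
    pow_le_pow_left₀ (hf.nonneg x) h2 2
  calc f x ^ 2 * (tiltCov f 0).det
      ≤ (4 ^ Fintype.card κ * f (tiltBary f 0)) ^ 2 * (tiltCov f 0).det :=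
        mul_le_mul_of_nonneg_right h3 (hf.tiltCov_posDef 0).det_pos.le
    _ = 16 ^ Fintype.card κ * (f (tiltBary f 0) ^ 2 * (tiltCov f 0).det) := by
        rw [mul_pow, ← pow_mul, mul_comm _ 2, pow_mul]; norm_num; ring
    _ ≤ 16 ^ Fintype.card κ * (128 * (2 + σ ^ 2 / 4)) ^ Fintype.card κ := by gcongr
    _ = _ := by rw [← mul_pow]; congr 1; ring

end IsRegularDensity
end Translation

section Truncation
variable {κ : Type*} [Fintype κ] {G : (κ → ℝ) → ℝ}

theorem isRegularDensity_indicator_ball (hG0 : ∀ x, 0 ≤ G x)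
    (hGl : ∀ x y, ∀ l ∈ Icc (0 : ℝ) 1, G x ^ (1 - l) * G y ^ l ≤ G ((1 - l) • x + l • y))
    (hGo : IsOpen {x | 0 < G x}) (hGm : Measurable G) {R : ℝ} (hR : 0 ≤ R)
    (hpos : 0 < ∫ x in Metric.ball 0 R, G x) :
    IsRegularDensity fun x =>
      (∫ x in Metric.ball 0 R, G x)⁻¹ * (Metric.ball 0 R).indicator G x := by
  set m := ∫ x in Metric.ball 0 R, G x with hm
  have hm' : 0 < m⁻¹ := inv_pos.2 hpos
  refine ⟨fun x => mul_nonneg hm'.le (indicator_nonneg (fun x _ => hG0 x) x), fun x y l hl => ?_,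
    ?_, ?_, ⟨R, hR, fun x hx => ?_⟩, ?_⟩
  · have hn : ∀ x, 0 ≤ (Metric.ball 0 R).indicator G x := indicator_nonneg (fun x _ => hG0 x)
    rw [mul_rpow hm'.le (hn _), mul_rpow hm'.le (hn _)]
    have key : (Metric.ball 0 R).indicator G x ^ (1 - l) * (Metric.ball 0 R).indicator G y ^ l ≤
        (Metric.ball 0 R).indicator G ((1 - l) • x + l • y) := by
      rcases hl.1.eq_or_lt with rfl | h0
      · simp
      rcases hl.2.eq_or_lt with rfl | h1
      · simp
      by_cases hx : x ∈ Metric.ball (0 : κ → ℝ) R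
      swap
      · rw [indicator_of_notMem hx, zero_rpow (by linarith), zero_mul]; exact hn _
      by_cases hy : y ∈ Metric.ball (0 : κ → ℝ) R
      swap
      · rw [indicator_of_notMem hy, zero_rpow h0.ne', mul_zero]; exact hn _
      rw [indicator_of_mem hx, indicator_of_mem hy, indicator_of_mem
        (convex_ball (0 : κ → ℝ) R hx hy (by linarith) h0.le (by ring))]
      exact hGl x y l hl
    calc _ = m⁻¹ ^ (1 - l) * m⁻¹ ^ l *
          ((Metric.ball 0 R).indicator G x ^ (1 - l) * (Metric.ball 0 R).indicator G y ^ l) := by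
            ring
      _ = m⁻¹ * ((Metric.ball 0 R).indicator G x ^ (1 - l) *
          (Metric.ball 0 R).indicator G y ^ l) := by
            rw [← rpow_add hm', sub_add_cancel, rpow_one]
      _ ≤ _ := mul_le_mul_of_nonneg_left key hm'.le
  · have : {x | 0 < m⁻¹ * (Metric.ball 0 R).indicator G x} = Metric.ball 0 R ∩ {x | 0 < G x} := by
      ext x
      rw [Set.mem_ofPred_eq, mul_pos_iff_of_pos_left hm']
      by_cases hx : x ∈ Metric.ball (0 : κ → ℝ) R
      · rw [indicator_of_mem hx]; exact ⟨fun h => ⟨hx, h⟩, fun h => h.2⟩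
      · rw [indicator_of_notMem hx]; exact ⟨fun h => absurd h (lt_irrefl _), fun h => absurd h.1 hx⟩
    rw [this]
    exact Metric.isOpen_ball.inter hGo
  · exact (hGm.indicator measurableSet_ball).const_mul _
  · by_contra hcon
    refine hx ?_
    rw [indicator_of_notMem (by simp; linarith), mul_zero]
  · rw [integral_const_mul, integral_indicator measurableSet_ball, ← hm, inv_mul_cancel₀ hpos.ne']

theorem tendsto_setIntegral_ball_nat {F : (κ → ℝ) → ℝ} (hF : Integrable F) :
    Tendsto (fun R : ℕ => ∫ x in Metric.ball 0 (R : ℝ), F x) atTop (𝓝 (∫ x, F x)) := by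
  have h := tendsto_setIntegral_of_monotone (μ := volume) (f := F)
    (s := fun R : ℕ => Metric.ball (0 : κ → ℝ) (R : ℝ)) (fun R => measurableSet_ball)
    (fun R S h => Metric.ball_subset_ball (by exact_mod_cast h)) hF.integrableOn
  rwa [Metric.iUnion_ball_nat, setIntegral_univ] at h

/-- An upper bound for a log-concave density with zero mean and identity covariance. -/
theorem sq_apply_le_of_isotropic [DecidableEq κ] (hG0 : ∀ x, 0 ≤ G x)
    (hGl : ∀ x y, ∀ l ∈ Icc (0 : ℝ) 1, G x ^ (1 - l) * G y ^ l ≤ G ((1 - l) • x + l • y))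
    (hGo : IsOpen {x | 0 < G x}) (hGm : Measurable G) (hGi : Integrable G)
    (hG1 : ∫ x, G x = 1) (hi1 : ∀ i, Integrable fun x => x i * G x)
    (hi2 : ∀ i j, Integrable fun x => x i * x j * G x) (hm1 : ∀ i, ∫ x, x i * G x = 0)
    (hm2 : ∀ i j, ∫ x, x i * x j * G x = if i = j then 1 else 0) {σ : ℝ}
    (hσ : ∀ f : (κ → ℝ) → ℝ, IsRegularDensity f → HasThirdMomentBound f σ) (x₀ : κ → ℝ) :
    G x₀ ^ 2 ≤ (2048 * (2 + σ ^ 2 / 4)) ^ Fintype.card κ := by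
  set m : ℕ → ℝ := fun R => ∫ x in Metric.ball 0 (R : ℝ), G x with hm
  set p : ℕ → κ → ℝ := fun R i => (m R)⁻¹ * ∫ x in Metric.ball 0 (R : ℝ), x i * G x with hp
  set A : ℕ → Matrix κ κ ℝ := fun R => Matrix.of fun i j =>
    (m R)⁻¹ * (∫ x in Metric.ball 0 (R : ℝ), x i * x j * G x) - p R i * p R j with hA
  have hmt : Tendsto m atTop (𝓝 1) := hG1 ▸ tendsto_setIntegral_ball_nat hGi
  have hmi : Tendsto (fun R => (m R)⁻¹) atTop (𝓝 1) := by
    simpa using hmt.inv₀ one_ne_zero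
  have hpt : ∀ i, Tendsto (fun R => p R i) atTop (𝓝 0) := fun i => by
    simpa [hm1] using hmi.mul (tendsto_setIntegral_ball_nat (hi1 i))
  have hAt : Tendsto A atTop (𝓝 1) := by
    refine tendsto_pi_nhds.2 fun i => tendsto_pi_nhds.2 fun j => ?_
    have h := (hmi.mul (tendsto_setIntegral_ball_nat (hi2 i j))).sub ((hpt i).mul (hpt j))
    rw [hm2, one_mul, mul_zero, sub_zero] at h
    exact h
  have hdet : Tendsto (fun R => (A R).det) atTop (𝓝 1) := by
    have : Continuous fun M : Matrix κ κ ℝ => M.det := continuous_id.matrix_det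
    have h := (this.tendsto 1).comp hAt
    rw [Matrix.det_one] at h
    exact h
  have hlim : Tendsto (fun R => ((m R)⁻¹ * G x₀) ^ 2 * (A R).det) atTop (𝓝 (G x₀ ^ 2)) := by
    simpa using ((hmi.mul_const (G x₀)).pow 2).mul hdet
  refine le_of_tendsto hlim ?_
  obtain ⟨N, hN⟩ := exists_nat_gt ‖x₀‖
  filter_upwards [hmt.eventually (lt_mem_nhds zero_lt_one), eventually_ge_atTop N] with R hR hRN
  have hreg := isRegularDensity_indicator_ball hG0 hGl hGo hGm R.cast_nonneg hR
  have hx₀ : x₀ ∈ Metric.ball (0 : κ → ℝ) (R : ℝ) := by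
    rw [mem_ball_zero_iff]
    exact hN.trans_le (by exact_mod_cast hRN)
  have hmean : ∀ q : (κ → ℝ) → ℝ, tiltMean (fun x => (∫ x in Metric.ball 0 (R : ℝ), G x)⁻¹ *
      (Metric.ball 0 (R : ℝ)).indicator G x) q 0 =
        (m R)⁻¹ * ∫ x in Metric.ball 0 (R : ℝ), q x * G x := fun q => by
    rw [hreg.tiltMean_zero, ← integral_indicator (f := fun x => q x * G x) measurableSet_ball,
      ← integral_const_mul]
    refine integral_congr_ae (Eventually.of_forall fun x => ?_)
    beta_reduce
    rw [indicator_mul_right _ q, mul_left_comm]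
  have hcov : tiltCov (fun x => (∫ x in Metric.ball 0 (R : ℝ), G x)⁻¹ *
      (Metric.ball 0 (R : ℝ)).indicator G x) 0 = A R := by
    ext i j
    simp only [tiltCov, tiltBary, Matrix.of_apply, hmean, hA, hp]
  have h := hreg.sq_apply_mul_det_le (hσ _ (hreg.comp_add_right _)) x₀
  rwa [hcov, indicator_of_mem hx₀] at h

end Truncation

section HyperplaneBound
variable {n : ℕ}

theorem IsIsotropic.integrable_apply {μ : Measure (EucSp n)} [IsProbabilityMeasure μ]
    (h : IsIsotropic μ) (i : Fin n) : Integrable (fun x : EucSp n => x i) μ := by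
  refine ((integrable_const (1 : ℝ)).add (h.integrable_sq i)).mono'
    (by fun_prop) (Eventually.of_forall fun x => ?_)
  rw [norm_eq_abs, Pi.add_apply]
  nlinarith [sq_abs (x i), sq_nonneg (|x i| - 1)]

theorem IsIsotropic.integrable_mul {μ : Measure (EucSp n)}
    (h : IsIsotropic μ) (i j : Fin n) : Integrable (fun x : EucSp n => x i * x j) μ := by
  refine ((h.integrable_sq i).add (h.integrable_sq j)).mono'
    (by fun_prop) (Eventually.of_forall fun x => ?_)
  rw [norm_eq_abs, Pi.add_apply, abs_mul]
  nlinarith [sq_abs (x i), sq_abs (x j), sq_nonneg (|x i| - |x j|), abs_nonneg (x i),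
    abs_nonneg (x j), mul_nonneg (abs_nonneg (x i)) (abs_nonneg (x j))]

theorem IsIsotropic.integral_apply {μ : Measure (EucSp n)} [IsProbabilityMeasure μ]
    (h : IsIsotropic μ) (i : Fin n) : ∫ x : EucSp n, x i ∂μ = 0 := by
  have hint : Integrable (fun x : EucSp n => x) μ := by
    refine ((integrable_const (1 : ℝ)).add h.integrable_norm_sq).mono'
      (by fun_prop) (Eventually.of_forall fun x => ?_)
    rw [Pi.add_apply]
    nlinarith [sq_nonneg (‖x‖ - 1)]
  have := (EuclideanSpace.proj (𝕜 := ℝ) i : EucSp n →L[ℝ] ℝ).integral_comp_comm hint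
  rw [h.1, map_zero] at this
  exact this

theorem density_le_of_isIsotropic (hn : 0 < n) {μ : Measure (EucSp n)} [IsProbabilityMeasure μ]
    (hμ : IsIsotropic μ) {f : EucSp n → ℝ} (hf : IsLogConcaveFn f)
    (hd : μ = volume.withDensity fun x => ENNReal.ofReal (f x)) (x : EucSp n) :
    f x ≤ √((2048 * (2 + sigmaBar n ^ 2 / 4)) ^ n) := by
  obtain ⟨g, hg, hgm, hgo, hgf, hle⟩ := hf.exists_open_version
  have hd' : μ = volume.withDensity fun x => ENNReal.ofReal (g x) := by
    rw [hd]
    refine withDensity_congr_ae ?_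
    filter_upwards [hgf] with x hx
    rw [hx]
  have hgm' : Measurable fun x => ENNReal.ofReal (g x) := by fun_prop
  have hmp := PiLp.volume_preserving_toLp (Fin n)
  have hemb : MeasurableEmbedding (WithLp.toLp 2 : (Fin n → ℝ) → EucSp n) :=
    (MeasurableEquiv.toLp 2 (Fin n → ℝ)).measurableEmbedding
  have hint : ∀ F : EucSp n → ℝ, ∫ z, F z ∂μ =
      ∫ y : Fin n → ℝ, F (WithLp.toLp 2 y) * g (WithLp.toLp 2 y) := fun F => by
    rw [hd', integral_withDensity_eq_integral_toReal_smul hgm' (by simp), hmp.integral_comp hemb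
      (fun z => F z * g z)]
    simp_rw [ENNReal.toReal_ofReal (hg.1 _), smul_eq_mul, mul_comm (g _)]
  have hinteg : ∀ F : EucSp n → ℝ, Integrable F μ →
      Integrable fun y : Fin n → ℝ => F (WithLp.toLp 2 y) * g (WithLp.toLp 2 y) := fun F hF => by
    rw [hd', integrable_withDensity_iff_integrable_smul' hgm' (by simp)] at hF
    simp_rw [ENNReal.toReal_ofReal (hg.1 _), smul_eq_mul, mul_comm (g _)] at hF
    exact (hmp.integrable_comp_emb hemb (g := fun z => F z * g z)).2 hF
  have hbound : ∀ z, g z ≤ √((2048 * (2 + sigmaBar n ^ 2 / 4)) ^ n) := by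
    intro z
    refine Real.le_sqrt_of_sq_le ?_
    have h := sq_apply_le_of_isotropic (G := fun y : Fin n → ℝ => g (WithLp.toLp 2 y))
      (fun y => hg.1 _) (fun x y l hl => hg.2 (WithLp.toLp 2 x) (WithLp.toLp 2 y) l hl)
      (hgo.preimage (PiLp.continuous_toLp 2 _)) (hgm.comp hemb.measurable)
      (by simpa using hinteg (fun _ => 1) (integrable_const 1))
      (by simpa using (hint fun _ => 1).symm)
      (fun i => hinteg (fun z => z i) (hμ.integrable_apply i))
      (fun i j => hinteg (fun z => z i * z j) (hμ.integrable_mul i j))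
      (fun i => (hint fun z => z i).symm.trans (hμ.integral_apply i))
      (fun i j => (hint fun z => z i * z j).symm.trans (hμ.integral_mul i j))
      (fun k hk => hk.hasThirdMomentBound hn) (WithLp.ofLp z)
    simpa using h
  refine hle _ ?_ hbound x
  by_contra! hcon
  have h0 : μ = 0 := by
    rw [hd']
    have : (fun x => ENNReal.ofReal (g x)) = 0 := by
      ext x; simp [ENNReal.ofReal_of_nonpos (hcon x)]
    rw [this, withDensity_zero]
  exact IsProbabilityMeasure.ne_zero μ h0

theorem density_zero_rpow_le (hn : 0 < n) {μ : Measure (EucSp n)} [IsProbabilityMeasure μ]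
    (hμ : IsIsotropic μ) {f : EucSp n → ℝ} (hf : IsLogConcaveFn f)
    (hd : μ = volume.withDensity fun x => ENNReal.ofReal (f x)) :
    f 0 ^ ((n : ℝ)⁻¹) ≤ 46 * sigmaBar n := by
  have h2 := two_le_sigmaBar hn
  have h : f 0 ≤ (46 * sigmaBar n) ^ n := by
    refine (density_le_of_isIsotropic hn hμ hf hd 0).trans ?_
    refine Real.sqrt_le_iff.2 ⟨by positivity, ?_⟩
    rw [← pow_mul, mul_comm n, pow_mul]
    refine pow_le_pow_left₀ (by positivity) ?_ n
    nlinarith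
  calc f 0 ^ ((n : ℝ)⁻¹) ≤ ((46 * sigmaBar n) ^ n) ^ ((n : ℝ)⁻¹) :=
        rpow_le_rpow (hf.1 0) h (by positivity)
    _ = _ := pow_rpow_inv_natCast (by positivity) hn.ne'

theorem LN_le (hn : 0 < n) : LN n ≤ 46 * sigmaBar n := by
  refine Real.sSup_le ?_ (by linarith [two_le_sigmaBar hn])
  rintro _ ⟨μ, f, hμ, hi, hf, hd, rfl⟩
  exact density_zero_rpow_le hn hi hf hd

end HyperplaneBound

/-- There exists a universal constant C > 0 such that for every dimension n ≥ 1,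
L_n ≤ C σ̲_n. -/
theorem hyperplane_bound_from_sigmaBar :
    ∃ C : ℝ, 0 < C ∧ ∀ n : ℕ, 1 ≤ n → LN n ≤ C * sigmaBar n := by
  exact ⟨46, by norm_num, fun n hn => LN_le hn⟩
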